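/- Let n ≥ 1 be an integer and d = 1 + n. For every ε > 0 there is a constant C = C(ε, n) > 0 such that for all λ ≥ 1, all dyadic integers N₁ ≥ N₂ ≥ 1 (i.e. N₁, N₂ ∈ 2^ℕ), and all g₁, g₂ : ℝ×(1/λ)ℤⁿ → ℂ with gⱼ supported in {k : |k| ≤ 2Nⱼ, and moreover |k| ≥ Nⱼ/2 when Nⱼ > 1}, the free waves uⱼ = U_λ gⱼ satisfy (∑_{γ∈ℤ} ‖u₁ u₂‖⁴_{L²(ℝ×𝕋ⁿ_λ×[γ,γ+1])})^{1/4} ≤ C N₂^ε K(λ,N₁,N₂)^{1/2} ‖g₁‖_{L²_λ} ‖g₂‖_{L²_λ}, where K(λ,N₁,N₂) := 1/λ + N₂/N₁ if n = 1, and K(λ,N₁,N₂) := N₂^{d−3}/λ + N₂^{d−1}/N₁ if n ≥ 2. -/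

import Mathlib

noncomputable section
open MeasureTheory
open scoped ENNReal NNReal Classical

/-- `|k|` for `k = (ζ, j/λ) ∈ ℝ^m × (1/λ)ℤⁿ`. -/
def freqNorm (lam : ℝ) {m n : ℕ} (ζ : Fin m → ℝ) (j : Fin n → ℤ) : ℝ :=
  Real.sqrt ((∑ i, (ζ i) ^ 2) + ∑ i, ((j i : ℝ) / lam) ^ 2)

/-- The free Schrödinger wave `(U_λ g)(t, x, y) = ∫ g(k) e^{i(z·k − t|k|²)} (dk)_λ`
on `ℝ^m × 𝕋ⁿ_λ`, where `g ζ j` stands for `g (ζ, j/λ)`. -/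
def waveU (lam : ℝ) {m n : ℕ} (g : (Fin m → ℝ) → (Fin n → ℤ) → ℂ)
    (t : ℝ) (x : Fin m → ℝ) (y : Fin n → ℝ) : ℂ :=
  ((1 / lam ^ n : ℝ) : ℂ) * ∑' j : Fin n → ℤ, ∫ ζ : Fin m → ℝ,
    g ζ j * Complex.exp (Complex.I *
      ((((∑ i, x i * ζ i) + ∑ i, y i * ((j i : ℝ) / lam))
        - t * ((∑ i, (ζ i) ^ 2) + ∑ i, ((j i : ℝ) / lam) ^ 2) : ℝ) : ℂ))

/-- Squared `L²_λ` norm of Fourier data on `ℝ^m × (1/λ)ℤⁿ`. -/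
def l2sq (lam : ℝ) {m n : ℕ} (g : (Fin m → ℝ) → (Fin n → ℤ) → ℂ) : ℝ≥0∞ :=
  ENNReal.ofReal (1 / lam ^ n) * ∑' j : Fin n → ℤ, ∫⁻ ζ : Fin m → ℝ, (‖g ζ j‖₊ : ℝ≥0∞) ^ 2

/-- `N` is a dyadic integer, i.e. `N ∈ 2^ℕ`. -/
def IsDyadic (N : ℝ) : Prop := ∃ a : ℕ, N = 2 ^ a

/-- `g` is supported in `{k : |k| ≤ 2N, and moreover |k| ≥ N/2 when N > 1}`. -/
def SuppIn (lam : ℝ) {m n : ℕ} (g : (Fin m → ℝ) → (Fin n → ℤ) → ℂ) (N : ℝ) : Prop :=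
  ∀ ζ j, g ζ j ≠ 0 → freqNorm lam ζ j ≤ 2 * N ∧ (1 < N → N / 2 ≤ freqNorm lam ζ j)

/-- One period box of the torus `𝕋ⁿ_λ`. -/
def torusBox (lam : ℝ) (n : ℕ) : Set (Fin n → ℝ) :=
  Set.Icc 0 (fun _ => 2 * Real.pi * lam)

-- part A
open MeasureTheory
open scoped ENNReal NNReal

lemma card_le_of_diam (T : Finset ℤ) (L : ℝ) (hL : 0 ≤ L)
    (h : ∀ x ∈ T, ∀ y ∈ T, |(x:ℝ) - y| ≤ L) : (T.card : ℝ) ≤ L + 1 := by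
  rcases T.eq_empty_or_nonempty with rfl | hne
  · simp; linarith
  · have hsub : T ⊆ Finset.Icc (T.min' hne) (T.min' hne + ⌊L⌋) := by
      intro x hx
      rw [Finset.mem_Icc]
      refine ⟨Finset.min'_le _ _ hx, ?_⟩
      have h1 := h x hx _ (Finset.min'_mem T hne)
      have h2 : ((x - T.min' hne : ℤ) : ℝ) ≤ L := by
        push_cast; exact (le_abs_self _).trans h1
      have := Int.le_floor.mpr h2
      linarith
    have hc := Finset.card_le_card hsub
    rw [Int.card_Icc] at hc
    have h0 : 0 ≤ ⌊L⌋ := Int.floor_nonneg.mpr hL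
    have h3 : (T.card : ℤ) ≤ ⌊L⌋ + 1 := by
      have : ((T.min' hne + ⌊L⌋ + 1 - T.min' hne).toNat : ℤ) = ⌊L⌋ + 1 := by
        rw [Int.toNat_of_nonneg] <;> linarith
      rw [← this]; exact_mod_cast hc
    have h4 : (T.card : ℝ) ≤ (⌊L⌋ : ℝ) + 1 := by exact_mod_cast h3
    linarith [Int.floor_le L]

lemma card_box_fiber {n : ℕ} (T : Finset (Fin n → ℤ)) (P : Finset (Fin n)) (L B : ℝ) (hL : 0 ≤ L)
    (h : ∀ x ∈ T, ∀ y ∈ T, ∀ i, |(x i:ℝ) - y i| ≤ L)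
    (hf : ∀ T' : Finset (Fin n → ℤ), T' ⊆ T → (∀ x ∈ T', ∀ y ∈ T', ∀ i ∉ P, x i = y i) →
      (T'.card : ℝ) ≤ B) : (T.card : ℝ) ≤ (L + 1) ^ (n - P.card) * B := by
  classical
  have hB : 0 ≤ B := by simpa using hf ∅ (by simp) (by simp)
  let f : (Fin n → ℤ) → (Fin n → ℤ) := fun x i => if i ∈ P then 0 else x i
  have hN : ∀ b ∈ T.image f, (T.filter (fun a => f a = b)).card ≤ ⌊B⌋₊ := by
    intro b _
    apply Nat.le_floor
    apply hf _ (Finset.filter_subset _ _)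
    intro x hx y hy i hi
    have h1 : f x = f y := by
      rw [(Finset.mem_filter.mp hx).2, (Finset.mem_filter.mp hy).2]
    have := congrFun h1 i
    simpa [f, hi] using this
  have h1 := Finset.card_le_mul_card_image T ⌊B⌋₊ hN
  have h2 : T.image f ⊆ Fintype.piFinset
      (fun i => if i ∈ P then ({0} : Finset ℤ) else T.image (fun x => x i)) := by
    intro y hy
    obtain ⟨x, hx, rfl⟩ := Finset.mem_image.mp hy
    rw [Fintype.mem_piFinset]
    intro i
    by_cases hi : i ∈ P
    · simp [f, hi]
    · simp only [f, hi, if_false]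
      exact Finset.mem_image_of_mem (fun x : Fin n → ℤ => x i) hx
  have h3 := Finset.card_le_card h2
  rw [Fintype.card_piFinset] at h3
  have h4 : ((∏ i, (if i ∈ P then ({0} : Finset ℤ) else T.image (fun x => x i)).card : ℕ) : ℝ)
      ≤ (L+1)^(n - P.card) := by
    push_cast
    have : (L+1)^(n - P.card) = ∏ i : Fin n, (if i ∈ P then (1:ℝ) else L + 1) := by
      rw [Finset.prod_ite]
      simp only [Finset.prod_const_one, Finset.prod_const, one_mul]
      congr 1
      have := Finset.card_compl P
      rw [Fintype.card_fin] at this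
      rw [← this]
      congr 1
      ext i; simp
    rw [this]
    apply Finset.prod_le_prod
    · intros; positivity
    · intro i _
      split_ifs with hi
      · simp
      · apply card_le_of_diam _ _ hL
        intro a ha b hb
        obtain ⟨x, hx, rfl⟩ := Finset.mem_image.mp ha
        obtain ⟨y, hy, rfl⟩ := Finset.mem_image.mp hb
        exact h x hx y hy i
  calc (T.card : ℝ) ≤ ((⌊B⌋₊ * (T.image f).card : ℕ) : ℝ) := by exact_mod_cast h1
    _ = (⌊B⌋₊ : ℝ) * ((T.image f).card : ℝ) := by push_cast; ring
    _ ≤ B * (L+1)^(n - P.card) := by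
        apply mul_le_mul (Nat.floor_le hB) _ (by positivity) hB
        exact le_trans (by exact_mod_cast h3) h4
    _ = _ := by ring

lemma card_fiber_one {n : ℕ} (T : Finset (Fin n → ℤ)) (p : Fin n) (L : ℝ) (hL : 0 ≤ L)
    (hag : ∀ x ∈ T, ∀ y ∈ T, ∀ i, i ≠ p → x i = y i)
    (h : ∀ x ∈ T, ∀ y ∈ T, |(x p:ℝ) - y p| ≤ L) : (T.card : ℝ) ≤ L + 1 := by
  classical
  have h1 : (T.image (fun x => x p)).card = T.card := by
    apply Finset.card_image_of_injOn
    intro x hx y hy hxy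
    funext i
    by_cases hi : i = p
    · subst hi; exact hxy
    · exact hag x hx y hy i hi
  rw [← h1]
  apply card_le_of_diam _ _ hL
  intro a ha b hb
  obtain ⟨x, hx, rfl⟩ := Finset.mem_image.mp ha
  obtain ⟨y, hy, rfl⟩ := Finset.mem_image.mp hb
  exact h x hx y hy

lemma sum_diff_one {n : ℕ} (f g : Fin n → ℝ) (p : Fin n) (h : ∀ i, i ≠ p → f i = g i) :
    ∑ i, f i - ∑ i, g i = f p - g p := by
  rw [← Finset.sum_sub_distrib]
  rw [Finset.sum_eq_single p]
  · intro i _ hi; rw [h i hi]; ring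
  · simp

/-- line count -/
lemma card_line {n : ℕ} (T : Finset (Fin n → ℤ)) (p : Fin n) (V : Fin n → ℝ) (D H : ℝ)
    (hD : 0 < D) (hH : 0 ≤ H) (hT : ∀ x ∈ T, ∀ i, |(x i:ℝ)| ≤ D)
    (hV : 4 * D ≤ |V p|)
    (hq : ∀ x ∈ T, |∑ i, (x i:ℝ) * (V i - x i)| ≤ H) :
    (T.card : ℝ) ≤ (2 * D + 1) ^ (n - 1) * (4 * H / |V p| + 1) := by
  have hVp : 0 < |V p| := by linarith
  have := card_box_fiber T {p} (2*D) (4 * H / |V p| + 1) (by linarith)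
    (by
      intro x hx y hy i
      have := abs_sub (x i:ℝ) (y i)
      linarith [hT x hx i, hT y hy i]) ?_
  · simpa using this
  intro T' hT' hag
  apply card_fiber_one T' p _ (by positivity)
  · intro x hx y hy i hi; exact hag x hx y hy i (by simpa using hi)
  intro x hx y hy
  have hs := sum_diff_one (fun i => (x i:ℝ) * (V i - x i)) (fun i => (y i:ℝ) * (V i - y i)) p
    (by intro i hi; rw [hag x hx y hy i (by simpa using hi)])
  have h1 := hq x (hT' hx)
  have h2 := hq y (hT' hy)
  have h3 : |(x p:ℝ) * (V p - x p) - (y p:ℝ) * (V p - y p)| ≤ 2 * H := by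
    rw [← hs]; exact (abs_sub _ _).trans (by linarith)
  have h4 : (x p:ℝ) * (V p - x p) - (y p:ℝ) * (V p - y p) = ((x p:ℝ) - y p) * (V p - (x p + y p)) := by
    ring
  rw [h4, abs_mul] at h3
  have h5 : |V p| / 2 ≤ |V p - ((x p:ℝ) + y p)| := by
    have e1 := abs_sub_abs_le_abs_sub (V p) ((x p:ℝ) + y p)
    have e2 := abs_add_le (x p:ℝ) (y p)
    linarith [hT x (hT' hx) p, hT y (hT' hy) p]
  rw [le_div_iff₀ hVp]
  nlinarith [abs_nonneg ((x p:ℝ) - y p)]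

/-- quadratic count -/
lemma card_quad {n : ℕ} (T : Finset (Fin n → ℤ)) (p : Fin n) (V : Fin n → ℝ) (D H : ℝ)
    (hD : 0 < D) (hH : 0 ≤ H) (hT : ∀ x ∈ T, ∀ i, |(x i:ℝ)| ≤ D)
    (hq : ∀ x ∈ T, |∑ i, (x i:ℝ) * (V i - x i)| ≤ H ^ 2) :
    (T.card : ℝ) ≤ (2 * D + 1) ^ (n - 1) * (4 * H + 2) := by
  classical
  have := card_box_fiber T {p} (2*D) (4 * H + 2) (by linarith)
    (by
      intro x hx y hy i
      have := abs_sub (x i:ℝ) (y i)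
      linarith [hT x hx i, hT y hy i]) ?_
  · simpa using this
  intro T' hT' hag
  have key : ∀ x ∈ T', ∀ y ∈ T', 0 ≤ ((x p:ℝ) - V p / 2) * (y p - V p / 2) →
      |(x p:ℝ) - y p| ≤ 2 * H := by
    intro x hx y hy hxy
    have hs := sum_diff_one (fun i => (x i:ℝ) * (V i - x i)) (fun i => (y i:ℝ) * (V i - y i)) p
      (by intro i hi; rw [hag x hx y hy i (by simpa using hi)])
    have h1 := hq x (hT' hx)
    have h2 := hq y (hT' hy)
    have h3 : |(x p:ℝ) * (V p - x p) - (y p:ℝ) * (V p - y p)| ≤ 2 * H ^ 2 := by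
      rw [← hs]; exact (abs_sub _ _).trans (by linarith)
    set a := (x p:ℝ) - V p / 2
    set b := (y p:ℝ) - V p / 2
    have h4 : (x p:ℝ) * (V p - x p) - (y p:ℝ) * (V p - y p) = b ^ 2 - a ^ 2 := by
      simp only [a, b]; ring
    have h5 : (x p:ℝ) - y p = a - b := by simp only [a, b]; ring
    rw [h4] at h3
    rw [h5]
    have h6 := abs_le.mp h3
    have h7 : (a - b) ^ 2 ≤ |b^2 - a^2| := by
      rcases le_total (a^2) (b^2) with h | h
      · rw [abs_of_nonneg (by linarith)]
        nlinarith [sq_le_sq.mp h, sq_abs a, sq_abs b, abs_mul a b, abs_of_nonneg hxy, abs_nonneg a]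
      · rw [abs_of_nonpos (by linarith)]
        nlinarith [sq_le_sq.mp h, sq_abs a, sq_abs b, abs_mul a b, abs_of_nonneg hxy, abs_nonneg b]
    apply abs_le_of_sq_le_sq _ (by linarith)
    nlinarith
  have h1 := Finset.card_filter_add_card_filter_not (s := T') (fun x => 0 ≤ (x p:ℝ) - V p / 2)
  have h2 : ((T'.filter (fun x => 0 ≤ (x p:ℝ) - V p / 2)).card : ℝ) ≤ 2 * H + 1 := by
    apply card_fiber_one _ p _ (by positivity)
    · intro x hx y hy i hi
      exact hag x (Finset.mem_filter.mp hx).1 y (Finset.mem_filter.mp hy).1 i (by simpa using hi)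
    · intro x hx y hy
      rw [Finset.mem_filter] at hx hy
      exact key x hx.1 y hy.1 (mul_nonneg hx.2 hy.2)
  have h3 : ((T'.filter (fun x => ¬ 0 ≤ (x p:ℝ) - V p / 2)).card : ℝ) ≤ 2 * H + 1 := by
    apply card_fiber_one _ p _ (by positivity)
    · intro x hx y hy i hi
      exact hag x (Finset.mem_filter.mp hx).1 y (Finset.mem_filter.mp hy).1 i (by simpa using hi)
    · intro x hx y hy
      rw [Finset.mem_filter, not_le] at hx hy
      exact key x hx.1 y hy.1 (mul_nonneg_of_nonpos_of_nonpos hx.2.le hy.2.le)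
  rw [← h1]; push_cast; linarith

lemma sum_two {n : ℕ} (f : Fin n → ℝ) (p q : Fin n) (hpq : p ≠ q)
    (h : ∀ i, i ≠ p → i ≠ q → f i = 0) : ∑ i, f i = f p + f q := by
  classical
  rw [← Finset.sum_pair hpq]
  symm
  apply Finset.sum_subset (Finset.subset_univ _)
  intro i _ hi
  simp only [Finset.mem_insert, Finset.mem_singleton, not_or] at hi
  exact h i hi.1 hi.2

lemma card_slab_aux {n : ℕ} (T : Finset (Fin n → ℤ)) (p q : Fin n) (hpq : p ≠ q) (v d : Fin n → ℝ)
    (R w H D c : ℝ) (hc : 0 < c) (hD : 0 < D) (hw : 0 ≤ w) (hH : 0 ≤ H) (hR : 0 ≤ R)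
    (hv : ∀ i, |v i| ≤ 1) (hd : ∀ i, |d i| ≤ D)
    (hm : c * D ≤ |v p * d q - v q * d p|)
    (hvp : c / 2 ≤ |v p|) (hdq : c * D / 2 ≤ |d q|)
    (hT : ∀ x ∈ T, ∀ y ∈ T, ∀ i, |(x i:ℝ) - y i| ≤ R)
    (h1 : ∀ x ∈ T, ∀ y ∈ T, |∑ i, v i * ((x i:ℝ) - y i)| ≤ w)
    (h2 : ∀ x ∈ T, ∀ y ∈ T, |∑ i, d i * ((x i:ℝ) - y i)| ≤ H) :
    (T.card : ℝ) ≤ (R + 1) ^ (n - 2) * (2 * (1 + 2 * w / c) * (1 + 2 * H / (c * D))) := by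
  classical
  have hcard : ({p, q} : Finset (Fin n)).card = 2 := Finset.card_pair hpq
  have := card_box_fiber T {p, q} R (2 * (1 + 2 * w / c) * (1 + 2 * H / (c * D))) hR hT ?_
  · rwa [hcard] at this
  intro T' hT' hag
  have g1 : ∀ x ∈ T', ∀ y ∈ T', |v p * ((x p:ℝ) - y p) + v q * ((x q:ℝ) - y q)| ≤ w := by
    intro x hx y hy
    rw [← sum_two (fun i => v i * ((x i:ℝ) - y i)) p q hpq]
    · exact h1 x (hT' hx) y (hT' hy)
    · intro i hip hiq
      rw [hag x hx y hy i (by simp [hip, hiq])]; ring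
  have g2 : ∀ x ∈ T', ∀ y ∈ T', |d p * ((x p:ℝ) - y p) + d q * ((x q:ℝ) - y q)| ≤ H := by
    intro x hx y hy
    rw [← sum_two (fun i => d i * ((x i:ℝ) - y i)) p q hpq]
    · exact h2 x (hT' hx) y (hT' hy)
    · intro i hip hiq
      rw [hag x hx y hy i (by simp [hip, hiq])]; ring
  have hcD : 0 < c * D := by positivity
  set X := w / c + H / (c * D) with hX
  have hX0 : 0 ≤ X := by positivity
  have gx : ∀ x ∈ T', ∀ y ∈ T', |(x p:ℝ) - y p| ≤ X := by
    intro x hx y hy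
    have e : (v p * d q - v q * d p) * ((x p:ℝ) - y p) =
       d q * (v p * ((x p:ℝ) - y p) + v q * ((x q:ℝ) - y q))
       - v q * (d p * ((x p:ℝ) - y p) + d q * ((x q:ℝ) - y q)) := by ring
    have e2 : |v p * d q - v q * d p| * |(x p:ℝ) - y p| ≤ D * w + 1 * H := by
      rw [← abs_mul, e]
      refine (abs_sub _ _).trans ?_
      rw [abs_mul, abs_mul]
      exact add_le_add (mul_le_mul (hd q) (g1 x hx y hy) (abs_nonneg _) hD.le)
        (mul_le_mul (hv q) (g2 x hx y hy) (abs_nonneg _) (by norm_num))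
    have e3 : c * D * |(x p:ℝ) - y p| ≤ D * w + H := by
      nlinarith [abs_nonneg ((x p:ℝ) - y p)]
    have e4 : X = (D * w + H) / (c * D) := by rw [hX]; field_simp
    rw [e4, le_div_iff₀ hcD]; linarith
  have gy : ∀ x ∈ T', ∀ y ∈ T', |(x q:ℝ) - y q| ≤ X := by
    intro x hx y hy
    have e : (v p * d q - v q * d p) * ((x q:ℝ) - y q) =
       v p * (d p * ((x p:ℝ) - y p) + d q * ((x q:ℝ) - y q))
       - d p * (v p * ((x p:ℝ) - y p) + v q * ((x q:ℝ) - y q)) := by ring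
    have e2 : |v p * d q - v q * d p| * |(x q:ℝ) - y q| ≤ 1 * H + D * w := by
      rw [← abs_mul, e]
      refine (abs_sub _ _).trans ?_
      rw [abs_mul, abs_mul]
      exact add_le_add (mul_le_mul (hv p) (g2 x hx y hy) (abs_nonneg _) (by norm_num))
        (mul_le_mul (hd p) (g1 x hx y hy) (abs_nonneg _) hD.le)
    have e3 : c * D * |(x q:ℝ) - y q| ≤ D * w + H := by
      nlinarith [abs_nonneg ((x q:ℝ) - y q)]
    have e4 : X = (D * w + H) / (c * D) := by rw [hX]; field_simp
    rw [e4, le_div_iff₀ hcD]; linarith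
  rcases le_total (w / c) (H / (c * D)) with hle | hle
  · -- fix y : x in w window
    have := card_box_fiber T' (Finset.univ.erase q) X (2 * w / c + 1) hX0 ?_ ?_
    · have hn : n - (Finset.univ.erase q : Finset (Fin n)).card = 1 := by
        rw [Finset.card_erase_of_mem (Finset.mem_univ _), Finset.card_univ, Fintype.card_fin]
        have := q.pos
        omega
      rw [hn, pow_one] at this
      refine this.trans ?_
      have a1 : X + 1 ≤ 2 * (1 + 2 * H / (c*D)) := by
        have : 2 * H / (c*D) = 2 * (H / (c*D)) := by ring
        rw [this]; linarith [hX, div_nonneg hH hcD.le]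
      have a2 : 0 ≤ 2 * w / c + 1 := by positivity
      nlinarith
    · intro x hx y hy i
      by_cases hip : i = p
      · subst hip; exact gx x hx y hy
      by_cases hiq : i = q
      · subst hiq; exact gy x hx y hy
      rw [hag x hx y hy i (by simp [hip, hiq])]; simpa using hX0
    · intro T'' hT'' hag''
      apply card_fiber_one T'' p _ (by positivity)
      · intro x hx y hy i hi
        by_cases hiq : i = q
        · subst hiq; exact hag'' x hx y hy i (by simp)
        · exact hag x (hT'' hx) y (hT'' hy) i (by simp [hi, hiq])
      · intro x hx y hy
        have := g1 x (hT'' hx) y (hT'' hy)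
        rw [hag'' x hx y hy q (by simp), sub_self, mul_zero, add_zero, abs_mul] at this
        rw [le_div_iff₀ hc]
        nlinarith [abs_nonneg ((x p:ℝ) - y p)]
  · have := card_box_fiber T' (Finset.univ.erase p) X (2 * H / (c * D) + 1) hX0 ?_ ?_
    · have hn : n - (Finset.univ.erase p : Finset (Fin n)).card = 1 := by
        rw [Finset.card_erase_of_mem (Finset.mem_univ _), Finset.card_univ, Fintype.card_fin]
        have := q.pos
        omega
      rw [hn, pow_one] at this
      refine this.trans ?_
      have a1 : X + 1 ≤ 2 * (1 + 2 * w / c) := by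
        have : 2 * w / c = 2 * (w / c) := by ring
        rw [this]; linarith [hX, div_nonneg hw hc.le]
      have a2 : 0 ≤ 2 * H / (c * D) + 1 := by positivity
      nlinarith
    · intro x hx y hy i
      by_cases hip : i = p
      · subst hip; exact gx x hx y hy
      by_cases hiq : i = q
      · subst hiq; exact gy x hx y hy
      rw [hag x hx y hy i (by simp [hip, hiq])]; simpa using hX0
    · intro T'' hT'' hag''
      apply card_fiber_one T'' q _ (by positivity)
      · intro x hx y hy i hi
        by_cases hip : i = p
        · subst hip; exact hag'' x hx y hy i (by simp)
        · exact hag x (hT'' hx) y (hT'' hy) i (by simp [hi, hip])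
      · intro x hx y hy
        have := g2 x (hT'' hx) y (hT'' hy)
        rw [hag'' x hx y hy p (by simp), sub_self, mul_zero, zero_add, abs_mul] at this
        rw [le_div_iff₀ hcD]
        nlinarith [abs_nonneg ((x q:ℝ) - y q)]

lemma exists_minor {n : ℕ} (v d : Fin n → ℝ) (D w : ℝ) (hD : 0 < D)
    (p : Fin n) (hvp : |v p| = 1) (hv : ∀ i, |v i| ≤ 1) (hd : ∀ i, |d i| ≤ D)
    (q₀ : Fin n) (hq₀ : |d q₀| = D) (hwd : |∑ i, v i * d i| ≤ w) (hwD : 4 * w ≤ D) :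
    ∃ q, p ≠ q ∧ 1 / (2 * ((n:ℝ) + 1)) * D ≤ |v p * d q - v q * d p| := by
  by_contra hcon
  push Not at hcon
  set c : ℝ := 1 / (2 * ((n:ℝ) + 1)) with hc
  have hc0 : 0 < c := by positivity
  have hm : ∀ q, |v p * d q - v q * d p| ≤ c * D := by
    intro q
    by_cases h : p = q
    · subst h; rw [mul_comm, sub_self, abs_zero]; positivity
    · exact (hcon q h).le
  have hs : ∑ q, v q * (v p * d q - v q * d p) = v p * ∑ i, v i * d i - d p * ∑ i, v i ^ 2 := by
    rw [Finset.mul_sum, Finset.mul_sum, ← Finset.sum_sub_distrib]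
    apply Finset.sum_congr rfl; intros; ring
  have hs2 : |∑ q, v q * (v p * d q - v q * d p)| ≤ n * (c * D) := by
    refine (Finset.abs_sum_le_sum_abs _ _).trans ?_
    have : ∑ i : Fin n, |v i * (v p * d i - v i * d p)| ≤ ∑ i : Fin n, c * D := by
      apply Finset.sum_le_sum
      intro i _
      rw [abs_mul]
      have := mul_le_mul (hv i) (hm i) (abs_nonneg _) (by norm_num)
      linarith
    simpa using this
  have hsq : 1 ≤ ∑ i, v i ^ 2 := by
    have h1 : v p ^ 2 = 1 := by rw [← sq_abs, hvp]; norm_num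
    rw [← h1]
    exact Finset.single_le_sum (f := fun i => v i ^ 2) (fun i _ => sq_nonneg _) (Finset.mem_univ p)
  have hdp : |d p| ≤ w + n * (c * D) := by
    have e : d p * ∑ i, v i ^ 2 = v p * ∑ i, v i * d i - ∑ q, v q * (v p * d q - v q * d p) := by
      rw [hs]; ring
    have e2 : |d p| * |∑ i, v i ^ 2| ≤ 1 * w + n * (c * D) := by
      rw [← abs_mul, e]
      refine (abs_sub _ _).trans ?_
      rw [abs_mul, hvp]
      linarith
    rw [abs_of_nonneg (show (0:ℝ) ≤ ∑ i, v i ^ 2 by linarith)] at e2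
    nlinarith [abs_nonneg (d p)]
  have h3 := hm q₀
  have e3 : |d q₀| ≤ |v p * d q₀ - v q₀ * d p| + |d p| := by
    have : |v p * d q₀| ≤ |v p * d q₀ - v q₀ * d p| + |v q₀ * d p| := by
      have := abs_add_le (v p * d q₀ - v q₀ * d p) (v q₀ * d p)
      rwa [sub_add_cancel] at this
    rw [abs_mul, hvp, one_mul, abs_mul] at this
    nlinarith [hv q₀, abs_nonneg (d p)]
  have h4 : D ≤ w + (n + 1) * (c * D) := by
    rw [hq₀] at e3; linarith
  have h5 : ((n:ℝ) + 1) * (c * D) = D / 2 := by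
    rw [hc]; field_simp
  rw [h5] at h4
  linarith

lemma card_slab {n : ℕ} (T : Finset (Fin n → ℤ)) (p : Fin n) (v d : Fin n → ℝ)
    (R w H D : ℝ) (hD : 0 < D) (hw : 0 ≤ w) (hH : 0 ≤ H) (hR : 0 ≤ R)
    (hvp : |v p| = 1) (hv : ∀ i, |v i| ≤ 1) (hd : ∀ i, |d i| ≤ D)
    (q₀ : Fin n) (hq₀ : |d q₀| = D) (hwd : |∑ i, v i * d i| ≤ w) (hwD : 4 * w ≤ D)
    (hT : ∀ x ∈ T, ∀ y ∈ T, ∀ i, |(x i:ℝ) - y i| ≤ R)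
    (h1 : ∀ x ∈ T, ∀ y ∈ T, |∑ i, v i * ((x i:ℝ) - y i)| ≤ w)
    (h2 : ∀ x ∈ T, ∀ y ∈ T, |∑ i, d i * ((x i:ℝ) - y i)| ≤ H) :
    (T.card : ℝ) ≤ (R + 1) ^ (n - 2) *
      (2 * (1 + 4 * (n + 1) * w) * (1 + 4 * (n + 1) * H / D)) := by
  obtain ⟨q, hpq, hm⟩ := exists_minor v d D w hD p hvp hv hd q₀ hq₀ hwd hwD
  set c : ℝ := 1 / (2 * ((n:ℝ) + 1)) with hc
  have hc0 : 0 < c := by positivity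
  have e1 : 2 * w / c = 4 * (n + 1) * w := by rw [hc]; field_simp; ring
  have e2 : 2 * H / (c * D) = 4 * (n + 1) * H / D := by rw [hc]; field_simp; ring
  rw [← e1, ← e2]
  have hcD : 0 < c * D := by positivity
  have htri : |v p * d q - v q * d p| ≤ |v p| * |d q| + |v q| * |d p| := by
    rw [← abs_mul, ← abs_mul]; exact abs_sub _ _
  rcases le_total (|v q| * |d p|) (|v p| * |d q|) with h | h
  · have hh : c * D / 2 ≤ |v p| * |d q| := by linarith
    apply card_slab_aux T p q hpq v d R w H D c hc0 hD hw hH hR hv hd hm _ _ hT h1 h2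
    · have : c / 2 * D ≤ |v p| * D := by nlinarith [hd q, abs_nonneg (v p)]
      exact le_of_mul_le_mul_right this hD
    · nlinarith [hv p, abs_nonneg (d q)]
  · have hh : c * D / 2 ≤ |v q| * |d p| := by linarith
    apply card_slab_aux T q p hpq.symm v d R w H D c hc0 hD hw hH hR hv hd _ _ _ hT h1 h2
    · rw [abs_sub_comm]; exact hm
    · have : c / 2 * D ≤ |v q| * D := by nlinarith [hd p, abs_nonneg (v q)]
      exact le_of_mul_le_mul_right this hD
    · nlinarith [hv q, abs_nonneg (d p)]

-- part B
open MeasureTheory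
open scoped ENNReal NNReal

/-- Indicator of a proposition. -/
noncomputable def ind (P : Prop) : ℝ≥0∞ := open Classical in if P then 1 else 0

lemma ind_pos {P : Prop} (h : P) : ind P = 1 := by simp [ind, h]
lemma ind_neg {P : Prop} (h : ¬ P) : ind P = 0 := by simp [ind, h]
lemma ind_le_one (P : Prop) : ind P ≤ 1 := by
  by_cases h : P
  · rw [ind_pos h]
  · rw [ind_neg h]; exact zero_le
lemma ind_mono {P Q : Prop} (h : P → Q) : ind P ≤ ind Q := by
  by_cases hp : P
  · rw [ind_pos hp, ind_pos (h hp)]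
  · rw [ind_neg hp]; exact zero_le
lemma ind_sq (P : Prop) : ind P ^ 2 = ind P := by
  by_cases h : P
  · rw [ind_pos h]; simp
  · rw [ind_neg h]; simp
lemma ind_and (P Q : Prop) : ind (P ∧ Q) = ind P * ind Q := by
  by_cases h : P <;> by_cases h' : Q <;> simp [ind, h, h']
lemma ind_mul_le {P : Prop} {x y : ℝ≥0∞} (h : P → x ≤ y) : ind P * x ≤ ind P * y := by
  by_cases hp : P
  · rw [ind_pos hp]; simpa using h hp
  · rw [ind_neg hp]; simp

lemma half_sq (a : ℝ≥0∞) : (a ^ 2) ^ (1/2 : ℝ) = a := by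
  rw [← ENNReal.rpow_natCast, ← ENNReal.rpow_mul]; norm_num
lemma sq_half (a : ℝ≥0∞) : (a ^ (1/2 : ℝ)) ^ 2 = a := by
  rw [← ENNReal.rpow_natCast, ← ENNReal.rpow_mul]; norm_num
lemma half_mul (a b : ℝ≥0∞) : (a * b) ^ (1/2 : ℝ) = a ^ (1/2 : ℝ) * b ^ (1/2 : ℝ) :=
  ENNReal.mul_rpow_of_nonneg _ _ (by norm_num)
lemma half_mono {a b : ℝ≥0∞} (h : a ≤ b) : a ^ (1/2 : ℝ) ≤ b ^ (1/2 : ℝ) :=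
  ENNReal.rpow_le_rpow h (by norm_num)
lemma half_mul_self (a : ℝ≥0∞) : a ^ (1/2 : ℝ) * a ^ (1/2 : ℝ) = a := by
  rw [← sq, sq_half]

lemma cs_lintegral {α : Type*} [MeasurableSpace α] (μ : Measure α) {f g : α → ℝ≥0∞}
    (hf : AEMeasurable f μ) (hg : AEMeasurable g μ) :
    ∫⁻ a, f a * g a ∂μ ≤ (∫⁻ a, f a ^ 2 ∂μ) ^ (1/2 : ℝ) * (∫⁻ a, g a ^ 2 ∂μ) ^ (1/2 : ℝ) := by
  have h : (2:ℝ).HolderConjugate 2 := Real.HolderConjugate.two_two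
  have := ENNReal.lintegral_mul_le_Lp_mul_Lq μ h hf hg
  simpa [ENNReal.rpow_two] using this

lemma cs_tsum {α : Type*} (f g : α → ℝ≥0∞) :
    ∑' a, f a * g a ≤ (∑' a, f a ^ 2) ^ (1/2 : ℝ) * (∑' a, g a ^ 2) ^ (1/2 : ℝ) := by
  let _ : MeasurableSpace α := ⊤
  have := cs_lintegral (Measure.count : Measure α) (f := f) (g := g)
    measurable_from_top.aemeasurable measurable_from_top.aemeasurable
  simpa [lintegral_count] using this

lemma tsum_ind_le {α : Type*} (P : α → Prop) (B : ℝ)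
    (h : ∀ T : Finset α, (∀ x ∈ T, P x) → (T.card : ℝ) ≤ B) :
    ∑' x, ind (P x) ≤ ENNReal.ofReal B := by
  classical
  rw [ENNReal.tsum_eq_iSup_sum]
  apply iSup_le
  intro T
  have h1 : ∑ x ∈ T, ind (P x) = ((T.filter P).card : ℝ≥0∞) := by
    simp only [ind]
    rw [Finset.sum_ite]; simp
  rw [h1]
  have := h (T.filter P) (fun x hx => (Finset.mem_filter.mp hx).2)
  calc ((T.filter P).card : ℝ≥0∞) = ENNReal.ofReal ((T.filter P).card : ℝ) := by simp
    _ ≤ _ := ENNReal.ofReal_le_ofReal this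

lemma mul_le_sq_add_sq (x y : ℝ≥0∞) : x * y ≤ x ^ 2 + y ^ 2 := by
  rcases le_total x y with h | h
  · calc x * y ≤ y * y := by gcongr
      _ ≤ _ := by rw [sq y]; exact le_add_self
  · calc x * y ≤ x * x := by gcongr
      _ ≤ _ := by rw [sq x]; exact le_self_add

lemma tsum_ind_eq {K : Type*} (k0 : K) : ∑' k, ind (k0 = k) = 1 := by
  rw [tsum_eq_single k0]
  · exact ind_pos rfl
  · intro b hb; exact ind_neg (fun h => hb h.symm)

lemma tsum_ind_eq_mul {K : Type*} (k0 : K) (F : K → ℝ≥0∞) : ∑' k, ind (k0 = k) * F k = F k0 := by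
  rw [tsum_eq_single k0]
  · rw [ind_pos rfl, one_mul]
  · intro b hb; rw [ind_neg (fun h => hb h.symm), zero_mul]

lemma tsum_shift_sub {ι : Type*} [AddCommGroup ι] (F : ι → ℝ≥0∞) (a : ι) :
    ∑' d, F (a - d) = ∑' d, F d := (Equiv.subLeft a).tsum_eq F
lemma tsum_shift_sub' {ι : Type*} [AddCommGroup ι] (F : ι → ℝ≥0∞) (a : ι) :
    ∑' d, F (d - a) = ∑' d, F d := (Equiv.subRight a).tsum_eq F
lemma tsum_shift_add {ι : Type*} [AddCommGroup ι] (F : ι → ℝ≥0∞) (a : ι) :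
    ∑' d, F (a + d) = ∑' d, F d := (Equiv.addLeft a).tsum_eq F
lemma tsum_shift_add' {ι : Type*} [AddCommGroup ι] (F : ι → ℝ≥0∞) (a : ι) :
    ∑' d, F (d + a) = ∑' d, F d := (Equiv.addRight a).tsum_eq F

lemma cell_one {ι : Type*} [AddCommGroup ι] (f1 f2 : ι → ℝ≥0∞) (q : ι → ι → ι → Prop)
    (PA PB : ι → Prop) (M : ℝ≥0∞)
    (hA : ∀ j1 d j2, q j1 d j2 → PA j1 ∧ PA (j1 - d) ∧ PB j2 ∧ PB (j2 + d))
    (hM1 : ∀ j1 d, ∑' j2, ind (q j1 d j2) ≤ M)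
    (hM2 : ∀ j2 d, ∑' j1, ind (q j1 d j2) ≤ M) :
    ∑' j1, ∑' d, ∑' j2, ind (q j1 d j2) * (f1 j1 * f2 j2 * f1 (j1 - d) * f2 (j2 + d))
      ≤ M * (∑' j, ind (PA j) * f1 j ^ 2) * (∑' j, ind (PB j) * f2 j ^ 2) := by
  set a := ∑' j, ind (PA j) * f1 j ^ 2
  set b := ∑' j, ind (PB j) * f2 j ^ 2
  have e1 : ∑' j1, ∑' d, ∑' j2, ind (q j1 d j2) * (f1 j1 * f2 j2 * f1 (j1 - d) * f2 (j2 + d))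
      = ∑' x : ι × ι × ι, (ind (q x.1 x.2.1 x.2.2) * (f1 x.1 * f1 (x.1 - x.2.1))) *
        (ind (q x.1 x.2.1 x.2.2) * (f2 x.2.2 * f2 (x.2.2 + x.2.1))) := by
    rw [ENNReal.tsum_prod']
    refine tsum_congr fun j1 => ?_
    rw [ENNReal.tsum_prod']
    refine tsum_congr fun d => tsum_congr fun j2 => ?_
    have := ind_sq (q j1 d j2)
    calc _ = ind (q j1 d j2) ^ 2 * (f1 j1 * f2 j2 * f1 (j1 - d) * f2 (j2 + d)) := by rw [this]
      _ = _ := by ring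
  rw [e1]
  refine (cs_tsum _ _).trans ?_
  have h1 : ∑' x : ι × ι × ι, (ind (q x.1 x.2.1 x.2.2) * (f1 x.1 * f1 (x.1 - x.2.1))) ^ 2
      ≤ M * a ^ 2 := by
    rw [ENNReal.tsum_prod']
    calc _ = ∑' j1, ∑' d, ∑' j2, ind (q j1 d j2) * (f1 j1 * f1 (j1 - d)) ^ 2 := by
          refine tsum_congr fun j1 => ?_
          rw [ENNReal.tsum_prod']
          refine tsum_congr fun d => tsum_congr fun j2 => ?_
          rw [mul_pow, ind_sq]
      _ ≤ ∑' j1, ∑' d, ∑' j2, ind (q j1 d j2) *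
            ((ind (PA j1) * f1 j1 ^ 2) * (ind (PA (j1 - d)) * f1 (j1 - d) ^ 2)) := by
          refine ENNReal.tsum_le_tsum fun j1 => ENNReal.tsum_le_tsum fun d =>
            ENNReal.tsum_le_tsum fun j2 => ind_mul_le fun hq => ?_
          obtain ⟨h1, h2, -, -⟩ := hA _ _ _ hq
          rw [ind_pos h1, ind_pos h2, one_mul, one_mul, mul_pow]
      _ ≤ ∑' j1, ∑' d, M *
            ((ind (PA j1) * f1 j1 ^ 2) * (ind (PA (j1 - d)) * f1 (j1 - d) ^ 2)) := by
          refine ENNReal.tsum_le_tsum fun j1 => ENNReal.tsum_le_tsum fun d => ?_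
          rw [ENNReal.tsum_mul_right]
          gcongr
          exact hM1 j1 d
      _ = M * a ^ 2 := by
          simp_rw [ENNReal.tsum_mul_left]
          congr 1
          have : ∀ j1, ∑' d, (ind (PA (j1 - d)) * f1 (j1 - d) ^ 2) = a := fun j1 =>
            tsum_shift_sub (fun j => ind (PA j) * f1 j ^ 2) j1
          simp_rw [this, ENNReal.tsum_mul_right]
          rw [sq]
  have h2 : ∑' x : ι × ι × ι, (ind (q x.1 x.2.1 x.2.2) * (f2 x.2.2 * f2 (x.2.2 + x.2.1))) ^ 2
      ≤ M * b ^ 2 := by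
    rw [ENNReal.tsum_prod']
    calc _ = ∑' j1, ∑' d, ∑' j2, ind (q j1 d j2) * (f2 j2 * f2 (j2 + d)) ^ 2 := by
          refine tsum_congr fun j1 => ?_
          rw [ENNReal.tsum_prod']
          refine tsum_congr fun d => tsum_congr fun j2 => ?_
          rw [mul_pow, ind_sq]
      _ ≤ ∑' j1, ∑' d, ∑' j2, ind (q j1 d j2) *
            ((ind (PB j2) * f2 j2 ^ 2) * (ind (PB (j2 + d)) * f2 (j2 + d) ^ 2)) := by
          refine ENNReal.tsum_le_tsum fun j1 => ENNReal.tsum_le_tsum fun d =>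
            ENNReal.tsum_le_tsum fun j2 => ind_mul_le fun hq => ?_
          obtain ⟨-, -, h1, h2⟩ := hA _ _ _ hq
          rw [ind_pos h1, ind_pos h2, one_mul, one_mul, mul_pow]
      _ = ∑' d, ∑' j2, ∑' j1, ind (q j1 d j2) *
            ((ind (PB j2) * f2 j2 ^ 2) * (ind (PB (j2 + d)) * f2 (j2 + d) ^ 2)) := by
          rw [ENNReal.tsum_comm]
          refine tsum_congr fun d => ?_
          rw [ENNReal.tsum_comm]
      _ ≤ ∑' d, ∑' j2, M *
            ((ind (PB j2) * f2 j2 ^ 2) * (ind (PB (j2 + d)) * f2 (j2 + d) ^ 2)) := by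
          refine ENNReal.tsum_le_tsum fun d => ENNReal.tsum_le_tsum fun j2 => ?_
          rw [ENNReal.tsum_mul_right]
          gcongr
          exact hM2 j2 d
      _ = M * b ^ 2 := by
          rw [ENNReal.tsum_comm]
          simp_rw [ENNReal.tsum_mul_left]
          congr 1
          have : ∀ j1, ∑' d, (ind (PB (j1 + d)) * f2 (j1 + d) ^ 2) = b := fun j1 =>
            tsum_shift_add (fun j => ind (PB j) * f2 j ^ 2) j1
          simp_rw [this, ENNReal.tsum_mul_right]
          rw [sq]
  calc _ ≤ (M * a ^ 2) ^ (1/2:ℝ) * (M * b ^ 2) ^ (1/2:ℝ) := by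
        gcongr
    _ = (M ^ (1/2:ℝ) * M ^ (1/2:ℝ)) * a * b := by
        rw [half_mul, half_mul, half_sq, half_sq]; ring
    _ = _ := by rw [half_mul_self]

lemma cell_bound {ι K : Type*} [AddCommGroup ι] (f1 f2 : ι → ℝ≥0∞) (Q : ι → ι → ι → Prop)
    (κ : ι → K) (β : K → ι → ℤ) (EA : K → ι → Prop) (EB : K → ℤ → ι → Prop) (M O1 O2 : ℝ≥0∞)
    (hA : ∀ j1 d j2, Q j1 d j2 → EA (κ j1) j1 ∧ EA (κ j1) (j1 - d) ∧
      EB (κ j1) (β (κ j1) j2) j2 ∧ EB (κ j1) (β (κ j1) j2) (j2 + d))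
    (hO1 : ∀ j, ∑' k, ind (EA k j) ≤ O1) (hO2 : ∀ k j, ∑' b, ind (EB k b j) ≤ O2)
    (hM1 : ∀ k b j1 d, ∑' j2, ind (Q j1 d j2 ∧ κ j1 = k ∧ β k j2 = b) ≤ M)
    (hM2 : ∀ k b j2 d, ∑' j1, ind (Q j1 d j2 ∧ κ j1 = k ∧ β k j2 = b) ≤ M) :
    ∑' j1, ∑' d, ∑' j2, ind (Q j1 d j2) * (f1 j1 * f2 j2 * f1 (j1 - d) * f2 (j2 + d))
      ≤ M * O1 * O2 * (∑' j, f1 j ^ 2) * (∑' j, f2 j ^ 2) := by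
  have e1 : ∀ j1 d j2, ind (Q j1 d j2) =
      ∑' k, ∑' b, ind (Q j1 d j2 ∧ κ j1 = k ∧ β k j2 = b) := by
    intro j1 d j2
    simp_rw [ind_and, ENNReal.tsum_mul_left]
    simp_rw [tsum_ind_eq, mul_one, tsum_ind_eq, mul_one]
  calc _ = ∑' j1, ∑' d, ∑' j2, ∑' k, ∑' b, ind (Q j1 d j2 ∧ κ j1 = k ∧ β k j2 = b) *
          (f1 j1 * f2 j2 * f1 (j1 - d) * f2 (j2 + d)) := by
        refine tsum_congr fun j1 => tsum_congr fun d => tsum_congr fun j2 => ?_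
        rw [e1]
        simp_rw [← ENNReal.tsum_mul_right]
    _ = ∑' k, ∑' b, ∑' j1, ∑' d, ∑' j2, ind (Q j1 d j2 ∧ κ j1 = k ∧ β k j2 = b) *
          (f1 j1 * f2 j2 * f1 (j1 - d) * f2 (j2 + d)) := by
        calc _ = ∑' j1, ∑' d, ∑' k, ∑' j2, ∑' b, ind (Q j1 d j2 ∧ κ j1 = k ∧ β k j2 = b) *
                (f1 j1 * f2 j2 * f1 (j1 - d) * f2 (j2 + d)) := by
              refine tsum_congr fun j1 => tsum_congr fun d => ENNReal.tsum_comm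
          _ = ∑' j1, ∑' k, ∑' d, ∑' b, ∑' j2, ind (Q j1 d j2 ∧ κ j1 = k ∧ β k j2 = b) *
                (f1 j1 * f2 j2 * f1 (j1 - d) * f2 (j2 + d)) := by
              refine tsum_congr fun j1 => ?_
              rw [ENNReal.tsum_comm]
              refine tsum_congr fun k => tsum_congr fun d => ENNReal.tsum_comm
          _ = ∑' k, ∑' j1, ∑' b, ∑' d, ∑' j2, ind (Q j1 d j2 ∧ κ j1 = k ∧ β k j2 = b) *
                (f1 j1 * f2 j2 * f1 (j1 - d) * f2 (j2 + d)) := by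
              rw [ENNReal.tsum_comm]
              refine tsum_congr fun k => tsum_congr fun j1 => ENNReal.tsum_comm
          _ = _ := by
              refine tsum_congr fun k => ENNReal.tsum_comm
    _ ≤ ∑' k, ∑' b, M * (∑' j, ind (EA k j) * f1 j ^ 2) * (∑' j, ind (EB k b j) * f2 j ^ 2) := by
        refine ENNReal.tsum_le_tsum fun k => ENNReal.tsum_le_tsum fun b => ?_
        apply cell_one f1 f2 _ (EA k) (EB k b) M _ (hM1 k b) (hM2 k b)
        rintro j1 d j2 ⟨hq, rfl, rfl⟩
        exact hA _ _ _ hq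
    _ ≤ ∑' k, M * (∑' j, ind (EA k j) * f1 j ^ 2) * (O2 * ∑' j, f2 j ^ 2) := by
        refine ENNReal.tsum_le_tsum fun k => ?_
        rw [ENNReal.tsum_mul_left]
        gcongr
        rw [ENNReal.tsum_comm, ← ENNReal.tsum_mul_left]
        refine ENNReal.tsum_le_tsum fun j => ?_
        rw [ENNReal.tsum_mul_right]
        gcongr
        exact hO2 k j
    _ ≤ M * (O1 * ∑' j, f1 j ^ 2) * (O2 * ∑' j, f2 j ^ 2) := by
        rw [ENNReal.tsum_mul_right, ENNReal.tsum_mul_left]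
        gcongr
        rw [ENNReal.tsum_comm, ← ENNReal.tsum_mul_left]
        refine ENNReal.tsum_le_tsum fun j => ?_
        rw [ENNReal.tsum_mul_right]
        gcongr
        exact hO1 j
    _ = _ := by ring

lemma schur_disc {ι : Type*} [AddCommGroup ι] (f1 f2 : ι → ℝ≥0∞) (Q : ι → ι → ι → Prop) (B : ℝ≥0∞)
    (hs : ∀ j1 d j2, Q j1 d j2 → Q (j1 - d) (-d) (j2 + d))
    (hB : ∀ j1 j2, ∑' d, ind (Q j1 d j2) ≤ B) :
    ∑' j1, ∑' d, ∑' j2, ind (Q j1 d j2) * (f1 j1 * f2 j2 * f1 (j1 - d) * f2 (j2 + d))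
      ≤ 2 * B * (∑' j, f1 j ^ 2) * (∑' j, f2 j ^ 2) := by
  have h1 : ∑' j1, ∑' d, ∑' j2, ind (Q j1 d j2) * (f1 j1 * f2 j2) ^ 2
      ≤ B * (∑' j, f1 j ^ 2) * (∑' j, f2 j ^ 2) := by
    calc _ = ∑' j1, ∑' j2, (∑' d, ind (Q j1 d j2)) * (f1 j1 * f2 j2) ^ 2 := by
          refine tsum_congr fun j1 => ?_
          rw [ENNReal.tsum_comm]
          simp_rw [ENNReal.tsum_mul_right]
      _ ≤ ∑' j1, ∑' j2, B * (f1 j1 ^ 2 * f2 j2 ^ 2) := by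
          refine ENNReal.tsum_le_tsum fun j1 => ENNReal.tsum_le_tsum fun j2 => ?_
          rw [mul_pow]
          gcongr
          exact hB _ _
      _ = _ := by
          simp_rw [ENNReal.tsum_mul_left, ENNReal.tsum_mul_right]; ring
  have h2 : ∑' j1, ∑' d, ∑' j2, ind (Q (j1 - d) (-d) (j2 + d)) * (f1 (j1 - d) * f2 (j2 + d)) ^ 2
      = ∑' j1, ∑' d, ∑' j2, ind (Q j1 d j2) * (f1 j1 * f2 j2) ^ 2 := by
    rw [ENNReal.tsum_comm]
    rw [ENNReal.tsum_comm (f := fun j1 d => ∑' j2, ind (Q j1 d j2) * (f1 j1 * f2 j2) ^ 2)]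
    rw [← (Equiv.neg ι).tsum_eq (fun d => ∑' j1, ∑' j2, ind (Q j1 d j2) * (f1 j1 * f2 j2) ^ 2)]
    refine tsum_congr fun d => ?_
    rw [← tsum_shift_sub' (fun j1 => ∑' j2, ind (Q j1 (Equiv.neg ι d) j2) * (f1 j1 * f2 j2) ^ 2) d]
    refine tsum_congr fun j1 => ?_
    rw [← tsum_shift_add' (fun j2 => ind (Q (j1 - d) (Equiv.neg ι d) j2) * (f1 (j1 - d) * f2 j2) ^ 2) d]
    rfl
  calc _ ≤ ∑' j1, ∑' d, ∑' j2, (ind (Q j1 d j2) * (f1 j1 * f2 j2) ^ 2 +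
          ind (Q (j1 - d) (-d) (j2 + d)) * (f1 (j1 - d) * f2 (j2 + d)) ^ 2) := by
        refine ENNReal.tsum_le_tsum fun j1 => ENNReal.tsum_le_tsum fun d =>
            ENNReal.tsum_le_tsum fun j2 => ?_
        calc _ ≤ ind (Q j1 d j2) * ((f1 j1 * f2 j2) ^ 2 + (f1 (j1 - d) * f2 (j2 + d)) ^ 2) := by
              gcongr
              rw [mul_assoc (f1 j1 * f2 j2)]
              exact mul_le_sq_add_sq _ _
          _ ≤ _ := by
              rw [mul_add]
              gcongr
              exact ind_mono (hs _ _ _)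
    _ ≤ _ := by
        simp_rw [ENNReal.tsum_add]
        rw [h2]
        calc _ ≤ _ := add_le_add h1 h1
          _ = _ := by ring

-- part C
open MeasureTheory
open scoped ENNReal NNReal

/-- The quadratic form condition. -/
def quadC {n : ℕ} (H : ℝ) (j1 d j2 : Fin n → ℤ) : Prop :=
  |∑ i, (d i : ℝ) * ((j1 i : ℝ) - j2 i - d i)| ≤ H

lemma quadC_symm {n : ℕ} (H : ℝ) (j1 d j2 : Fin n → ℤ) (h : quadC H j1 d j2) :
    quadC H (j1 - d) (-d) (j2 + d) := by
  unfold quadC at *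
  rw [← abs_neg, ← Finset.sum_neg_distrib]
  convert h using 4
  simp only [Pi.sub_apply, Pi.neg_apply, Pi.add_apply]; push_cast; ring

/-- Generic Schur bound: counting `d` given `j1,j2`. -/
lemma disc_schur {n : ℕ} (f1 f2 : (Fin n → ℤ) → ℝ≥0∞) (H D B R : ℝ)
    (hf2 : ∀ j, f2 j ≠ 0 → ∀ i, |(j i : ℝ)| ≤ R)
    (hB : ∀ j1 j2, f1 j1 ≠ 0 → f2 j2 ≠ 0 → ∀ T : Finset (Fin n → ℤ),
      (∀ d ∈ T, (∀ i, |(d i : ℝ)| ≤ 2 * R) ∧ (∀ i, |(d i : ℝ)| ≤ D) ∧ quadC H j1 d j2) → (T.card : ℝ) ≤ B)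
    (hB0 : 0 ≤ B) :
    ∑' j1, ∑' d, ∑' j2, ind ((∀ i, |(d i : ℝ)| ≤ D) ∧ quadC H j1 d j2) *
        (f1 j1 * f2 j2 * f1 (j1 - d) * f2 (j2 + d))
      ≤ 2 * ENNReal.ofReal B * (∑' j, f1 j ^ 2) * (∑' j, f2 j ^ 2) := by
  have := schur_disc f1 f2 (fun j1 d j2 => (f1 j1 ≠ 0 ∧ f2 j2 ≠ 0 ∧ f1 (j1 - d) ≠ 0 ∧ f2 (j2 + d) ≠ 0) ∧
    (∀ i, |(d i : ℝ)| ≤ D) ∧ quadC H j1 d j2) (ENNReal.ofReal B) ?_ ?_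
  · refine le_trans ?_ this
    refine ENNReal.tsum_le_tsum fun j1 => ENNReal.tsum_le_tsum fun d =>
            ENNReal.tsum_le_tsum fun j2 => ?_
    by_cases h : f1 j1 ≠ 0 ∧ f2 j2 ≠ 0 ∧ f1 (j1 - d) ≠ 0 ∧ f2 (j2 + d) ≠ 0
    · gcongr
      apply ind_mono
      exact fun h' => ⟨h, h'⟩
    · have : f1 j1 * f2 j2 * f1 (j1 - d) * f2 (j2 + d) = 0 := by
        simp only [mul_eq_zero]
        tauto
      rw [this]; simp
  · rintro j1 d j2 ⟨⟨h1, h2, h3, h4⟩, h5, h6⟩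
    refine ⟨⟨h3, h4, by simpa using h1, by simpa using h2⟩, ?_, quadC_symm _ _ _ _ h6⟩
    intro i; simpa using h5 i
  · intro j1 j2
    by_cases h1 : f1 j1 ≠ 0
    · by_cases h2 : f2 j2 ≠ 0
      · apply tsum_ind_le
        intro T hT
        apply hB j1 j2 h1 h2 T
        intro d hd
        obtain ⟨⟨-, -, -, h4⟩, h5, h6⟩ := hT d hd
        refine ⟨?_, h5, h6⟩
        intro i
        have a1 := hf2 _ h4 i
        have a2 := hf2 _ h2 i
        have : (d i : ℝ) = ((j2 + d) i : ℤ) - (j2 i : ℤ) := by simp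
        rw [this]
        exact (abs_sub _ _).trans (by linarith)
      · rw [ENNReal.tsum_eq_zero.mpr]
        · exact zero_le
        · intro d; exact ind_neg (by tauto)
    · rw [ENNReal.tsum_eq_zero.mpr]
      · exact zero_le
      · intro d; exact ind_neg (by tauto)

lemma floor_close {x y : ℝ} (h : |x - y| ≤ 1) : |⌊x⌋ - ⌊y⌋| ≤ 1 := by
  rw [abs_le] at *
  have h1 : ⌊x⌋ ≤ ⌊y + 1⌋ := Int.floor_le_floor (by linarith)
  have h2 : ⌊y⌋ ≤ ⌊x + 1⌋ := Int.floor_le_floor (by linarith)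
  rw [Int.floor_add_one] at h1 h2
  constructor <;> linarith

lemma floor_eq_close {x y : ℝ} (h : ⌊x⌋ = ⌊y⌋) : |x - y| ≤ 1 := (Int.abs_sub_lt_one_of_floor_eq_floor h).le

lemma card_box {n : ℕ} (T : Finset (Fin n → ℤ)) (L : ℝ) (hL : 0 ≤ L)
    (h : ∀ x ∈ T, ∀ y ∈ T, ∀ i, |(x i:ℝ) - y i| ≤ L) : (T.card : ℝ) ≤ (L + 1) ^ n := by
  have := card_box_fiber T ∅ L 1 hL h ?_
  · simpa using this
  · intro T' _ hag
    have : T'.card ≤ 1 := by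
      rw [Finset.card_le_one]
      intro x hx y hy
      funext i
      exact hag x hx y hy i (by simp)
    exact_mod_cast this

/-- big-`d` part via cells. -/
lemma disc_cells {n : ℕ} (hn : 1 ≤ n) (f1 f2 : (Fin n → ℤ) → ℝ≥0∞) (H D0 R S w Λ : ℝ)
    (hR : 0 < R) (hS : 0 < S) (hw : 0 < w) (hΛ : 0 < Λ) (hH0 : 0 ≤ H)
    (hf1 : ∀ j, f1 j ≠ 0 → ∃ p, S ≤ |(j p : ℝ)|)
    (hf2 : ∀ j, f2 j ≠ 0 → ∀ i, |(j i : ℝ)| ≤ R)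
    (hw1 : H + 10 * n * R ^ 2 ≤ S * w)
    (hD0 : 4 * w ≤ D0) (hD1 : Λ ≤ D0) (hH : H ≤ Λ ^ 2) :
    ∑' j1, ∑' d, ∑' j2, ind (¬ (∀ i, |(d i : ℝ)| ≤ D0) ∧ quadC H j1 d j2) *
        (f1 j1 * f2 j2 * f1 (j1 - d) * f2 (j2 + d))
      ≤ ENNReal.ofReal ((2 * R + 1) ^ (n - 2) * (2 * (1 + 4 * (n + 1) * w) * (1 + 8 * (n + 1) * Λ)))
         * ENNReal.ofReal (3 ^ n * 3) * ENNReal.ofReal 3 * (∑' j, f1 j ^ 2) * (∑' j, f2 j ^ 2) := by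
  classical
  let cu : (Fin n → ℤ) → (Fin n → ℤ) := fun j i => ⌊(j i : ℝ) / (2 * R)⌋
  have hne : Nonempty (Fin n) := ⟨⟨0, by omega⟩⟩
  -- direction selection
  have hdir : ∀ c : Fin n → ℤ, ∃ (v : Fin n → ℝ) (p : Fin n),
      (∃ j0, cu j0 = c ∧ f1 j0 ≠ 0) → |v p| = 1 ∧ (∀ i, |v i| ≤ 1) ∧
        ∃ (j0 : Fin n → ℤ) (s : ℝ), cu j0 = c ∧ S ≤ s ∧ ∀ i, (j0 i : ℝ) = s * v i := by
    intro c
    by_cases h : ∃ j0, cu j0 = c ∧ f1 j0 ≠ 0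
    · obtain ⟨j0, hc, hf⟩ := h
      obtain ⟨p0, hp0⟩ := hf1 j0 hf
      obtain ⟨p, -, hp⟩ := Finset.exists_max_image (Finset.univ : Finset (Fin n)) (fun i => |(j0 i : ℝ)|)
        Finset.univ_nonempty
      have hps : S ≤ |(j0 p : ℝ)| := hp0.trans (hp p0 (Finset.mem_univ _))
      have hpp : 0 < |(j0 p : ℝ)| := by linarith
      refine ⟨fun i => (j0 i : ℝ) / |(j0 p : ℝ)|, p, fun _ => ⟨?_, ?_, j0, |(j0 p : ℝ)|, hc, hps, ?_⟩⟩
      · rw [abs_div, abs_abs, div_self hpp.ne']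
      · intro i
        rw [abs_div, abs_abs, div_le_one hpp]
        exact hp i (Finset.mem_univ _)
      · intro i; field_simp
    · exact ⟨0, Classical.arbitrary _, fun h' => absurd h' h⟩
  choose v p hvp using hdir
  let κ : (Fin n → ℤ) → (Fin n → ℤ) × ℤ := fun j => (cu j, ⌊(∑ i, v (cu j) i * (j i : ℝ)) / w⌋)
  let β : (Fin n → ℤ) × ℤ → (Fin n → ℤ) → ℤ := fun k j => ⌊(∑ i, v k.1 i * (j i : ℝ)) / w⌋
  let EA : (Fin n → ℤ) × ℤ → (Fin n → ℤ) → Prop := fun k j =>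
    (∀ i, |cu j i - k.1 i| ≤ 1) ∧ |⌊(∑ i, v k.1 i * (j i : ℝ)) / w⌋ - k.2| ≤ 1
  let EB : (Fin n → ℤ) × ℤ → ℤ → (Fin n → ℤ) → Prop := fun k b j =>
    |⌊(∑ i, v k.1 i * (j i : ℝ)) / w⌋ - b| ≤ 1
  let Q : (Fin n → ℤ) → (Fin n → ℤ) → (Fin n → ℤ) → Prop := fun j1 d j2 =>
    (f1 j1 ≠ 0 ∧ f2 j2 ≠ 0 ∧ f1 (j1 - d) ≠ 0 ∧ f2 (j2 + d) ≠ 0) ∧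
    ¬ (∀ i, |(d i : ℝ)| ≤ D0) ∧ quadC H j1 d j2
  have hQd : ∀ j1 d j2, Q j1 d j2 → ∀ i, |(d i : ℝ)| ≤ 2 * R := by
    rintro j1 d j2 ⟨⟨-, h2, -, h4⟩, -⟩ i
    have a1 := hf2 _ h4 i
    have a2 := hf2 _ h2 i
    have : (d i : ℝ) = ((j2 + d) i : ℤ) - (j2 i : ℤ) := by simp
    rw [this]
    exact (abs_sub _ _).trans (by linarith)
  have hcube : ∀ j j' : Fin n → ℤ, cu j = cu j' → ∀ i, |(j i : ℝ) - j' i| ≤ 2 * R := by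
    intro j j' h i
    have h1 := floor_eq_close (congrFun h i)
    rw [← sub_div, abs_div, abs_of_pos (show (0:ℝ) < 2 * R by linarith), div_le_one (by linarith)] at h1
    exact h1
  have hslab : ∀ (c j j' : Fin n → ℤ), ⌊(∑ i, v c i * (j i : ℝ)) / w⌋ = ⌊(∑ i, v c i * (j' i : ℝ)) / w⌋ →
      |∑ i, v c i * ((j i : ℝ) - j' i)| ≤ w := by
    intro c j j' h
    have h1 := floor_eq_close h
    rw [← sub_div, abs_div, abs_of_pos hw, div_le_one hw, ← Finset.sum_sub_distrib] at h1
    simpa [mul_sub] using h1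
  have hQv : ∀ j1 d j2, Q j1 d j2 → |∑ i, v (cu j1) i * (d i : ℝ)| ≤ w := by
    intro j1 d j2 hq
    have hd := hQd _ _ _ hq
    obtain ⟨⟨h1, h2, h3, h4⟩, -, h6⟩ := hq
    obtain ⟨-, -, j0, s, hc, hs, hj0⟩ := hvp (cu j1) ⟨j1, rfl, h1⟩
    have e : s * ∑ i, v (cu j1) i * (d i : ℝ) = ∑ i, (d i : ℝ) * ((j1 i : ℝ) - j2 i - d i) +
        ∑ i, (d i : ℝ) * (((j0 i : ℝ) - j1 i) + j2 i + d i) := by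
      rw [Finset.mul_sum, ← Finset.sum_add_distrib]
      refine Finset.sum_congr rfl fun i _ => ?_
      rw [hj0 i]; ring
    have e2 : |∑ i, (d i : ℝ) * (((j0 i : ℝ) - j1 i) + j2 i + d i)| ≤ ∑ i : Fin n, 10 * R ^ 2 := by
      refine (Finset.abs_sum_le_sum_abs _ _).trans (Finset.sum_le_sum fun i _ => ?_)
      rw [abs_mul]
      have b1 := hcube j0 j1 hc i
      have b2 := hf2 _ h2 i
      have b3 := hd i
      have b4 : |((j0 i : ℝ) - j1 i) + j2 i + d i| ≤ 5 * R := by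
        refine (abs_add_le _ _).trans ?_
        have := abs_add_le ((j0 i : ℝ) - j1 i) (j2 i)
        linarith
      calc _ ≤ (2 * R) * (5 * R) := mul_le_mul b3 b4 (abs_nonneg _) (by linarith)
        _ = _ := by ring
    have e3 : |s * ∑ i, v (cu j1) i * (d i : ℝ)| ≤ S * w := by
      rw [e]
      refine (abs_add_le _ _).trans (le_trans ?_ hw1)
      unfold quadC at h6
      simp only [Finset.sum_const, Finset.card_univ, Fintype.card_fin, nsmul_eq_mul] at e2
      linarith
    rw [abs_mul, abs_of_pos (by linarith)] at e3
    have : S * |∑ i, v (cu j1) i * (d i : ℝ)| ≤ S * w :=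
      le_trans (by gcongr) e3
    exact le_of_mul_le_mul_left this hS
  -- maximal coordinate of d
  have hmax : ∀ j1 d j2, Q j1 d j2 → ∃ q0 D, |(d q0 : ℝ)| = D ∧ D0 ≤ D ∧ ∀ i, |(d i : ℝ)| ≤ D := by
    rintro j1 d j2 ⟨-, h5, -⟩
    obtain ⟨q, -, hq⟩ := Finset.exists_max_image (Finset.univ : Finset (Fin n)) (fun i => |(d i : ℝ)|)
        Finset.univ_nonempty
    refine ⟨q, _, rfl, ?_, fun i => hq i (Finset.mem_univ _)⟩
    push Not at h5
    obtain ⟨i, hi⟩ := h5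
    exact hi.le.trans (hq i (Finset.mem_univ _))
  have hfin : ∀ D, D0 ≤ D → (2 * R + 1) ^ (n - 2) *
      (2 * (1 + 4 * (n + 1) * w) * (1 + 4 * (n + 1) * (2 * H) / D)) ≤
      (2 * R + 1) ^ (n - 2) * (2 * (1 + 4 * (n + 1) * w) * (1 + 8 * (n + 1) * Λ)) := by
    intro D hD
    have hDp : 0 < D := by linarith
    gcongr
    rw [div_le_iff₀ hDp]
    have : Λ ^ 2 ≤ Λ * D := by nlinarith
    have h8 : (0:ℝ) ≤ 8 * (n + 1) := by positivity
    nlinarith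
  have hfull := cell_bound f1 f2 Q κ β EA EB
    (ENNReal.ofReal ((2 * R + 1) ^ (n - 2) * (2 * (1 + 4 * (n + 1) * w) * (1 + 8 * (n + 1) * Λ))))
    (ENNReal.ofReal (3 ^ n * 3)) (ENNReal.ofReal 3) ?_ ?_ ?_ ?_ ?_
  · refine le_trans ?_ hfull
    refine ENNReal.tsum_le_tsum fun j1 => ENNReal.tsum_le_tsum fun d =>
            ENNReal.tsum_le_tsum fun j2 => ?_
    by_cases h : f1 j1 ≠ 0 ∧ f2 j2 ≠ 0 ∧ f1 (j1 - d) ≠ 0 ∧ f2 (j2 + d) ≠ 0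
    · gcongr
      apply ind_mono
      exact fun h' => ⟨h, h'⟩
    · have : f1 j1 * f2 j2 * f1 (j1 - d) * f2 (j2 + d) = 0 := by
        simp only [mul_eq_zero]
        tauto
      rw [this]; simp
  · intro j1 d j2 hq
    have hd := hQd _ _ _ hq
    have hv := hQv _ _ _ hq
    refine ⟨⟨by simp [κ], by simp [κ]⟩, ⟨?_, ?_⟩, by simp [EB, β], ?_⟩
    · intro i
      apply floor_close
      rw [← sub_div, abs_div, abs_of_pos (show (0:ℝ) < 2 * R by linarith), div_le_one (by linarith)]
      simp only [Pi.sub_apply]; push_cast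
      rw [sub_sub_cancel_left, abs_neg]; exact hd i
    · apply floor_close
      rw [← sub_div, abs_div, abs_of_pos hw, div_le_one hw, ← Finset.sum_sub_distrib]
      rw [← abs_neg, ← Finset.sum_neg_distrib]
      refine le_trans (le_of_eq ?_) hv
      congr 1
      refine Finset.sum_congr rfl fun i _ => ?_
      simp only [Pi.sub_apply, κ]; push_cast; ring
    · apply floor_close
      rw [← sub_div, abs_div, abs_of_pos hw, div_le_one hw, ← Finset.sum_sub_distrib]
      refine le_trans (le_of_eq ?_) hv
      congr 1
      refine Finset.sum_congr rfl fun i _ => ?_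
      simp only [Pi.add_apply, κ]; push_cast; ring
  · intro j
    rw [ENNReal.tsum_prod']
    simp only [EA]
    simp_rw [ind_and, ENNReal.tsum_mul_left]
    have h3 : ∀ c : Fin n → ℤ, ∑' b : ℤ, ind (|⌊(∑ i, v c i * (j i : ℝ)) / w⌋ - b| ≤ 1) ≤ ENNReal.ofReal 3 := by
      intro c
      apply tsum_ind_le
      intro T hT
      have := card_le_of_diam T 2 (by norm_num) ?_
      · linarith
      intro x hx y hy
      have h1 := abs_le.mp (hT x hx)
      have h2 := abs_le.mp (hT y hy)
      have : |x - y| ≤ 2 := by rw [abs_le]; constructor <;> linarith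
      exact_mod_cast this
    calc _ ≤ ∑' c : Fin n → ℤ, ind (∀ i, |cu j i - c i| ≤ 1) * ENNReal.ofReal 3 := by
          refine ENNReal.tsum_le_tsum fun c => ?_
          gcongr
          exact h3 c
      _ ≤ ENNReal.ofReal (3 ^ n) * ENNReal.ofReal 3 := by
          rw [ENNReal.tsum_mul_right]
          gcongr
          apply tsum_ind_le
          intro T hT
          have := card_box T 2 (by norm_num) ?_
          · norm_num at this; exact this
          intro x hx y hy i
          have h1 := abs_le.mp (hT x hx i)
          have h2 := abs_le.mp (hT y hy i)
          have : |x i - y i| ≤ 2 := by rw [abs_le]; constructor <;> linarith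
          exact_mod_cast this
      _ = _ := by rw [← ENNReal.ofReal_mul (by positivity)]
  · intro k j
    apply tsum_ind_le
    intro T hT
    have := card_le_of_diam T 2 (by norm_num) ?_
    · linarith
    intro x hx y hy
    have h1 := abs_le.mp (hT x hx)
    have h2 := abs_le.mp (hT y hy)
    have : |x - y| ≤ 2 := by rw [abs_le]; constructor <;> linarith
    exact_mod_cast this
  · intro k b j1 d
    apply tsum_ind_le
    intro T hT
    rcases T.eq_empty_or_nonempty with rfl | ⟨x0, hx0⟩
    · simp; positivity
    obtain ⟨hq0, hk, -⟩ := hT x0 hx0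
    obtain ⟨q0, D, hqD, hDD, hdD⟩ := hmax _ _ _ hq0
    have hv := hQv _ _ _ hq0
    have hk1 : k.1 = cu j1 := by rw [← hk]
    obtain ⟨hv1, hv2, -⟩ := hvp (cu j1) ⟨j1, rfl, hq0.1.1⟩
    refine (card_slab T (p (cu j1)) (v (cu j1)) (fun i => (d i : ℝ)) (2 * R) w (2 * H) D
      (by linarith) hw.le (by linarith) (by linarith) hv1 hv2 hdD q0 hqD hv (by linarith)
      ?_ ?_ ?_).trans (hfin D hDD)
    · intro x hx y hy i
      have a1 := hf2 _ (hT x hx).1.1.2.1 i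
      have a2 := hf2 _ (hT y hy).1.1.2.1 i
      exact (abs_sub _ _).trans (by linarith)
    · intro x hx y hy
      apply hslab
      have a1 := (hT x hx).2.2
      have a2 := (hT y hy).2.2
      simp only [β, hk1] at a1 a2
      rw [a1, a2]
    · intro x hx y hy
      have a1 := (hT x hx).1.2.2
      have a2 := (hT y hy).1.2.2
      unfold quadC at a1 a2
      have : ∑ i, (d i : ℝ) * ((x i : ℝ) - y i) = ∑ i, (d i : ℝ) * ((j1 i : ℝ) - y i - d i) -
          ∑ i, (d i : ℝ) * ((j1 i : ℝ) - x i - d i) := by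
        rw [← Finset.sum_sub_distrib]; refine Finset.sum_congr rfl fun i _ => ?_; ring
      rw [this]
      exact (abs_sub _ _).trans (by linarith)
  · intro k b j2 d
    apply tsum_ind_le
    intro T hT
    rcases T.eq_empty_or_nonempty with rfl | ⟨x0, hx0⟩
    · simp; positivity
    obtain ⟨hq0, hk, -⟩ := hT x0 hx0
    obtain ⟨q0, D, hqD, hDD, hdD⟩ := hmax _ _ _ hq0
    have hv := hQv _ _ _ hq0
    have hk1 : k.1 = cu x0 := by rw [← hk]
    obtain ⟨hv1, hv2, -⟩ := hvp (cu x0) ⟨x0, rfl, hq0.1.1⟩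
    refine (card_slab T (p (cu x0)) (v (cu x0)) (fun i => (d i : ℝ)) (2 * R) w (2 * H) D
      (by linarith) hw.le (by linarith) (by linarith) hv1 hv2 hdD q0 hqD hv (by linarith)
      ?_ ?_ ?_).trans (hfin D hDD)
    · intro x hx y hy i
      apply hcube
      have a1 := congrArg Prod.fst (hT x hx).2.1
      have a2 := congrArg Prod.fst (hT y hy).2.1
      simp only [κ] at a1 a2
      rw [a1, a2]
    · intro x hx y hy
      apply hslab
      have a1 := (hT x hx).2.1
      have a2 := (hT y hy).2.1
      have c1 : cu x = cu x0 := by rw [← hk1, ← a1]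
      have c2 : cu y = cu x0 := by rw [← hk1, ← a2]
      have b1 := congrArg Prod.snd a1
      have b2 := congrArg Prod.snd a2
      simp only [κ, c1, c2] at b1 b2
      rw [b1, b2]
    · intro x hx y hy
      have a1 := (hT x hx).1.2.2
      have a2 := (hT y hy).1.2.2
      unfold quadC at a1 a2
      have : ∑ i, (d i : ℝ) * ((x i : ℝ) - y i) = ∑ i, (d i : ℝ) * ((x i : ℝ) - j2 i - d i) -
          ∑ i, (d i : ℝ) * ((y i : ℝ) - j2 i - d i) := by
        rw [← Finset.sum_sub_distrib]; refine Finset.sum_congr rfl fun i _ => ?_; ring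
      rw [this]
      exact (abs_sub _ _).trans (by linarith)

-- part D
open MeasureTheory
open scoped ENNReal NNReal

/-- `λ^n K`. -/
noncomputable def Kd (n : ℕ) (lam N1 N2 : ℝ) : ℝ :=
  if n = 1 then 1 + lam * N2 / N1 else lam ^ (n - 1) * N2 ^ (n - 2) + lam ^ n * N2 ^ n / N1

lemma Kd_pos (n : ℕ) {lam N1 N2 : ℝ} (hl : 1 ≤ lam) (h2 : 1 ≤ N2) (h12 : N2 ≤ N1) :
    0 < Kd n lam N1 N2 := by
  have h0 : 0 < N2 := by linarith
  have h1 : 0 < N1 := by linarith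
  have h3 : 0 < lam := by linarith
  unfold Kd
  split_ifs <;> positivity

lemma Kd_ge (n : ℕ) (hn : 1 ≤ n) {lam N1 N2 : ℝ} (hl : 1 ≤ lam) (h2 : 1 ≤ N2) (h12 : N2 ≤ N1) :
    lam ^ n * N2 ^ n / N1 ≤ Kd n lam N1 N2 := by
  unfold Kd
  split_ifs with h
  · subst h; simp
  · have : 0 ≤ lam ^ (n - 1) * N2 ^ (n - 2) := by positivity
    linarith

/-- The discrete sum. -/
noncomputable def discS {n : ℕ} (H : ℝ) (f1 f2 : (Fin n → ℤ) → ℝ≥0∞) : ℝ≥0∞ :=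
  ∑' j1, ∑' d, ∑' j2, ind (quadC H j1 d j2) * (f1 j1 * f2 j2 * f1 (j1 - d) * f2 (j2 + d))

/-- comparable case -/
lemma disc_comp (n : ℕ) (hn : 1 ≤ n) (Cn : ℝ) (hCn : 0 < Cn) (lam N1 N2 a : ℝ) (hl : 1 ≤ lam) (h2 : 1 ≤ N2)
    (h12 : N2 ≤ N1) (ha : 1 ≤ a) (hN : N1 ≤ Cn * N2) (f1 f2 : (Fin n → ℤ) → ℝ≥0∞)
    (hf2 : ∀ j, f2 j ≠ 0 → ∀ i, |(j i : ℝ)| ≤ 2 * (lam * N2)) :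
    discS (8 * (lam * a) ^ 2) f1 f2 ≤ 
      ENNReal.ofReal (28 * 9 ^ (n - 1) * Cn * (a * Kd n lam N1 N2)) * (∑' j, f1 j ^ 2) * (∑' j, f2 j ^ 2) := by
  have hLN : 1 ≤ lam * N2 := by nlinarith
  have hLa : 1 ≤ lam * a := by nlinarith
  set R := 2 * (lam * N2) with hR
  have := disc_schur f1 f2 (8 * (lam * a) ^ 2) (2 * R) ((4 * R + 1) ^ (n - 1) * (14 * (lam * a))) R hf2 ?_
    (by positivity)
  · refine le_trans ?_ (this.trans ?_)
    · unfold discS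
      refine ENNReal.tsum_le_tsum fun j1 => ENNReal.tsum_le_tsum fun d =>
            ENNReal.tsum_le_tsum fun j2 => ?_
      by_cases h : f2 j2 = 0
      · simp [h]
      by_cases h' : f2 (j2 + d) = 0
      · simp [h']
      gcongr
      apply ind_mono
      intro hq
      refine ⟨fun i => ?_, hq⟩
      have a1 := hf2 _ h' i
      have a2 := hf2 _ h i
      have : (d i : ℝ) = ((j2 + d) i : ℤ) - (j2 i : ℤ) := by simp
      rw [this]
      exact (abs_sub _ _).trans (by linarith)
    · gcongr
      rw [show (2:ℝ≥0∞) = ENNReal.ofReal 2 by simp, ← ENNReal.ofReal_mul (by norm_num)]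
      apply ENNReal.ofReal_le_ofReal
      have h1 : (4 * R + 1) ^ (n - 1) ≤ (9 * (lam * N2)) ^ (n - 1) := by
        apply pow_le_pow_left₀ (by positivity); rw [hR]; linarith
      have h3 : lam ^ n * N2 ^ (n - 1) ≤ Cn * Kd n lam N1 N2 := by
        have h4 := Kd_ge n hn hl h2 h12
        refine le_trans ?_ (mul_le_mul_of_nonneg_left h4 hCn.le)
        rw [mul_div_assoc', le_div_iff₀ (by linarith)]
        obtain ⟨m, rfl⟩ : ∃ m, n = m + 1 := ⟨n - 1, by omega⟩
        simp only [Nat.add_sub_cancel]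
        calc lam ^ (m+1) * N2 ^ m * N1 ≤ lam ^ (m+1) * N2 ^ m * (Cn * N2) := by gcongr
          _ = _ := by ring
      calc 2 * ((4 * R + 1) ^ (n - 1) * (14 * (lam * a)))
          ≤ 2 * ((9 * (lam * N2)) ^ (n - 1) * (14 * (lam * a))) := by gcongr
        _ = 28 * 9 ^ (n - 1) * a * (lam ^ n * N2 ^ (n - 1)) := by
            obtain ⟨m, rfl⟩ : ∃ m, n = m + 1 := ⟨n - 1, by omega⟩
            simp only [Nat.add_sub_cancel]; rw [mul_pow, mul_pow]; ring
        _ ≤ 28 * 9 ^ (n - 1) * a * (Cn * Kd n lam N1 N2) := by gcongr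
        _ = _ := by ring
  · intro j1 j2 _ _ T hT
    have := card_quad T ⟨0, by omega⟩ (fun i => (j1 i : ℝ) - j2 i) (2 * R) (3 * (lam * a))
      (by positivity) (by positivity) (fun x hx => (hT x hx).1) (fun x hx => ?_)
    · refine this.trans ?_
      rw [show 2 * (2 * R) + 1 = 4 * R + 1 by ring]
      gcongr; linarith
    · have := (hT x hx).2.2
      unfold quadC at this
      refine this.trans ?_
      nlinarith

/-- far case, one torus dimension -/
lemma disc_far_one (κ : ℝ) (hκ : 0 < κ) (lam N1 N2 a : ℝ) (hl : 1 ≤ lam) (h2 : 1 ≤ N2)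
    (h12 : N2 ≤ N1) (ha : 1 ≤ a) (ha2 : a ≤ 16 * N2) (hN : 2000 / κ * N2 ≤ N1)
    (f1 f2 : (Fin 1 → ℤ) → ℝ≥0∞)
    (hf1 : ∀ j, f1 j ≠ 0 → ∃ p, κ * (lam * N1) ≤ |(j p : ℝ)|)
    (hf2 : ∀ j, f2 j ≠ 0 → ∀ i, |(j i : ℝ)| ≤ 2 * (lam * N2)) :
    discS (8 * (lam * a) ^ 2) f1 f2 ≤ 
      ENNReal.ofReal ((2 + 2048 / κ) * (a * Kd 1 lam N1 N2)) * (∑' j, f1 j ^ 2) * (∑' j, f2 j ^ 2) := by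
  have hLN : 1 ≤ lam * N2 := by nlinarith
  have hLa : 1 ≤ lam * a := by nlinarith
  have hN1 : 1 ≤ N1 := by linarith
  have hS : 2000 * (lam * N2) ≤ κ * (lam * N1) := by
    have : 2000 * N2 ≤ κ * N1 := by
      have := mul_le_mul_of_nonneg_left hN hκ.le
      calc 2000 * N2 = κ * (2000 / κ * N2) := by field_simp
        _ ≤ _ := this
    nlinarith
  set R := 2 * (lam * N2) with hR
  have := disc_schur f1 f2 (8 * (lam * a) ^ 2) (2 * R) (64 * (lam * a) ^ 2 / (κ * (lam * N1)) + 1) R hf2 ?_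
    (by positivity)
  · refine le_trans ?_ (this.trans ?_)
    · unfold discS
      refine ENNReal.tsum_le_tsum fun j1 => ENNReal.tsum_le_tsum fun d =>
            ENNReal.tsum_le_tsum fun j2 => ?_
      by_cases h : f2 j2 = 0
      · simp [h]
      by_cases h' : f2 (j2 + d) = 0
      · simp [h']
      gcongr
      apply ind_mono
      intro hq
      refine ⟨fun i => ?_, hq⟩
      have a1 := hf2 _ h' i
      have a2 := hf2 _ h i
      have : (d i : ℝ) = ((j2 + d) i : ℤ) - (j2 i : ℤ) := by simp
      rw [this]
      exact (abs_sub _ _).trans (by linarith)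
    · gcongr
      rw [show (2:ℝ≥0∞) = ENNReal.ofReal 2 by simp, ← ENNReal.ofReal_mul (by norm_num)]
      apply ENNReal.ofReal_le_ofReal
      unfold Kd
      simp only [if_true]
      have e : 64 * (lam * a) ^ 2 / (κ * (lam * N1)) ≤ 1024 / κ * a * (lam * N2 / N1) := by
        have : 64 * (lam * a) ^ 2 / (κ * (lam * N1)) = 64 / κ * a * (lam * a / N1) := by
          field_simp
        rw [this]
        have : lam * a / N1 ≤ lam * (16 * N2) / N1 := by gcongr
        calc _ ≤ 64 / κ * a * (lam * (16 * N2) / N1) := by gcongr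
          _ = _ := by ring
      have e0 : 0 ≤ lam * N2 / N1 := by positivity
      have e1 : 0 ≤ 1024 / κ * a := by positivity
      have e2 : 0 ≤ a * (lam * N2 / N1) := by positivity
      calc _ ≤ 2 * (1024 / κ * a * (lam * N2 / N1) + a) := by linarith
        _ ≤ 2 * (1024 / κ * a * (lam * N2 / N1) + a) + 2 * (a * (lam * N2 / N1)) +
            2 * (1024 / κ * a) := by linarith
        _ = _ := by ring
  · intro j1 j2 hj1 hj2 T hT
    obtain ⟨p, hp⟩ := hf1 j1 hj1
    have hVp : κ * (lam * N1) / 2 ≤ |(j1 p : ℝ) - j2 p| := by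
      have := abs_sub_abs_le_abs_sub (j1 p : ℝ) (j2 p)
      have := hf2 _ hj2 p
      linarith
    have := card_line T p (fun i => (j1 i : ℝ) - j2 i) (2 * R) (8 * (lam * a) ^ 2)
      (by positivity) (by positivity) (fun x hx => (hT x hx).1) (by show _ ≤ |(j1 p : ℝ) - j2 p|; linarith)
      (fun x hx => (hT x hx).2.2)
    refine this.trans ?_
    simp only [Nat.sub_self, pow_zero, one_mul]
    have hp0 : 0 < κ * (lam * N1) / 2 := by positivity
    refine add_le_add_left ?_ 1
    calc 4 * (8 * (lam * a) ^ 2) / |(j1 p : ℝ) - j2 p| ≤ 4 * (8 * (lam * a) ^ 2) / (κ * (lam * N1) / 2) := by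
          gcongr
      _ = _ := by field_simp; ring

set_option maxHeartbeats 2000000 in
/-- far case, `n ≥ 2` -/
lemma disc_far (n : ℕ) (hn : 2 ≤ n) (κ : ℝ) (hκ : 0 < κ) (hκ1 : κ ≤ 1) : ∃ C : ℝ, 0 < C ∧
    ∀ (lam N1 N2 a : ℝ) (_hl : 1 ≤ lam) (_h2 : 1 ≤ N2)
    (_h12 : N2 ≤ N1) (_ha : 1 ≤ a) (_ha2 : a ≤ 16 * N2) (_hN : (2000 + 20 * n) / κ * N2 ≤ N1)
    (f1 f2 : (Fin n → ℤ) → ℝ≥0∞)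
    (_hf1 : ∀ j, f1 j ≠ 0 → ∃ p, κ * (lam * N1) ≤ |(j p : ℝ)|)
    (_hf2 : ∀ j, f2 j ≠ 0 → ∀ i, |(j i : ℝ)| ≤ 2 * (lam * N2)),
    discS (8 * (lam * a) ^ 2) f1 f2 ≤ 
      ENNReal.ofReal (C * (a * Kd n lam N1 N2)) * (∑' j, f1 j ^ 2) * (∑' j, f2 j ^ 2) := by
  set A : ℝ := 512 + 10 * n with hA
  have hA0 : 0 < A := by positivity
  set c1 : ℝ := 2 * (16 * (n + 1) * A / κ) * (25 * (n + 1)) * 5 ^ (n - 2) * (3 ^ n * 3) * 3 with hc1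
  set c2 : ℝ := 2 * (114 ^ (n - 2) * (4 * (520 * A + 28672) / κ + 7)) with hc2
  refine ⟨c1 + c2, by positivity, ?_⟩
  intro lam N1 N2 a hl h2 h12 ha ha2 hN f1 f2 hf1 hf2
  have hLN : 1 ≤ lam * N2 := by nlinarith
  set Λ := lam * a with hΛ
  have hLa : 1 ≤ Λ := by rw [hΛ]; nlinarith
  have hN1 : 1 ≤ N1 := by linarith
  set R := 2 * (lam * N2) with hR
  set S := κ * (lam * N1) with hS
  have hSR : (1000 + 10 * n) * R ≤ S := by
    have : (2000 + 20 * n) * N2 ≤ κ * N1 := by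
      have := mul_le_mul_of_nonneg_left hN hκ.le
      calc (2000 + 20 * (n:ℝ)) * N2 = κ * ((2000 + 20 * n) / κ * N2) := by field_simp
        _ ≤ _ := this
    have h3 := mul_le_mul_of_nonneg_left this (show 0 ≤ lam by linarith)
    rw [hR, hS]; linarith
  have hR2 : 2 ≤ R := by linarith
  have hΛR : Λ ≤ 8 * R := by rw [hΛ, hR]; nlinarith
  have hn0 : (0:ℝ) ≤ n := by positivity
  have hS1000 : 1000 * R ≤ S := by nlinarith
  have hS0 : 0 < S := by linarith
  set y := R ^ 2 / S with hy
  have hy0 : 0 < y := by positivity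
  set w := A * y with hw
  have hw0 : 0 < w := by positivity
  have hwR : w ≤ R := by
    rw [hw, hy, mul_div_assoc', div_le_iff₀ hS0]
    nlinarith
  set D0 := 4 * w + 3 * Λ with hD0
  have hΛS : Λ ^ 2 / S ≤ 64 * y := by
    rw [hy, mul_div_assoc']; gcongr; nlinarith
  have hΛS2 : Λ / S ≤ 1 := by
    rw [div_le_one hS0]; linarith
  -- target
  set Tg := Λ * (R / 2) ^ (n - 2) * (1 + κ * y / 4) with hTg
  have hTgt : Tg = a * Kd n lam N1 N2 := by
    rw [hTg, hy, hR, hS, hΛ]; unfold Kd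
    rw [if_neg (by omega)]
    obtain ⟨m, rfl⟩ : ∃ m, n = m + 2 := ⟨n - 2, by omega⟩
    simp only [Nat.add_sub_cancel, show m + 2 - 1 = m + 1 by omega]
    have : 2 * (lam * N2) / 2 = lam * N2 := by ring
    rw [this, mul_pow]
    field_simp
    ring
  have hsmall := disc_schur f1 f2 (8 * Λ ^ 2) D0 ((2 * D0 + 1) ^ (n - 1) * (64 * Λ ^ 2 / S + 1)) R hf2 ?_
    (by positivity)
  have hbig := disc_cells (by omega) f1 f2 (8 * Λ ^ 2) D0 R S w (3 * Λ) (by linarith) hS0 hw0 (by linarith)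
    (by positivity) hf1 hf2 ?_ (by linarith) (by linarith) (by nlinarith)
  · have hsum : discS (8 * Λ ^ 2) f1 f2 ≤ _ := le_trans ?_ (add_le_add hsmall hbig)
    · refine hsum.trans ?_
      have e1 : 2 * ENNReal.ofReal ((2 * D0 + 1) ^ (n - 1) * (64 * Λ ^ 2 / S + 1)) ≤
          ENNReal.ofReal (c2 * Tg) := by
        rw [show (2:ℝ≥0∞) = ENNReal.ofReal 2 by simp, ← ENNReal.ofReal_mul (by norm_num)]
        apply ENNReal.ofReal_le_ofReal
        have f1 : (2 * D0 + 1) ^ (n - 1) = (2 * D0 + 1) ^ (n - 2) * (2 * D0 + 1) := by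
          rw [← pow_succ]; congr 1; omega
        have f2 : (2 * D0 + 1) ^ (n - 2) ≤ 114 ^ (n - 2) * (R / 2) ^ (n - 2) := by
          rw [← mul_pow]
          apply pow_le_pow_left₀ (by positivity); linarith
        have f3 : (2 * D0 + 1) * (64 * Λ ^ 2 / S + 1) ≤
            (4 * (520 * A + 28672) / κ + 7) * (Λ * (1 + κ * y / 4)) := by
          have g1 : 2 * D0 + 1 ≤ 8 * w + 7 * Λ := by linarith
          have g2 : 64 * Λ ^ 2 / S + 1 = 64 * (Λ ^ 2 / S) + 1 := by ring
          have g3 : 0 ≤ Λ ^ 2 / S := by positivity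
          have g4 : w * (Λ ^ 2 / S) ≤ w * Λ := by
            have : Λ ^ 2 / S = Λ * (Λ / S) := by ring
            rw [this]; gcongr; nlinarith
          have g5 : Λ * (Λ ^ 2 / S) ≤ Λ * (64 * y) := by gcongr
          have g6 : w ≤ w * Λ := by nlinarith
          calc (2 * D0 + 1) * (64 * Λ ^ 2 / S + 1) ≤ (8 * w + 7 * Λ) * (64 * (Λ ^ 2 / S) + 1) := by
                rw [g2]; gcongr
            _ = 512 * (w * (Λ ^ 2 / S)) + 8 * w + 448 * (Λ * (Λ ^ 2 / S)) + 7 * Λ := by ring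
            _ ≤ 512 * (w * Λ) + 8 * (w * Λ) + 448 * (Λ * (64 * y)) + 7 * Λ := by gcongr
            _ = Λ * ((520 * A + 28672) * y + 7) := by rw [hw]; ring
            _ ≤ Λ * ((520 * A + 28672) * y + 7 + (4 * (520 * A + 28672) / κ + 7 * (κ * y / 4))) := by
                refine mul_le_mul_of_nonneg_left ?_ (by positivity)
                have : 0 ≤ (4 * (520 * A + 28672) / κ + 7 * (κ * y / 4)) := by positivity
                linarith
            _ = _ := by field_simp; ring
        rw [f1]
        calc 2 * ((2 * D0 + 1) ^ (n - 2) * (2 * D0 + 1) * (64 * Λ ^ 2 / S + 1))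
            = 2 * ((2 * D0 + 1) ^ (n - 2) * ((2 * D0 + 1) * (64 * Λ ^ 2 / S + 1))) := by ring
          _ ≤ 2 * ((114 ^ (n - 2) * (R / 2) ^ (n - 2)) * ((4 * (520 * A + 28672) / κ + 7) * (Λ * (1 + κ * y / 4)))) := by
              gcongr
          _ = _ := by rw [hc2, hTg]; ring
      have e2 : ENNReal.ofReal ((2 * R + 1) ^ (n - 2) *
          (2 * (1 + 4 * (n + 1) * w) * (1 + 8 * (n + 1) * (3 * Λ)))) * ENNReal.ofReal (3 ^ n * 3) *
          ENNReal.ofReal 3 ≤ ENNReal.ofReal (c1 * Tg) := by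
        rw [← ENNReal.ofReal_mul (by positivity), ← ENNReal.ofReal_mul (by positivity)]
        apply ENNReal.ofReal_le_ofReal
        have f2 : (2 * R + 1) ^ (n - 2) ≤ 5 ^ (n - 2) * (R / 2) ^ (n - 2) := by
          rw [← mul_pow]
          apply pow_le_pow_left₀ (by positivity); linarith
        have f3 : 1 + 4 * (n + 1) * w ≤ (16 * (n + 1) * A / κ) * (1 + κ * y / 4) := by
          have : (16 * (n + 1) * A / κ) * (1 + κ * y / 4) = 16 * (n + 1) * A / κ + 4 * (n + 1) * (A * y) := by
            field_simp; ring
          rw [this, ← hw]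
          have : 1 ≤ 16 * (n + 1) * A / κ := by
            rw [le_div_iff₀ hκ]; nlinarith
          linarith
        have f4 : 1 + 8 * (n + 1) * (3 * Λ) ≤ 25 * (n + 1) * Λ := by nlinarith
        calc _ ≤ (5 ^ (n - 2) * (R / 2) ^ (n - 2)) * (2 * ((16 * (n + 1) * A / κ) * (1 + κ * y / 4)) * 
              (25 * (n + 1) * Λ)) * (3 ^ n * 3) * 3 := by gcongr
          _ = _ := by rw [hc1, hTg]; ring
      calc _ ≤ ENNReal.ofReal (c2 * Tg) * (∑' j, f1 j ^ 2) * (∑' j, f2 j ^ 2) +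
            ENNReal.ofReal (c1 * Tg) * (∑' j, f1 j ^ 2) * (∑' j, f2 j ^ 2) := by gcongr
        _ = ENNReal.ofReal ((c1 + c2) * Tg) * (∑' j, f1 j ^ 2) * (∑' j, f2 j ^ 2) := by
            rw [add_mul c1 c2 Tg, ENNReal.ofReal_add (by positivity) (by positivity)]; ring
        _ = _ := by rw [hTgt]
    · unfold discS
      simp_rw [← ENNReal.tsum_add, ← add_mul]
      refine ENNReal.tsum_le_tsum fun j1 => ENNReal.tsum_le_tsum fun d =>
            ENNReal.tsum_le_tsum fun j2 => ?_
      gcongr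
      by_cases h : ∀ i, |(d i : ℝ)| ≤ D0
      · refine le_add_right (ind_mono fun hq => ⟨h, hq⟩)
      · refine le_add_left (ind_mono fun hq => ⟨h, hq⟩)
  · have : S * w = A * R ^ 2 := by rw [hw, hy]; field_simp
    rw [this, hA]; nlinarith
  · intro j1 j2 hj1 hj2 T hT
    obtain ⟨p, hp⟩ := hf1 j1 hj1
    have hVp : S - R ≤ |(j1 p : ℝ) - j2 p| := by
      have := abs_sub_abs_le_abs_sub (j1 p : ℝ) (j2 p)
      have := hf2 _ hj2 p
      linarith
    have hVp2 : S / 2 ≤ |(j1 p : ℝ) - j2 p| := by linarith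
    have := card_line T p (fun i => (j1 i : ℝ) - j2 i) D0 (8 * Λ ^ 2)
      (by positivity) (by positivity) (fun x hx => (hT x hx).2.1) (by show _ ≤ |(j1 p : ℝ) - j2 p|; linarith)
      (fun x hx => (hT x hx).2.2)
    refine this.trans (mul_le_mul_of_nonneg_left (add_le_add_left ?_ 1) (by positivity))
    calc 4 * (8 * Λ ^ 2) / |(j1 p : ℝ) - j2 p| ≤ 4 * (8 * Λ ^ 2) / (S / 2) := by
          gcongr
      _ = _ := by field_simp; ring

lemma disc_main (n : ℕ) (hn : 1 ≤ n) (κ : ℝ) (hκ : 0 < κ) (hκ1 : κ ≤ 1) : ∃ C : ℝ, 0 < C ∧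
    ∀ (lam N1 N2 a : ℝ) (_hl : 1 ≤ lam) (_h2 : 1 ≤ N2)
    (_h12 : N2 ≤ N1) (_ha : 1 ≤ a) (_ha2 : a ≤ 16 * N2)
    (f1 f2 : (Fin n → ℤ) → ℝ≥0∞)
    (_hf1 : (2000 + 20 * n) / κ * N2 < N1 → ∀ j, f1 j ≠ 0 → ∃ p, κ * (lam * N1) ≤ |(j p : ℝ)|)
    (_hf2 : ∀ j, f2 j ≠ 0 → ∀ i, |(j i : ℝ)| ≤ 2 * (lam * N2)),
    discS (8 * (lam * a) ^ 2) f1 f2 ≤ 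
      ENNReal.ofReal (C * (a * Kd n lam N1 N2)) * (∑' j, f1 j ^ 2) * (∑' j, f2 j ^ 2) := by
  set Cn : ℝ := (2000 + 20 * n) / κ with hCn
  have hCn0 : 0 < Cn := by positivity
  rcases Nat.lt_or_ge 1 n with h | h
  · obtain ⟨C, hC, hfar⟩ := disc_far n h κ hκ hκ1
    refine ⟨C + 28 * 9 ^ (n - 1) * Cn, by positivity, ?_⟩
    intro lam N1 N2 a hl h2 h12 ha ha2 f1 f2 hf1 hf2
    have hK := Kd_pos n hl h2 h12
    rcases lt_or_ge (Cn * N2) N1 with hN | hN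
    · refine (hfar lam N1 N2 a hl h2 h12 ha ha2 hN.le f1 f2 (hf1 hN) hf2).trans ?_
      gcongr
      have : 0 ≤ 28 * 9 ^ (n - 1) * Cn := by positivity
      linarith
    · refine (disc_comp n hn Cn hCn0 lam N1 N2 a hl h2 h12 ha hN f1 f2 hf2).trans ?_
      gcongr
      linarith
  · obtain rfl : n = 1 := by omega
    refine ⟨(2 + 2048 / κ) + 28 * 9 ^ (1 - 1) * Cn, by positivity, ?_⟩
    intro lam N1 N2 a hl h2 h12 ha ha2 f1 f2 hf1 hf2
    have hK := Kd_pos 1 hl h2 h12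
    rcases lt_or_ge (Cn * N2) N1 with hN | hN
    · refine (disc_far_one κ hκ lam N1 N2 a hl h2 h12 ha ha2 ?_ f1 f2 (hf1 hN) hf2).trans ?_
      · refine le_trans ?_ hN.le
        rw [hCn]; gcongr; simp
      · generalize 2 + 2048 / κ = c0
        gcongr
        have : 0 ≤ 28 * 9 ^ (1 - 1) * Cn := by positivity
        linarith
    · refine (disc_comp 1 hn Cn hCn0 lam N1 N2 a hl h2 h12 ha hN f1 f2 hf2).trans ?_
      gcongr
      have : 0 ≤ 2 + 2048 / κ := by positivity
      linarith

-- part E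
open MeasureTheory
open scoped ENNReal NNReal

lemma measurable_ind {α : Type*} [MeasurableSpace α] {P : α → Prop} (h : MeasurableSet {x | P x}) :
    Measurable (fun x => ind (P x)) := by
  classical
  unfold ind
  exact Measurable.ite h measurable_const measurable_const

lemma kq_half (Φ : ℝ → ℝ≥0∞) (c : ℝ) :
    ∫⁻ x in Set.Ioi (0:ℝ), ENNReal.ofReal |x| * Φ (2 * x ^ 2 + c) ≤ ∫⁻ s, Φ s := by
  have h := lintegral_image_eq_lintegral_abs_deriv_mul (s := Set.Ioi (0:ℝ)) (f := fun x => 2 * x ^ 2 + c)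
    (f' := fun x => 4 * x) measurableSet_Ioi (fun x _ => by
      have : HasDerivAt (fun x : ℝ => 2 * x ^ 2 + c) (4 * x) x := by
        have := ((hasDerivAt_pow 2 x).const_mul 2).add_const c
        have e : 4 * x = 2 * (((2:ℕ):ℝ) * x ^ (2 - 1)) := by norm_num; ring
        rw [e]; exact this
      exact this.hasDerivWithinAt) (by
      intro x hx y hy hxy
      simp only [Set.mem_Ioi] at hx hy
      simp only [add_left_inj, mul_eq_mul_left_iff] at hxy
      have : x ^ 2 = y ^ 2 := by rcases hxy with h | h <;> [exact h; norm_num at h]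
      exact (pow_left_inj₀ hx.le hy.le two_ne_zero).mp this) Φ
  calc _ ≤ ∫⁻ x in Set.Ioi (0:ℝ), ENNReal.ofReal |4 * x| * Φ (2 * x ^ 2 + c) := by
        apply lintegral_mono
        intro x
        refine mul_le_mul' (ENNReal.ofReal_le_ofReal ?_) le_rfl
        rw [abs_mul]; norm_num; linarith [abs_nonneg x]
    _ = _ := h.symm
    _ ≤ _ := setLIntegral_le_lintegral _ _

lemma kq_full (Φ : ℝ → ℝ≥0∞) (c : ℝ) :
    ∫⁻ x, ENNReal.ofReal |x| * Φ (2 * x ^ 2 + c) ≤ 2 * ∫⁻ s, Φ s := by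
  have h1 := kq_half Φ c
  have h2 : ∫⁻ x in Set.Iio (0:ℝ), ENNReal.ofReal |x| * Φ (2 * x ^ 2 + c) ≤ ∫⁻ s, Φ s := by
    refine le_trans (le_of_eq ?_) h1
    have := (Measure.measurePreserving_neg (volume : Measure ℝ)).setLIntegral_comp_preimage_emb
      (Homeomorph.neg ℝ).measurableEmbedding (fun x => ENNReal.ofReal |x| * Φ (2 * x ^ 2 + c)) (Set.Iio 0)
    rw [← this]
    simp
  have h3 : ∫⁻ x, ENNReal.ofReal |x| * Φ (2 * x ^ 2 + c) ≤
      ∫⁻ x in Set.Iio (0:ℝ) ∪ (Set.Ioi (0:ℝ) ∪ {0}), ENNReal.ofReal |x| * Φ (2 * x ^ 2 + c) := by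
    have : Set.Iio (0:ℝ) ∪ (Set.Ioi (0:ℝ) ∪ {0}) = Set.univ := by
      ext x; simp
    rw [this]; simp
  refine h3.trans ((lintegral_union_le _ _ _).trans ?_)
  rw [two_mul]
  refine add_le_add h2 ((lintegral_union_le _ _ _).trans ?_)
  simpa using h1

lemma lintegral_neg_comp (Φ : ℝ → ℝ≥0∞) : ∫⁻ s, Φ (-s) = ∫⁻ s, Φ s :=
  lintegral_neg_eq_self Φ

lemma kq_far (Φ : ℝ → ℝ≥0∞) (c A : ℝ) (hA : 0 < A) :
    ∫⁻ x, ind (A ≤ |x|) * Φ (2 * x ^ 2 + c) ≤ ENNReal.ofReal (2 / A) * ∫⁻ s, Φ s := by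
  calc _ ≤ ∫⁻ x, ENNReal.ofReal (1 / A) * (ENNReal.ofReal |x| * Φ (2 * x ^ 2 + c)) := by
        apply lintegral_mono
        intro x
        dsimp only
        rw [← mul_assoc, ← ENNReal.ofReal_mul (by positivity)]
        gcongr
        by_cases h : A ≤ |x|
        · rw [ind_pos h, ← ENNReal.ofReal_one]
          apply ENNReal.ofReal_le_ofReal
          rw [one_div, ← div_eq_inv_mul, le_div_iff₀ hA]; linarith
        · rw [ind_neg h]; exact zero_le
    _ = ENNReal.ofReal (1 / A) * ∫⁻ x, (ENNReal.ofReal |x| * Φ (2 * x ^ 2 + c)) :=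
        lintegral_const_mul' _ _ (by simp)
    _ ≤ ENNReal.ofReal (1 / A) * (2 * ∫⁻ s, Φ s) := by gcongr; exact kq_full Φ c
    _ = _ := by
        rw [← mul_assoc, show (2:ℝ≥0∞) = ENNReal.ofReal 2 by simp, ← ENNReal.ofReal_mul (by positivity)]
        congr 2; ring

lemma kq_far_neg (Φ : ℝ → ℝ≥0∞) (c A : ℝ) (hA : 0 < A) :
    ∫⁻ x, ind (A ≤ |x|) * Φ (c - 2 * x ^ 2) ≤ ENNReal.ofReal (2 / A) * ∫⁻ s, Φ s := by
  have := kq_far (fun s => Φ (-s)) (-c) A hA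
  rw [lintegral_neg_comp Φ] at this
  refine le_trans (le_of_eq ?_) this
  refine lintegral_congr fun x => ?_
  congr 2; ring

lemma cs_iter {α β : Type*} [MeasurableSpace α] [MeasurableSpace β] (μ : Measure α) (ν : Measure β)
    [SFinite μ] [SFinite ν]
    {f g : α → β → ℝ≥0∞} (hf : Measurable (Function.uncurry f)) (hg : Measurable (Function.uncurry g)) :
    ∫⁻ x, ∫⁻ y, f x y * g x y ∂ν ∂μ ≤
      (∫⁻ x, ∫⁻ y, f x y ^ 2 ∂ν ∂μ) ^ (1/2 : ℝ) * (∫⁻ x, ∫⁻ y, g x y ^ 2 ∂ν ∂μ) ^ (1/2 : ℝ) := by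
  have hf2 : Measurable (fun x => (∫⁻ y, f x y ^ 2 ∂ν)) :=
    Measurable.lintegral_prod_right' (f := fun p : α × β => f p.1 p.2 ^ 2) (hf.pow_const 2)
  have hg2 : Measurable (fun x => (∫⁻ y, g x y ^ 2 ∂ν)) :=
    Measurable.lintegral_prod_right' (f := fun p : α × β => g p.1 p.2 ^ 2) (hg.pow_const 2)
  calc _ ≤ ∫⁻ x, (∫⁻ y, f x y ^ 2 ∂ν) ^ (1/2 : ℝ) * (∫⁻ y, g x y ^ 2 ∂ν) ^ (1/2 : ℝ) ∂μ := by
        apply lintegral_mono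
        intro x
        exact cs_lintegral ν (hf.comp measurable_prodMk_left).aemeasurable
          (hg.comp measurable_prodMk_left).aemeasurable
    _ ≤ _ := by
        refine (cs_lintegral μ (hf2.pow_const _).aemeasurable (hg2.pow_const _).aemeasurable).trans ?_
        simp_rw [sq_half]
        exact le_rfl

lemma ker_half (M M' Ψ : ℝ → ℝ≥0∞) (hM : Measurable M) (hM' : Measurable M') (hΨ : Measurable Ψ) (h : ℝ) :
    ∫⁻ y, ∫⁻ x, ind (|y| ≤ |x|) * (M x * M' y * Ψ (2 * x ^ 2 - 2 * y ^ 2 + h)) ≤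
      2 * ((∫⁻ x, M x ^ 2) ^ (1/2 : ℝ) * (∫⁻ x, M' x ^ 2) ^ (1/2 : ℝ) * (∫⁻ s, Ψ s ^ 2) ^ (1/2 : ℝ)) := by
  have hind : Measurable (fun p : ℝ × ℝ => ind (|p.1| ≤ |p.2|)) :=
    measurable_ind (measurableSet_le (measurable_fst.abs) (measurable_snd.abs))
  have hr : Measurable (fun x : ℝ => ENNReal.ofReal |x|) := by fun_prop
  let I : ℝ → ℝ≥0∞ := fun y => ∫⁻ x, ind (|y| ≤ |x|) * (M x ^ 2 * (ENNReal.ofReal |x|)⁻¹)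
  have hIm : Measurable (Function.uncurry fun y x : ℝ => ind (|y| ≤ |x|) * (M x ^ 2 * (ENNReal.ofReal |x|)⁻¹)) := by
    apply hind.mul
    exact ((hM.comp measurable_snd).pow_const 2).mul ((hr.comp measurable_snd).inv)
  have hI : Measurable I := hIm.lintegral_prod_right
  have e1 : ∀ y, ∫⁻ x, ind (|y| ≤ |x|) * (M x * M' y * Ψ (2 * x ^ 2 - 2 * y ^ 2 + h)) ≤
      M' y * I y ^ (1/2:ℝ) * (2 * ∫⁻ s, Ψ s ^ 2) ^ (1/2 : ℝ) := by
    intro y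
    have hae : ∀ᵐ x : ℝ, ind (|y| ≤ |x|) * (M x * M' y * Ψ (2 * x ^ 2 - 2 * y ^ 2 + h)) =
        M' y * ((ind (|y| ≤ |x|) * (M x * (ENNReal.ofReal |x|)⁻¹ ^ (1/2:ℝ))) *
          ((ENNReal.ofReal |x|) ^ (1/2:ℝ) * Ψ (2 * x ^ 2 - 2 * y ^ 2 + h))) := by
      have : ∀ᵐ x : ℝ, x ≠ 0 := by simp [ae_iff]
      filter_upwards [this] with x hx
      have : (ENNReal.ofReal |x|)⁻¹ ^ (1/2:ℝ) * (ENNReal.ofReal |x|) ^ (1/2:ℝ) = 1 := by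
        rw [← half_mul, ENNReal.inv_mul_cancel (by simpa using hx) (by simp)]
        simp
      calc _ = M' y * (ind (|y| ≤ |x|) * (M x * ((ENNReal.ofReal |x|)⁻¹ ^ (1/2:ℝ) * (ENNReal.ofReal |x|) ^ (1/2:ℝ))) *
          Ψ (2 * x ^ 2 - 2 * y ^ 2 + h)) := by rw [this]; ring
        _ = _ := by ring
    rw [lintegral_congr_ae hae]
    have hm1 : Measurable (fun x => ind (|y| ≤ |x|) * (M x * (ENNReal.ofReal |x|)⁻¹ ^ (1/2:ℝ))) :=
      (hind.comp measurable_prodMk_left).mul (hM.mul (hr.inv.pow_const _))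
    have hm2 : Measurable (fun x => (ENNReal.ofReal |x|) ^ (1/2:ℝ) * Ψ (2 * x ^ 2 - 2 * y ^ 2 + h)) := by
      fun_prop
    have hm12 : Measurable (fun x => (ind (|y| ≤ |x|) * (M x * (ENNReal.ofReal |x|)⁻¹ ^ (1/2:ℝ))) *
          ((ENNReal.ofReal |x|) ^ (1/2:ℝ) * Ψ (2 * x ^ 2 - 2 * y ^ 2 + h))) := hm1.mul hm2
    rw [lintegral_const_mul _ hm12, mul_assoc]
    gcongr
    refine (cs_lintegral _ hm1.aemeasurable hm2.aemeasurable).trans ?_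
    gcongr
    · apply le_of_eq
      refine lintegral_congr fun x => ?_
      rw [mul_pow, mul_pow, ind_sq, sq_half]
    · refine le_trans (le_of_eq ?_) (kq_full (fun s => Ψ s ^ 2) (- 2 * y ^ 2 + h))
      refine lintegral_congr fun x => ?_
      rw [mul_pow, sq_half]
      congr 3; ring
  have e2 : ∫⁻ y, I y ≤ 2 * ∫⁻ x, M x ^ 2 := by
    simp only [I]
    rw [lintegral_lintegral_swap hIm.aemeasurable]
    rw [← lintegral_const_mul _ (hM.pow_const 2)]
    apply lintegral_mono
    intro x
    dsimp only
    have hi : Measurable fun y : ℝ => ind (|y| ≤ |x|) := hind.comp measurable_prodMk_right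
    rw [lintegral_mul_const _ hi]
    have : ∫⁻ y : ℝ, ind (|y| ≤ |x|) ≤ 2 * ENNReal.ofReal |x| := by
      have : ∀ y : ℝ, ind (|y| ≤ |x|) = Set.indicator (Set.Icc (-|x|) |x|) (fun _ => 1) y := by
        intro y
        by_cases hy : |y| ≤ |x|
        · rw [ind_pos hy, Set.indicator_of_mem (show y ∈ Set.Icc (-|x|) |x| from abs_le.mp hy)]
        · rw [ind_neg hy, Set.indicator_of_notMem (fun h : y ∈ Set.Icc (-|x|) |x| => hy (abs_le.mpr h))]
      simp_rw [this]
      rw [lintegral_indicator measurableSet_Icc]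
      simp only [lintegral_one, Measure.restrict_apply_univ, Real.volume_Icc]
      rw [show (2:ℝ≥0∞) = ENNReal.ofReal 2 by simp, ← ENNReal.ofReal_mul (by norm_num)]
      apply ENNReal.ofReal_le_ofReal; linarith
    calc _ ≤ 2 * ENNReal.ofReal |x| * (M x ^ 2 * (ENNReal.ofReal |x|)⁻¹) := by gcongr
      _ = 2 * M x ^ 2 * (ENNReal.ofReal |x| * (ENNReal.ofReal |x|)⁻¹) := by ring
      _ ≤ 2 * M x ^ 2 * 1 := by gcongr; exact ENNReal.mul_inv_le_one _
      _ = _ := by ring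
  calc _ ≤ ∫⁻ y, M' y * I y ^ (1/2:ℝ) * (2 * ∫⁻ s, Ψ s ^ 2) ^ (1/2 : ℝ) := lintegral_mono e1
    _ = (∫⁻ y, M' y * I y ^ (1/2:ℝ)) * (2 * ∫⁻ s, Ψ s ^ 2) ^ (1/2 : ℝ) :=
        lintegral_mul_const _ (hM'.mul (hI.pow_const _))
    _ ≤ ((∫⁻ y, M' y ^ 2) ^ (1/2:ℝ) * (2 * ∫⁻ x, M x ^ 2) ^ (1/2:ℝ)) * (2 * ∫⁻ s, Ψ s ^ 2) ^ (1/2 : ℝ) := by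
        gcongr
        refine (cs_lintegral _ hM'.aemeasurable (hI.pow_const _).aemeasurable).trans ?_
        simp_rw [sq_half]
        gcongr
    _ = ((2:ℝ≥0∞) ^ (1/2:ℝ) * (2:ℝ≥0∞) ^ (1/2:ℝ)) * ((∫⁻ x, M x ^ 2) ^ (1/2 : ℝ) * (∫⁻ x, M' x ^ 2) ^ (1/2 : ℝ) * (∫⁻ s, Ψ s ^ 2) ^ (1/2 : ℝ)) := by
        rw [half_mul, half_mul]; ring
    _ = _ := by rw [half_mul_self]

lemma ker_zero (M M' Ψ : ℝ → ℝ≥0∞) (hM : Measurable M) (hM' : Measurable M') (hΨ : Measurable Ψ) (h : ℝ) :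
    ∫⁻ x, ∫⁻ y, M x * M' y * Ψ (2 * x ^ 2 - 2 * y ^ 2 + h) ≤
      4 * ((∫⁻ x, M x ^ 2) ^ (1/2 : ℝ) * (∫⁻ x, M' x ^ 2) ^ (1/2 : ℝ) * (∫⁻ s, Ψ s ^ 2) ^ (1/2 : ℝ)) := by
  have h1 := ker_half M M' Ψ hM hM' hΨ h
  have h2 := ker_half M' M (fun s => Ψ (-s)) hM' hM (hΨ.comp measurable_neg) (-h)
  rw [lintegral_neg_comp (fun s => Ψ s ^ 2)] at h2
  have hind : Measurable (fun p : ℝ × ℝ => ind (|p.1| ≤ |p.2|)) :=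
    measurable_ind (measurableSet_le (measurable_fst.abs) (measurable_snd.abs))
  have hk : Measurable (fun p : ℝ × ℝ => M p.1 * M' p.2 * Ψ (2 * p.1 ^ 2 - 2 * p.2 ^ 2 + h)) := by
    fun_prop
  have hm1 : Measurable (fun p : ℝ × ℝ => ind (|p.2| ≤ |p.1|) * (M p.1 * M' p.2 * Ψ (2 * p.1 ^ 2 - 2 * p.2 ^ 2 + h))) :=
    (hind.comp measurable_swap).mul hk
  have hm2 : Measurable (fun p : ℝ × ℝ => ind (|p.1| ≤ |p.2|) * (M p.1 * M' p.2 * Ψ (2 * p.1 ^ 2 - 2 * p.2 ^ 2 + h))) :=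
    hind.mul hk
  calc _ ≤ ∫⁻ x, ∫⁻ y, (ind (|y| ≤ |x|) * (M x * M' y * Ψ (2 * x ^ 2 - 2 * y ^ 2 + h)) +
          ind (|x| ≤ |y|) * (M x * M' y * Ψ (2 * x ^ 2 - 2 * y ^ 2 + h))) := by
        refine lintegral_mono fun x => lintegral_mono fun y => ?_
        dsimp only
        rcases le_total |x| |y| with hxy | hxy
        · rw [ind_pos hxy, one_mul]; exact le_add_self
        · rw [ind_pos hxy, one_mul]; exact le_self_add
    _ = (∫⁻ x, ∫⁻ y, (ind (|y| ≤ |x|) * (M x * M' y * Ψ (2 * x ^ 2 - 2 * y ^ 2 + h)))) +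
          ∫⁻ x, ∫⁻ y, ind (|x| ≤ |y|) * (M x * M' y * Ψ (2 * x ^ 2 - 2 * y ^ 2 + h)) := by
        rw [← lintegral_add_left hm1.lintegral_prod_right']
        refine lintegral_congr fun x => ?_
        have hmx : Measurable fun y => ind (|y| ≤ |x|) * (M x * M' y * Ψ (2 * x ^ 2 - 2 * y ^ 2 + h)) :=
          hm1.comp measurable_prodMk_left
        exact lintegral_add_left hmx _
    _ ≤ _ := by
        rw [lintegral_lintegral_swap hm1.aemeasurable]
        refine (add_le_add h1 (le_trans (le_of_eq ?_) h2)).trans (le_of_eq ?_)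
        · refine lintegral_congr fun x => lintegral_congr fun y => ?_
          rw [mul_comm (M x)]
          congr 3; ring
        · ring

lemma ker_far (M M' Ψ : ℝ → ℝ≥0∞) (hM : Measurable M) (hM' : Measurable M') (hΨ : Measurable Ψ) (h a : ℝ)
    (ha : 0 < a) (hsM : ∀ x, M x ≠ 0 → a ≤ |x|) (hsM' : ∀ x, M' x ≠ 0 → a ≤ |x|) :
    ∫⁻ x, ∫⁻ y, M x * M' y * Ψ (2 * x ^ 2 - 2 * y ^ 2 + h) ≤
      ENNReal.ofReal (2 / a) * ((∫⁻ x, M x ^ 2) ^ (1/2 : ℝ) * (∫⁻ x, M' x ^ 2) ^ (1/2 : ℝ) * (∫⁻ s, Ψ s)) := by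
  have hind : Measurable (fun x : ℝ => ind (a ≤ |x|)) :=
    measurable_ind (measurableSet_le measurable_const measurable_abs)
  have hm1 : Measurable (Function.uncurry fun x y : ℝ => ind (a ≤ |y|) * (M x * Ψ (2 * x ^ 2 - 2 * y ^ 2 + h) ^ (1/2:ℝ))) :=
    (hind.comp measurable_snd).mul (by fun_prop)
  have hm2 : Measurable (Function.uncurry fun x y : ℝ => ind (a ≤ |x|) * (M' y * Ψ (2 * x ^ 2 - 2 * y ^ 2 + h) ^ (1/2:ℝ))) :=
    (hind.comp measurable_fst).mul (by fun_prop)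
  have e1 : ∫⁻ x, ∫⁻ y, (ind (a ≤ |y|) * (M x * Ψ (2 * x ^ 2 - 2 * y ^ 2 + h) ^ (1/2:ℝ))) ^ 2 ≤
      (ENNReal.ofReal (2 / a) * ∫⁻ s, Ψ s) * ∫⁻ x, M x ^ 2 := by
    rw [← lintegral_const_mul _ (hM.pow_const 2)]
    refine lintegral_mono fun x => ?_
    dsimp only
    have := kq_far_neg Ψ (2 * x ^ 2 + h) a ha
    calc _ = ∫⁻ y, M x ^ 2 * (ind (a ≤ |y|) * Ψ (2 * x ^ 2 + h - 2 * y ^ 2)) := by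
          refine lintegral_congr fun y => ?_
          rw [mul_pow, mul_pow, ind_sq, sq_half, show 2 * x ^ 2 - 2 * y ^ 2 + h = 2 * x ^ 2 + h - 2 * y ^ 2 by ring]
          ring
      _ = M x ^ 2 * ∫⁻ y, (ind (a ≤ |y|) * Ψ (2 * x ^ 2 + h - 2 * y ^ 2)) :=
          lintegral_const_mul _ (hind.mul (by fun_prop))
      _ ≤ M x ^ 2 * (ENNReal.ofReal (2 / a) * ∫⁻ s, Ψ s) := by gcongr
      _ = _ := by ring
  have e2 : ∫⁻ x, ∫⁻ y, (ind (a ≤ |x|) * (M' y * Ψ (2 * x ^ 2 - 2 * y ^ 2 + h) ^ (1/2:ℝ))) ^ 2 ≤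
      (ENNReal.ofReal (2 / a) * ∫⁻ s, Ψ s) * ∫⁻ x, M' x ^ 2 := by
    rw [lintegral_lintegral_swap (by exact (hm2.pow_const 2).aemeasurable)]
    rw [← lintegral_const_mul _ (hM'.pow_const 2)]
    refine lintegral_mono fun y => ?_
    dsimp only
    have := kq_far Ψ (- 2 * y ^ 2 + h) a ha
    calc _ = ∫⁻ x, M' y ^ 2 * (ind (a ≤ |x|) * Ψ (2 * x ^ 2 + (- 2 * y ^ 2 + h))) := by
          refine lintegral_congr fun x => ?_
          rw [mul_pow, mul_pow, ind_sq, sq_half, show 2 * x ^ 2 - 2 * y ^ 2 + h = 2 * x ^ 2 + (- 2 * y ^ 2 + h) by ring]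
          ring
      _ = M' y ^ 2 * ∫⁻ x, (ind (a ≤ |x|) * Ψ (2 * x ^ 2 + (- 2 * y ^ 2 + h))) :=
          lintegral_const_mul _ (hind.mul (by fun_prop))
      _ ≤ M' y ^ 2 * (ENNReal.ofReal (2 / a) * ∫⁻ s, Ψ s) := by gcongr
      _ = _ := by ring
  calc _ ≤ ∫⁻ x, ∫⁻ y, (ind (a ≤ |y|) * (M x * Ψ (2 * x ^ 2 - 2 * y ^ 2 + h) ^ (1/2:ℝ))) *
        (ind (a ≤ |x|) * (M' y * Ψ (2 * x ^ 2 - 2 * y ^ 2 + h) ^ (1/2:ℝ))) := by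
        refine lintegral_mono fun x => lintegral_mono fun y => ?_
        dsimp only
        by_cases h1 : M x = 0
        · simp [h1]
        by_cases h2 : M' y = 0
        · simp [h2]
        rw [ind_pos (hsM x h1), ind_pos (hsM' y h2), one_mul, one_mul]
        apply le_of_eq
        calc _ = M x * M' y * (Ψ (2 * x ^ 2 - 2 * y ^ 2 + h) ^ (1/2:ℝ) * Ψ (2 * x ^ 2 - 2 * y ^ 2 + h) ^ (1/2:ℝ)) := by
              rw [half_mul_self]
          _ = _ := by ring
    _ ≤ _ := cs_iter _ _ hm1 hm2
    _ ≤ ((ENNReal.ofReal (2 / a) * ∫⁻ s, Ψ s) * ∫⁻ x, M x ^ 2) ^ (1/2:ℝ) *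
        ((ENNReal.ofReal (2 / a) * ∫⁻ s, Ψ s) * ∫⁻ x, M' x ^ 2) ^ (1/2:ℝ) := by gcongr
    _ = ((ENNReal.ofReal (2 / a) * ∫⁻ s, Ψ s) ^ (1/2:ℝ) * (ENNReal.ofReal (2 / a) * ∫⁻ s, Ψ s) ^ (1/2:ℝ)) *
        ((∫⁻ x, M x ^ 2) ^ (1/2 : ℝ) * (∫⁻ x, M' x ^ 2) ^ (1/2 : ℝ)) := by
        rw [half_mul _ (∫⁻ x, M x ^ 2), half_mul _ (∫⁻ x, M' x ^ 2)]; ring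
    _ = _ := by rw [half_mul_self]; ring

lemma l1_le_l2 (Ψ : ℝ → ℝ≥0∞) (hΨ : Measurable Ψ) (hs : ∀ s, Ψ s ≠ 0 → |s| ≤ 7) :
    ∫⁻ s, Ψ s ≤ 4 * (∫⁻ s, Ψ s ^ 2) ^ (1/2:ℝ) := by
  have hind : Measurable (fun x : ℝ => ind (|x| ≤ 7)) :=
    measurable_ind (measurableSet_le measurable_abs measurable_const)
  calc _ ≤ ∫⁻ s, ind (|s| ≤ 7) * Ψ s := by
        refine lintegral_mono fun s => ?_
        dsimp only
        by_cases h : Ψ s = 0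
        · simp [h]
        · rw [ind_pos (hs s h), one_mul]
    _ ≤ _ := cs_lintegral _ hind.aemeasurable hΨ.aemeasurable
    _ ≤ _ := by
        gcongr
        simp_rw [ind_sq]
        have : ∀ y : ℝ, ind (|y| ≤ 7) = Set.indicator (Set.Icc (-7) 7) (fun _ => 1) y := by
          intro y
          by_cases hy : |y| ≤ 7
          · rw [ind_pos hy, Set.indicator_of_mem (show y ∈ Set.Icc (-7:ℝ) 7 from abs_le.mp hy)]
          · rw [ind_neg hy, Set.indicator_of_notMem (fun h : y ∈ Set.Icc (-7:ℝ) 7 => hy (abs_le.mpr h))]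
        simp_rw [this]
        rw [lintegral_indicator measurableSet_Icc]
        simp only [lintegral_one, Measure.restrict_apply_univ, Real.volume_Icc]
        calc ENNReal.ofReal (7 - -7) ^ (1/2:ℝ) ≤ ((4:ℝ≥0∞) ^ 2) ^ (1/2:ℝ) := by
              apply half_mono
              rw [show (4:ℝ≥0∞) = ENNReal.ofReal 4 by simp, ← ENNReal.ofReal_pow (by norm_num)]
              apply ENNReal.ofReal_le_ofReal; norm_num
          _ = 4 := half_sq 4

-- part G
open MeasureTheory
open scoped ENNReal NNReal

noncomputable def en {n : ℕ} (lam : ℝ) (σ j : Fin n → ℤ) : ℝ :=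
  (∑ i, (j i : ℝ) ^ 2 + ∑ i, ((σ i : ℝ) - j i) ^ 2) / lam ^ 2

noncomputable def amp {n : ℕ} (P : ℝ → Prop) (F1 F2 : (Fin n → ℤ) → ℝ → ℝ≥0∞) (σ j : Fin n → ℤ) (ξ η : ℝ) : ℝ≥0∞ :=
  ind (P η) * (F1 j (ξ / 2 + η) * F2 (σ - j) (ξ / 2 - η))

noncomputable def ZZ {n : ℕ} (lam : ℝ) (P : ℝ → Prop) (F1 F2 : (Fin n → ℤ) → ℝ → ℝ≥0∞) (Ψ : ℝ → ℝ≥0∞) : ℝ≥0∞ :=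
  ∑' σ : Fin n → ℤ, ∫⁻ ξ : ℝ, ∑' j : Fin n → ℤ, ∑' j' : Fin n → ℤ, ∫⁻ η : ℝ, ∫⁻ η' : ℝ,
    amp P F1 F2 σ j ξ η * amp P F1 F2 σ j' ξ η' * Ψ (2 * η ^ 2 - 2 * η' ^ 2 + (en lam σ j - en lam σ j'))

lemma en_diff {n : ℕ} {lam : ℝ} (hl : 1 ≤ lam) (σ j j' : Fin n → ℤ) :
    ∑ i, ((j - j') i : ℝ) * ((j i : ℝ) - ((σ - j) i : ℤ) - ((j - j') i : ℤ)) =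
      (en lam σ j - en lam σ j') * lam ^ 2 / 2 := by
  have h0 : lam ^ 2 ≠ 0 := by positivity
  unfold en
  rw [← sub_div, div_mul_cancel₀ _ h0, ← Finset.sum_add_distrib, ← Finset.sum_add_distrib,
    ← Finset.sum_sub_distrib, Finset.sum_div]
  refine Finset.sum_congr rfl fun i _ => ?_
  simp only [Pi.sub_apply, Int.cast_sub]
  ring

lemma shear (G1 G2 : ℝ → ℝ≥0∞) (h1 : Measurable G1) (h2 : Measurable G2) :
    ∫⁻ ξ : ℝ, ∫⁻ η : ℝ, G1 (ξ / 2 + η) * G2 (ξ / 2 - η) = (∫⁻ x, G1 x) * ∫⁻ x, G2 x := by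
  have e : ∀ ξ : ℝ, ∫⁻ η : ℝ, G1 (ξ / 2 + η) * G2 (ξ / 2 - η) = ∫⁻ ζ, G1 ζ * G2 (ξ - ζ) := by
    intro ξ
    rw [← lintegral_add_left_eq_self (fun ζ => G1 ζ * G2 (ξ - ζ)) (ξ / 2)]
    refine lintegral_congr fun η => ?_
    congr 2; ring
  simp_rw [e]
  rw [lintegral_lintegral_swap (by
    have : Measurable (fun p : ℝ × ℝ => G1 p.2 * G2 (p.1 - p.2)) := by fun_prop
    exact this.aemeasurable)]
  rw [← lintegral_mul_const _ h1]
  refine lintegral_congr fun ζ => ?_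
  rw [lintegral_const_mul _ (by fun_prop), lintegral_sub_right_eq_self]

section piece
variable {n : ℕ} {lam : ℝ} {P : ℝ → Prop} {F1 F2 : (Fin n → ℤ) → ℝ → ℝ≥0∞} {Ψ : ℝ → ℝ≥0∞}

lemma amp_meas (hP : MeasurableSet {x | P x}) (h1 : ∀ j, Measurable (F1 j)) (h2 : ∀ j, Measurable (F2 j))
    (σ j : Fin n → ℤ) : Measurable (fun p : ℝ × ℝ => amp P F1 F2 σ j p.1 p.2) := by
  unfold amp
  have := measurable_ind hP
  have a := h1 j
  have b := h2 (σ - j)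
  exact (this.comp measurable_snd).mul (by fun_prop)

lemma amp_meas' (hP : MeasurableSet {x | P x}) (h1 : ∀ j, Measurable (F1 j)) (h2 : ∀ j, Measurable (F2 j))
    (σ j : Fin n → ℤ) (ξ : ℝ) : Measurable (fun η => amp P F1 F2 σ j ξ η) :=
  (amp_meas hP h1 h2 σ j).comp measurable_prodMk_left

lemma amp_int (h1 : ∀ j, Measurable (F1 j)) (h2 : ∀ j, Measurable (F2 j)) (σ j : Fin n → ℤ) :
    ∫⁻ ξ, ∫⁻ η, amp P F1 F2 σ j ξ η ^ 2 ≤ (∫⁻ x, F1 j x ^ 2) * ∫⁻ x, F2 (σ - j) x ^ 2 := by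
  rw [← shear (fun x => F1 j x ^ 2) (fun x => F2 (σ - j) x ^ 2) ((h1 j).pow_const 2) ((h2 _).pow_const 2)]
  refine lintegral_mono fun ξ => lintegral_mono fun η => ?_
  dsimp only
  unfold amp
  rw [mul_pow, ind_sq, mul_pow]
  exact mul_le_of_le_one_left' (ind_le_one _)

lemma piece_gen (hl : 1 ≤ lam) (hP : MeasurableSet {x | P x}) (h1 : ∀ j, Measurable (F1 j)) (h2 : ∀ j, Measurable (F2 j))
    (hΨ : Measurable Ψ) (hs : ∀ s, Ψ s ≠ 0 → |s| ≤ 7) (a : ℝ) (ha : 1 ≤ a)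
    (hP2 : ∀ x, P x → |x| ≤ 2 * a) (hP1 : a = 1 ∨ ∀ x, P x → a ≤ |x|) :
    ZZ lam P F1 F2 Ψ ≤ ENNReal.ofReal (8 / a) * (∫⁻ s, Ψ s ^ 2) ^ (1/2:ℝ) *
      discS (8 * (lam * a) ^ 2) (fun j => (∫⁻ x, F1 j x ^ 2) ^ (1/2:ℝ)) (fun j => (∫⁻ x, F2 j x ^ 2) ^ (1/2:ℝ)) := by
  set f1 : (Fin n → ℤ) → ℝ≥0∞ := fun j => (∫⁻ x, F1 j x ^ 2) ^ (1/2:ℝ) with hf1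
  set f2 : (Fin n → ℤ) → ℝ≥0∞ := fun j => (∫⁻ x, F2 j x ^ 2) ^ (1/2:ℝ) with hf2
  set N := (∫⁻ s, Ψ s ^ 2) ^ (1/2:ℝ) with hN
  set α : (Fin n → ℤ) → (Fin n → ℤ) → ℝ → ℝ≥0∞ := fun σ j ξ => ∫⁻ η, amp P F1 F2 σ j ξ η ^ 2 with hα
  have hαm : ∀ σ j, Measurable (α σ j) := fun σ j =>
    Measurable.lintegral_prod_right' (f := fun p : ℝ × ℝ => amp P F1 F2 σ j p.1 p.2 ^ 2)
      ((amp_meas hP h1 h2 σ j).pow_const 2)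
  have ker : ∀ σ j j' ξ, ∫⁻ η : ℝ, ∫⁻ η' : ℝ,
      amp P F1 F2 σ j ξ η * amp P F1 F2 σ j' ξ η' * Ψ (2 * η ^ 2 - 2 * η' ^ 2 + (en lam σ j - en lam σ j')) ≤
      (ENNReal.ofReal (8 / a) * N * ind (quadC (8 * (lam * a) ^ 2) j (j - j') (σ - j))) *
        (α σ j ξ ^ (1/2:ℝ) * α σ j' ξ ^ (1/2:ℝ)) := by
    intro σ j j' ξ
    by_cases hq : quadC (8 * (lam * a) ^ 2) j (j - j') (σ - j)
    · rw [ind_pos hq, mul_one]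
      rcases hP1 with h | h
      · refine (ker_zero _ _ Ψ (amp_meas' hP h1 h2 σ j ξ) (amp_meas' hP h1 h2 σ j' ξ) hΨ _).trans ?_
        subst h
        calc _ = 4 * N * (α σ j ξ ^ (1/2:ℝ) * α σ j' ξ ^ (1/2:ℝ)) := by ring
          _ ≤ _ := by
            gcongr
            rw [show (4:ℝ≥0∞) = ENNReal.ofReal 4 by simp]
            apply ENNReal.ofReal_le_ofReal; norm_num
      · have hsup : ∀ j x, amp P F1 F2 σ j ξ x ≠ 0 → a ≤ |x| := by
          intro j x hx
          apply h
          by_contra hc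
          apply hx
          simp [amp, ind_neg hc]
        refine (ker_far _ _ Ψ (amp_meas' hP h1 h2 σ j ξ) (amp_meas' hP h1 h2 σ j' ξ) hΨ _ a (by linarith)
          (hsup j) (hsup j')).trans ?_
        calc _ ≤ ENNReal.ofReal (2 / a) * (α σ j ξ ^ (1/2:ℝ) * α σ j' ξ ^ (1/2:ℝ) * (4 * N)) := by
              gcongr
              exact l1_le_l2 Ψ hΨ hs
          _ = (ENNReal.ofReal (2 / a) * 4) * N * (α σ j ξ ^ (1/2:ℝ) * α σ j' ξ ^ (1/2:ℝ)) := by ring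
          _ = _ := by
            congr 2
            rw [show (4:ℝ≥0∞) = ENNReal.ofReal 4 by simp, ← ENNReal.ofReal_mul (by positivity)]
            congr 1; ring
    · rw [ind_neg hq]
      simp only [mul_zero, zero_mul, nonpos_iff_eq_zero]
      rw [lintegral_eq_zero_of_ae_eq_zero]
      refine Filter.Eventually.of_forall fun η => ?_
      dsimp only
      rw [lintegral_eq_zero_of_ae_eq_zero]; · rfl
      refine Filter.Eventually.of_forall fun η' => ?_
      dsimp only [Pi.zero_apply]
      by_contra hne
      apply hq
      have hne' := hne
      simp only [mul_eq_zero, not_or] at hne'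
      obtain ⟨⟨ha1, ha2⟩, hpsi⟩ := hne'
      have p1 : P η := by
        by_contra hc; apply ha1; simp [amp, ind_neg hc]
      have p2 : P η' := by
        by_contra hc; apply ha2; simp [amp, ind_neg hc]
      have b1 := hP2 _ p1
      have b2 := hP2 _ p2
      have b3 := hs _ hpsi
      unfold quadC
      rw [en_diff hl]
      have c1 : η ^ 2 ≤ 4 * a ^ 2 := by
        rw [← sq_abs]; nlinarith [abs_nonneg η]
      have c2 : η' ^ 2 ≤ 4 * a ^ 2 := by
        rw [← sq_abs]; nlinarith [abs_nonneg η']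
      have c3 : |en lam σ j - en lam σ j'| ≤ 15 * a ^ 2 := by
        rw [abs_le] at b3 ⊢
        constructor <;> nlinarith [sq_nonneg η, sq_nonneg η']
      rw [abs_div, abs_mul, abs_of_nonneg (sq_nonneg lam)]
      rw [abs_of_pos (by norm_num : (0:ℝ) < 2), mul_pow, div_le_iff₀ (by norm_num)]
      nlinarith [sq_nonneg lam, mul_le_mul_of_nonneg_right c3 (sq_nonneg lam), mul_nonneg (sq_nonneg lam) (sq_nonneg a)]
  have step1 : ∀ σ, ∫⁻ ξ : ℝ, ∑' j : Fin n → ℤ, ∑' j' : Fin n → ℤ, ∫⁻ η : ℝ, ∫⁻ η' : ℝ,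
      amp P F1 F2 σ j ξ η * amp P F1 F2 σ j' ξ η' * Ψ (2 * η ^ 2 - 2 * η' ^ 2 + (en lam σ j - en lam σ j')) ≤
      ∑' j, ∑' j', (ENNReal.ofReal (8 / a) * N * ind (quadC (8 * (lam * a) ^ 2) j (j - j') (σ - j))) *
        (f1 j * f2 (σ - j) * f1 j' * f2 (σ - j')) := by
    intro σ
    have hm : ∀ j j', Measurable fun ξ => α σ j ξ ^ (1/2:ℝ) * α σ j' ξ ^ (1/2:ℝ) := fun j j' =>
      ((hαm σ j).pow_const _).mul ((hαm σ j').pow_const _)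
    calc _ ≤ ∫⁻ ξ : ℝ, ∑' j : Fin n → ℤ, ∑' j' : Fin n → ℤ,
          (ENNReal.ofReal (8 / a) * N * ind (quadC (8 * (lam * a) ^ 2) j (j - j') (σ - j))) *
          (α σ j ξ ^ (1/2:ℝ) * α σ j' ξ ^ (1/2:ℝ)) := by
          refine lintegral_mono fun ξ => ENNReal.tsum_le_tsum fun j => ENNReal.tsum_le_tsum fun j' => ker σ j j' ξ
      _ = ∑' j : Fin n → ℤ, ∑' j' : Fin n → ℤ,
          (ENNReal.ofReal (8 / a) * N * ind (quadC (8 * (lam * a) ^ 2) j (j - j') (σ - j))) *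
          ∫⁻ ξ : ℝ, (α σ j ξ ^ (1/2:ℝ) * α σ j' ξ ^ (1/2:ℝ)) := by
          rw [lintegral_tsum (fun j => (Measurable.ennreal_tsum fun j' => (hm j j').const_mul _).aemeasurable)]
          refine tsum_congr fun j => ?_
          rw [lintegral_tsum (fun j' => ((hm j j').const_mul _).aemeasurable)]
          refine tsum_congr fun j' => ?_
          rw [lintegral_const_mul _ (hm j j')]
      _ ≤ _ := by
          refine ENNReal.tsum_le_tsum fun j => ENNReal.tsum_le_tsum fun j' => ?_
          refine mul_le_mul_right ?_ _
          refine (cs_lintegral _ ((hαm σ j).pow_const _).aemeasurable ((hαm σ j').pow_const _).aemeasurable).trans ?_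
          simp_rw [sq_half]
          calc _ ≤ ((∫⁻ x, F1 j x ^ 2) * ∫⁻ x, F2 (σ - j) x ^ 2) ^ (1/2:ℝ) *
                ((∫⁻ x, F1 j' x ^ 2) * ∫⁻ x, F2 (σ - j') x ^ 2) ^ (1/2:ℝ) :=
                mul_le_mul' (half_mono (amp_int h1 h2 σ j)) (half_mono (amp_int h1 h2 σ j'))
            _ = _ := by rw [half_mul, half_mul]; simp only [hf1, hf2]; ring
  calc ZZ lam P F1 F2 Ψ ≤ ∑' σ, ∑' j, ∑' j', (ENNReal.ofReal (8 / a) * N * ind (quadC (8 * (lam * a) ^ 2) j (j - j') (σ - j))) *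
        (f1 j * f2 (σ - j) * f1 j' * f2 (σ - j')) := ENNReal.tsum_le_tsum step1
    _ = ∑' j, ∑' j', ∑' j2, (ENNReal.ofReal (8 / a) * N * ind (quadC (8 * (lam * a) ^ 2) j (j - j') j2)) *
        (f1 j * f2 j2 * f1 j' * f2 (j2 + (j - j'))) := by
        rw [ENNReal.tsum_comm]
        refine tsum_congr fun j => ?_
        rw [ENNReal.tsum_comm]
        refine tsum_congr fun j' => ?_
        symm
        rw [← tsum_shift_sub' _ j]
        refine tsum_congr fun σ => ?_
        rw [show σ - j + (j - j') = σ - j' by abel]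
    _ = ∑' j, ∑' d, ∑' j2, (ENNReal.ofReal (8 / a) * N * ind (quadC (8 * (lam * a) ^ 2) j d j2)) *
        (f1 j * f2 j2 * f1 (j - d) * f2 (j2 + d)) := by
        refine tsum_congr fun j => ?_
        rw [← tsum_shift_sub _ j]
        refine tsum_congr fun d => tsum_congr fun j2 => ?_
        rw [show j - (j - d) = d by abel]
    _ = _ := by
        unfold discS
        simp_rw [← ENNReal.tsum_mul_left]
        refine tsum_congr fun j => tsum_congr fun d => tsum_congr fun j2 => ?_
        ring


lemma supp_coord {n : ℕ} {lam N ζ : ℝ} (hl : 1 ≤ lam) (hN : 1 ≤ N) {j : Fin n → ℤ}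
    (h : ζ ^ 2 + ∑ i, ((j i : ℝ) / lam) ^ 2 ≤ (2 * N) ^ 2) :
    |ζ| ≤ 2 * N ∧ ∀ i, |(j i : ℝ)| ≤ 2 * (lam * N) := by
  have h0 : 0 ≤ ∑ i, ((j i : ℝ) / lam) ^ 2 := Finset.sum_nonneg fun i _ => sq_nonneg _
  constructor
  · exact abs_le_of_sq_le_sq (by linarith) (by linarith)
  · intro i
    have h1 : ((j i : ℝ) / lam) ^ 2 ≤ ∑ i, ((j i : ℝ) / lam) ^ 2 :=
      Finset.single_le_sum (f := fun i => ((j i : ℝ) / lam) ^ 2) (fun i _ => sq_nonneg _) (Finset.mem_univ i)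
    have h2 : |(j i : ℝ) / lam| ≤ 2 * N := abs_le_of_sq_le_sq (by nlinarith [sq_nonneg ζ]) (by linarith)
    rw [abs_div, abs_of_pos (by linarith : 0 < lam), div_le_iff₀ (by linarith)] at h2
    linarith

lemma supp_large {n : ℕ} (hn : 1 ≤ n) {lam N ζ : ℝ} (hl : 1 ≤ lam) (hN : 1 ≤ N) {j : Fin n → ℤ}
    (hz : |ζ| ≤ N / 4) (h : (N / 2) ^ 2 ≤ ζ ^ 2 + ∑ i, ((j i : ℝ) / lam) ^ 2) :
    ∃ p, 1 / (4 * n) * (lam * N) ≤ |(j p : ℝ)| := by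
  by_contra! hc
  have hn' : (1:ℝ) ≤ n := by exact_mod_cast hn
  have h1 : ∀ i, ((j i : ℝ) / lam) ^ 2 ≤ N ^ 2 / 16 / n := by
    intro i
    have : |(j i : ℝ) / lam| ≤ N / (4 * n) := by
      rw [abs_div, abs_of_pos (by linarith : 0 < lam), div_le_iff₀ (by linarith)]
      refine (hc i).le.trans (le_of_eq (by ring))
    rw [← sq_abs]
    calc |(j i : ℝ) / lam| ^ 2 ≤ (N / (4 * n)) ^ 2 := by gcongr
      _ = N ^ 2 / 16 / n / n := by field_simp; norm_num
      _ ≤ _ := div_le_self (by positivity) hn'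
  have h2 : ∑ i, ((j i : ℝ) / lam) ^ 2 ≤ N ^ 2 / 16 := by
    calc _ ≤ ∑ i : Fin n, N ^ 2 / 16 / n := Finset.sum_le_sum fun i _ => h1 i
      _ = _ := by simp; field_simp
  have h3 : ζ ^ 2 ≤ N ^ 2 / 16 := by
    rw [← sq_abs]
    nlinarith [abs_nonneg ζ]
  nlinarith

lemma f_ne {n : ℕ} {F : (Fin n → ℤ) → ℝ → ℝ≥0∞} {j : Fin n → ℤ} (h : (∫⁻ x, F j x ^ 2) ^ (1/2:ℝ) ≠ 0) :
    ∃ x, F j x ≠ 0 := by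
  by_contra! hc
  apply h
  simp [hc]

lemma piece_bd (n : ℕ) (hn : 1 ≤ n) : ∃ C : ℝ, 0 < C ∧ ∀ (lam N1 N2 a : ℝ), 1 ≤ lam → 1 ≤ N2 → N2 ≤ N1 →
    1 ≤ a → a ≤ 16 * N2 → ∀ (P : ℝ → Prop) (F1 F2 : (Fin n → ℤ) → ℝ → ℝ≥0∞) (Ψ : ℝ → ℝ≥0∞),
    MeasurableSet {x | P x} → (∀ j, Measurable (F1 j)) → (∀ j, Measurable (F2 j)) → Measurable Ψ →
    (∀ s, Ψ s ≠ 0 → |s| ≤ 7) → (∀ x, P x → |x| ≤ 2 * a) → (a = 1 ∨ ∀ x, P x → a ≤ |x|) →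
    (∀ j ζ, F1 j ζ ≠ 0 → ζ ^ 2 + ∑ i, ((j i : ℝ) / lam) ^ 2 ≤ (2 * N1) ^ 2 ∧
      (1 < N1 → (N1 / 2) ^ 2 ≤ ζ ^ 2 + ∑ i, ((j i : ℝ) / lam) ^ 2)) →
    (∀ j ζ, F2 j ζ ≠ 0 → ζ ^ 2 + ∑ i, ((j i : ℝ) / lam) ^ 2 ≤ (2 * N2) ^ 2) →
    ZZ lam P F1 F2 Ψ ≤ ENNReal.ofReal (C * Kd n lam N1 N2) * (∫⁻ s, Ψ s ^ 2) ^ (1/2:ℝ) *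
      ((∑' j, ∫⁻ x, F1 j x ^ 2) * ∑' j, ∫⁻ x, F2 j x ^ 2) := by
  have hn' : (1:ℝ) ≤ n := by exact_mod_cast hn
  have hκ : (0:ℝ) < 1 / (4 * n) := by positivity
  have hκ1 : 1 / (4 * (n:ℝ)) ≤ 1 := by rw [div_le_one (by positivity)]; linarith
  obtain ⟨C, hC, H⟩ := disc_main n hn (1 / (4 * n)) hκ hκ1
  refine ⟨8 * C, by positivity, ?_⟩
  intro lam N1 N2 a hl hN2 hN12 ha ha2 P F1 F2 Ψ hP h1 h2 hΨ hs hP2 hP1 hF1 hF2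
  have hK := Kd_pos n hl hN2 hN12
  set F1' : (Fin n → ℤ) → ℝ → ℝ≥0∞ := fun j ζ => ind (|ζ| ≤ 66 * N2) * F1 j ζ with hF1'
  have hle : ∀ j ζ, F1' j ζ ≤ F1 j ζ := fun j ζ => mul_le_of_le_one_left' (ind_le_one _)
  have hm1 : ∀ j, Measurable (F1' j) := fun j =>
    (measurable_ind (measurableSet_le measurable_abs measurable_const)).mul (h1 j)
  have hamp : amp P F1 F2 = amp P F1' F2 := by
    funext σ j ξ η
    unfold amp
    by_cases hp : P η
    · by_cases hf : F2 (σ - j) (ξ / 2 - η) = 0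
      · simp [hf]
      · have b := (supp_coord hl hN2 (hF2 _ _ hf)).1
        have b2 := hP2 _ hp
        have : |ξ / 2 + η| ≤ 66 * N2 := by
          rw [abs_le] at b b2 ⊢
          constructor <;> linarith
        simp only [hF1', ind_pos this, one_mul]
    · simp [ind_neg hp]
  have hZ : ZZ lam P F1 F2 Ψ = ZZ lam P F1' F2 Ψ := by unfold ZZ; rw [hamp]
  rw [hZ]
  refine (piece_gen hl hP hm1 h2 hΨ hs a ha hP2 hP1).trans ?_
  have hd := H lam N1 N2 a hl hN2 hN12 ha ha2 (fun j => (∫⁻ x, F1' j x ^ 2) ^ (1/2:ℝ))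
    (fun j => (∫⁻ x, F2 j x ^ 2) ^ (1/2:ℝ)) (by
      intro hbig j hj
      obtain ⟨x, hx⟩ := f_ne hj
      simp only [hF1', ne_eq, mul_eq_zero, not_or] at hx
      have hx1 : |x| ≤ 66 * N2 := by
        by_contra hc; exact hx.1 (ind_neg hc)
      have hb : 2000 * N2 < N1 := by
        refine lt_of_le_of_lt ?_ hbig
        have : (2000:ℝ) ≤ (2000 + 20 * n) / (1 / (4 * n)) := by
          rw [le_div_iff₀ hκ]
          nlinarith
        nlinarith
      exact supp_large hn hl (by linarith) (by linarith) ((hF1 _ _ hx.2).2 (by linarith))) (by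
      intro j hj
      obtain ⟨x, hx⟩ := f_ne hj
      exact (supp_coord hl hN2 (hF2 _ _ hx)).2)
  simp_rw [sq_half] at hd
  have hmono : ∑' j, ∫⁻ x, F1' j x ^ 2 ≤ ∑' j, ∫⁻ x, F1 j x ^ 2 :=
    ENNReal.tsum_le_tsum fun j => lintegral_mono fun x => by
      dsimp only
      gcongr; exact hle j x
  calc _ ≤ ENNReal.ofReal (8 / a) * (∫⁻ s, Ψ s ^ 2) ^ (1/2:ℝ) *
        (ENNReal.ofReal (C * (a * Kd n lam N1 N2)) * (∑' j, ∫⁻ x, F1 j x ^ 2) * ∑' j, ∫⁻ x, F2 j x ^ 2) := by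
        gcongr
        exact hd.trans (by gcongr)
    _ = (ENNReal.ofReal (8 / a) * ENNReal.ofReal (C * (a * Kd n lam N1 N2))) * (∫⁻ s, Ψ s ^ 2) ^ (1/2:ℝ) *
      ((∑' j, ∫⁻ x, F1 j x ^ 2) * ∑' j, ∫⁻ x, F2 j x ^ 2) := by ring
    _ = _ := by
      rw [← ENNReal.ofReal_mul (by positivity)]
      congr 3
      have : a ≠ 0 := by linarith
      field_simp

end piece

-- part I
open MeasureTheory
open scoped ENNReal NNReal

lemma Kd_ge2 (n : ℕ) (hn : 1 ≤ n) {lam N1 N2 : ℝ} (hl : 1 ≤ lam) (h2 : 1 ≤ N2) (h12 : N2 ≤ N1) :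
    (lam * N2) ^ (n - 1) ≤ Kd n lam N1 N2 * N2 := by
  have h1 : 0 < N1 := by linarith
  unfold Kd
  split_ifs with h
  · subst h
    have : 0 ≤ lam * N2 / N1 := by positivity
    simp; nlinarith
  · obtain ⟨k, rfl⟩ : ∃ k, n = k + 2 := ⟨n - 2, by omega⟩
    simp only [Nat.add_sub_cancel, show k + 2 - 1 = k + 1 by omega]
    have : 0 ≤ lam ^ (k + 2) * N2 ^ (k + 2) / N1 * N2 := by positivity
    rw [add_mul, mul_pow, mul_assoc, ← pow_succ]
    linarith

lemma inf_card (n : ℕ) (hn : 1 ≤ n) (κ : ℝ) (hκ : 0 < κ) (hκ1 : κ ≤ 1) : ∃ C : ℝ, 0 < C ∧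
    ∀ (lam N1 N2 ξ η : ℝ) (σ j : Fin n → ℤ), 1 ≤ lam → 1 ≤ N2 → N2 ≤ N1 → 16 * N2 < |η| →
    |ξ / 2 - η| ≤ 2 * N2 → (∀ i, |((σ - j) i : ℝ)| ≤ 2 * (lam * N2)) →
    (|ξ / 2 + η| ≤ N1 / 4 → ∃ p, κ * (lam * N1) ≤ |(j p : ℝ)|) →
    ∑' j', ind ((∀ i, |((σ - j') i : ℝ)| ≤ 2 * (lam * N2)) ∧ quadC (5 * N2 * lam ^ 2 * |ξ|) j (j - j') (σ - j)) ≤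
      ENNReal.ofReal (C * (Kd n lam N1 N2 * |ξ|)) := by
  refine ⟨9 ^ n * (40 / κ + 1) + 9 ^ n * (5 / κ), by positivity, ?_⟩
  intro lam N1 N2 ξ η σ j hl h2 h12 hη hx hj hp
  have hK := Kd_pos n hl h2 h12
  have hKg := Kd_ge n hn hl h2 h12
  have hKg2 := Kd_ge2 n hn hl h2 h12
  have hN1 : 0 < N1 := by linarith
  have hlN : 1 ≤ lam * N2 := by nlinarith
  have hξ : 28 * N2 ≤ |ξ| := by
    have h1 : |η| ≤ |ξ / 2| + |ξ / 2 - η| := by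
      have := abs_sub (ξ / 2) (ξ / 2 - η)
      simpa using this
    rw [abs_div, abs_of_pos (by norm_num : (0:ℝ) < 2)] at h1
    linarith
  have hξ0 : 0 < |ξ| := by linarith
  apply tsum_ind_le
  intro T hT
  by_cases hc : κ / 5 * N1 ≤ |ξ|
  · have h := card_box T (8 * (lam * N2)) (by positivity) (by
      intro x hx y hy i
      have a1 := (hT x hx).1 i
      have a2 := (hT y hy).1 i
      simp only [Pi.sub_apply, Int.cast_sub] at a1 a2
      rw [abs_le] at a1 a2 ⊢
      constructor <;> linarith)
    have hN1' : N1 ≤ 5 / κ * |ξ| := by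
      rw [div_mul_eq_mul_div, le_div_iff₀ hκ]; nlinarith
    calc (T.card : ℝ) ≤ (8 * (lam * N2) + 1) ^ n := h
      _ ≤ (9 * (lam * N2)) ^ n := by gcongr; linarith
      _ = 9 ^ n * ((lam ^ n * N2 ^ n / N1) * N1) := by
          rw [div_mul_cancel₀ _ hN1.ne', mul_pow, mul_pow]
      _ ≤ 9 ^ n * (Kd n lam N1 N2 * (5 / κ * |ξ|)) := by gcongr
      _ = 9 ^ n * (5 / κ) * (Kd n lam N1 N2 * |ξ|) := by ring
      _ ≤ _ := by
          gcongr
          have : 0 ≤ (9:ℝ) ^ n * (40 / κ + 1) := by positivity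
          linarith
  · push Not at hc
    have hz : |ξ / 2 + η| ≤ N1 / 4 := by
      have h1 : |ξ / 2 + η| ≤ |ξ| + |ξ / 2 - η| := by
        have := abs_sub ξ (ξ / 2 - η)
        rwa [show ξ - (ξ / 2 - η) = ξ / 2 + η by ring] at this
      have : κ / 5 * N1 ≤ N1 / 5 := by nlinarith
      linarith
    obtain ⟨p, hpp⟩ := hp hz
    have hsmall : N2 ≤ κ * N1 / 140 := by linarith
    have hV : κ * (lam * N1) / 2 ≤ |(fun i => (j i : ℝ) - ((σ - j) i : ℤ)) p| := by
      have h1 : |(j p : ℝ)| ≤ |(j p : ℝ) - ((σ - j) p : ℤ)| + |((σ - j) p : ℝ)| := by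
        have := abs_add_le ((j p : ℝ) - ((σ - j) p : ℤ)) ((σ - j) p : ℤ)
        simpa using this
      have h3 := hj p
      have h4 : lam * N2 ≤ lam * (κ * N1 / 140) := by gcongr
      have h5 : 0 < κ * (lam * N1) := by positivity
      have h6 : lam * (κ * N1 / 140) = κ * (lam * N1) / 140 := by ring
      simp only
      linarith
    have hV0 : 0 < κ * (lam * N1) / 2 := by positivity
    have h := card_line (T.image (fun j' => j - j')) p (fun i => (j i : ℝ) - ((σ - j) i : ℤ)) (4 * (lam * N2))
      (5 * N2 * lam ^ 2 * |ξ|) (by positivity) (by positivity) (by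
        intro x hx i
        obtain ⟨y, hy, rfl⟩ := Finset.mem_image.mp hx
        have a1 := (hT y hy).1 i
        have a2 := hj i
        simp only [Pi.sub_apply, Int.cast_sub] at a1 a2 ⊢
        rw [abs_le] at a1 a2 ⊢
        constructor <;> linarith) (by
        refine le_trans ?_ hV
        have h4 : lam * N2 ≤ lam * (κ * N1 / 140) := by gcongr
        have h6 : lam * (κ * N1 / 140) = κ * (lam * N1) / 140 := by ring
        linarith) (by
        intro x hx
        obtain ⟨y, hy, rfl⟩ := Finset.mem_image.mp hx
        exact (hT y hy).2)
    rw [Finset.card_image_of_injective _ (sub_right_injective)] at h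
    calc (T.card : ℝ) ≤ _ := h
      _ ≤ (9 * (lam * N2)) ^ (n - 1) * (4 * (5 * N2 * lam ^ 2 * |ξ|) / (κ * (lam * N1) / 2) + 1) := by
          gcongr
          linarith
      _ = 9 ^ (n - 1) * (40 / κ * ((lam * N2) ^ (n - 1) * (lam * N2) / N1 * |ξ|) + (lam * N2) ^ (n - 1)) := by
          rw [mul_pow]
          field_simp
          ring
      _ = 9 ^ (n - 1) * (40 / κ * ((lam ^ n * N2 ^ n) / N1 * |ξ|) + (lam * N2) ^ (n - 1)) := by
          rw [← pow_succ, Nat.sub_add_cancel hn, mul_pow lam N2 n]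
      _ ≤ 9 ^ n * (40 / κ * (Kd n lam N1 N2 * |ξ|) + Kd n lam N1 N2 * |ξ|) := by
          gcongr
          · norm_num
          · omega
          · refine hKg2.trans ?_
            gcongr; linarith
      _ = 9 ^ n * (40 / κ + 1) * (Kd n lam N1 N2 * |ξ|) := by ring
      _ ≤ _ := by
          gcongr
          have : 0 ≤ (9:ℝ) ^ n * (5 / κ) := by positivity
          linarith

lemma inf_ker (n : ℕ) (hn : 1 ≤ n) : ∃ C : ℝ, 0 < C ∧ ∀ (lam N1 N2 : ℝ), 1 ≤ lam → 1 ≤ N2 → N2 ≤ N1 →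
    ∀ (F1 F2 : (Fin n → ℤ) → ℝ → ℝ≥0∞) (Ψ : ℝ → ℝ≥0∞),
    (∀ s, Ψ s ≠ 0 → |s| ≤ 7) →
    (∀ j ζ, F1 j ζ ≠ 0 → ζ ^ 2 + ∑ i, ((j i : ℝ) / lam) ^ 2 ≤ (2 * N1) ^ 2 ∧
      (1 < N1 → (N1 / 2) ^ 2 ≤ ζ ^ 2 + ∑ i, ((j i : ℝ) / lam) ^ 2)) →
    (∀ j ζ, F2 j ζ ≠ 0 → ζ ^ 2 + ∑ i, ((j i : ℝ) / lam) ^ 2 ≤ (2 * N2) ^ 2) →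
    ∀ (σ j : Fin n → ℤ) (ξ η : ℝ), amp (fun η => 16 * N2 < |η|) F1 F2 σ j ξ η ≠ 0 →
    ∑' j', ∫⁻ η', ind (amp (fun η => 16 * N2 < |η|) F1 F2 σ j' ξ η' ≠ 0) *
      Ψ (2 * η ^ 2 - 2 * η' ^ 2 + (en lam σ j - en lam σ j')) ≤
      ENNReal.ofReal (C * Kd n lam N1 N2) * ∫⁻ s, Ψ s := by
  have hn' : (1:ℝ) ≤ n := by exact_mod_cast hn
  have hκ : (0:ℝ) < 1 / (4 * n) := by positivity
  have hκ1 : 1 / (4 * (n:ℝ)) ≤ 1 := by rw [div_le_one (by positivity)]; linarith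
  obtain ⟨C, hC, H⟩ := inf_card n hn (1 / (4 * n)) hκ hκ1
  refine ⟨C * 5, by positivity, ?_⟩
  intro lam N1 N2 hl h2 h12 F1 F2 Ψ hs hF1 hF2 σ j ξ η hne
  have hK := Kd_pos n hl h2 h12
  have unp : ∀ j η, amp (fun η => 16 * N2 < |η|) F1 F2 σ j ξ η ≠ 0 →
      16 * N2 < |η| ∧ F1 j (ξ / 2 + η) ≠ 0 ∧ F2 (σ - j) (ξ / 2 - η) ≠ 0 := by
    intro j η h
    unfold amp at h
    simp only [ne_eq, mul_eq_zero, not_or] at h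
    refine ⟨?_, h.2.1, h.2.2⟩
    by_contra hc; exact h.1 (ind_neg hc)
  obtain ⟨a1, a2, a3⟩ := unp j η hne
  have b := supp_coord hl h2 (hF2 _ _ a3)
  have xi_big : ∀ η : ℝ, 16 * N2 < |η| → |ξ / 2 - η| ≤ 2 * N2 → 28 * N2 ≤ |ξ| ∧ 0.4 * |ξ| ≤ |η| := by
    intro η hη hx
    have h1 : |η| ≤ |ξ / 2| + |ξ / 2 - η| := by
      have := abs_sub (ξ / 2) (ξ / 2 - η)
      simpa using this
    have h3 : |ξ / 2| ≤ |η| + |ξ / 2 - η| := by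
      have := abs_add_le (ξ / 2 - η) η
      simp only [sub_add_cancel] at this
      linarith
    rw [abs_div, abs_of_pos (by norm_num : (0:ℝ) < 2)] at h1 h3
    constructor
    · linarith
    · norm_num; linarith
  obtain ⟨c1, c2⟩ := xi_big η a1 b.1
  have hcard := H lam N1 N2 ξ η σ j hl h2 h12 a1 b.1 b.2 (by
    intro hz
    apply supp_large hn hl (by linarith) hz
    apply (hF1 _ _ a2).2
    have h1 : |η| ≤ |ξ / 2 + η| / 2 + |ξ / 2 - η| / 2 := by
      have := abs_sub (ξ / 2 + η) (ξ / 2 - η)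
      rw [show ξ / 2 + η - (ξ / 2 - η) = 2 * η by ring, abs_mul, abs_of_pos (by norm_num : (0:ℝ) < 2)] at this
      linarith
    linarith [b.1])
  have hξ0 : 0 < |ξ| := by linarith
  have key : ∀ j', ∫⁻ η', ind (amp (fun η => 16 * N2 < |η|) F1 F2 σ j' ξ η' ≠ 0) *
      Ψ (2 * η ^ 2 - 2 * η' ^ 2 + (en lam σ j - en lam σ j')) ≤
      ind ((∀ i, |((σ - j') i : ℝ)| ≤ 2 * (lam * N2)) ∧ quadC (5 * N2 * lam ^ 2 * |ξ|) j (j - j') (σ - j)) *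
        (ENNReal.ofReal (5 / |ξ|) * ∫⁻ s, Ψ s) := by
    intro j'
    by_cases hc : (∀ i, |((σ - j') i : ℝ)| ≤ 2 * (lam * N2)) ∧ quadC (5 * N2 * lam ^ 2 * |ξ|) j (j - j') (σ - j)
    · rw [ind_pos hc, one_mul]
      have := kq_far_neg Ψ (2 * η ^ 2 + (en lam σ j - en lam σ j')) (0.4 * |ξ|) (by positivity)
      rw [show 2 / (0.4 * |ξ|) = 5 / |ξ| by field_simp; norm_num] at this
      refine le_trans (lintegral_mono fun η' => ?_) this
      dsimp only
      rw [show 2 * η ^ 2 - 2 * η' ^ 2 + (en lam σ j - en lam σ j') = 2 * η ^ 2 + (en lam σ j - en lam σ j') - 2 * η' ^ 2 by ring]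
      gcongr
      apply ind_mono
      intro h
      obtain ⟨d1, d2, d3⟩ := unp j' η' h
      exact (xi_big η' d1 (supp_coord hl h2 (hF2 _ _ d3)).1).2
    · rw [ind_neg hc, zero_mul, nonpos_iff_eq_zero]
      rw [lintegral_eq_zero_of_ae_eq_zero]
      refine Filter.Eventually.of_forall fun η' => ?_
      dsimp only [Pi.zero_apply]
      by_contra hz
      simp only [mul_eq_zero, not_or] at hz
      obtain ⟨z1, z2⟩ := hz
      have h : amp (fun η => 16 * N2 < |η|) F1 F2 σ j' ξ η' ≠ 0 := by
        by_contra hcc; exact z1 (ind_neg (not_not.mpr hcc))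
      obtain ⟨d1, d2, d3⟩ := unp j' η' h
      have e := supp_coord hl h2 (hF2 _ _ d3)
      apply hc
      refine ⟨e.2, ?_⟩
      unfold quadC
      rw [en_diff hl]
      have hΨ := hs _ z2
      have m1 : |η - η'| ≤ 4 * N2 := by
        have x1 := abs_le.mp b.1
        have x2 := abs_le.mp e.1
        rw [abs_le]; constructor <;> linarith
      have m2 : |η + η'| ≤ |ξ| + 4 * N2 := by
        have x1 := abs_le.mp b.1
        have x2 := abs_le.mp e.1
        have x3 := le_abs_self ξ
        have x4 := neg_abs_le ξ
        rw [abs_le]; constructor <;> linarith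
      have m3 : |2 * η ^ 2 - 2 * η' ^ 2| ≤ 2 * (4 * N2 * (|ξ| + 4 * N2)) := by
        rw [show 2 * η ^ 2 - 2 * η' ^ 2 = 2 * ((η - η') * (η + η')) by ring, abs_mul, abs_mul,
          abs_of_pos (by norm_num : (0:ℝ) < 2)]
        gcongr
      have m4 : |en lam σ j - en lam σ j'| ≤ 10 * (N2 * |ξ|) := by
        have m5 : 28 ≤ N2 * |ξ| := by nlinarith
        have m6 : N2 * (28 * N2) ≤ N2 * |ξ| := by gcongr
        rw [abs_le] at hΨ m3 ⊢
        constructor <;> nlinarith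
      rw [abs_div, abs_mul, abs_of_nonneg (sq_nonneg lam)]
      rw [abs_of_pos (by norm_num : (0:ℝ) < 2), div_le_iff₀ (by norm_num)]
      nlinarith [mul_le_mul_of_nonneg_right m4 (sq_nonneg lam)]
  calc _ ≤ ∑' j', ind ((∀ i, |((σ - j') i : ℝ)| ≤ 2 * (lam * N2)) ∧ quadC (5 * N2 * lam ^ 2 * |ξ|) j (j - j') (σ - j)) *
        (ENNReal.ofReal (5 / |ξ|) * ∫⁻ s, Ψ s) := ENNReal.tsum_le_tsum key
    _ = (∑' j', ind ((∀ i, |((σ - j') i : ℝ)| ≤ 2 * (lam * N2)) ∧ quadC (5 * N2 * lam ^ 2 * |ξ|) j (j - j') (σ - j))) *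
        (ENNReal.ofReal (5 / |ξ|) * ∫⁻ s, Ψ s) := ENNReal.tsum_mul_right
    _ ≤ ENNReal.ofReal (C * (Kd n lam N1 N2 * |ξ|)) * (ENNReal.ofReal (5 / |ξ|) * ∫⁻ s, Ψ s) := by gcongr
    _ = _ := by
      rw [← mul_assoc, ← ENNReal.ofReal_mul (by positivity)]
      congr 2
      field_simp

lemma inf_bd (n : ℕ) (hn : 1 ≤ n) : ∃ C : ℝ, 0 < C ∧ ∀ (lam N1 N2 : ℝ), 1 ≤ lam → 1 ≤ N2 → N2 ≤ N1 →
    ∀ (F1 F2 : (Fin n → ℤ) → ℝ → ℝ≥0∞) (Ψ : ℝ → ℝ≥0∞),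
    (∀ j, Measurable (F1 j)) → (∀ j, Measurable (F2 j)) → Measurable Ψ →
    (∀ s, Ψ s ≠ 0 → |s| ≤ 7) →
    (∀ j ζ, F1 j ζ ≠ 0 → ζ ^ 2 + ∑ i, ((j i : ℝ) / lam) ^ 2 ≤ (2 * N1) ^ 2 ∧
      (1 < N1 → (N1 / 2) ^ 2 ≤ ζ ^ 2 + ∑ i, ((j i : ℝ) / lam) ^ 2)) →
    (∀ j ζ, F2 j ζ ≠ 0 → ζ ^ 2 + ∑ i, ((j i : ℝ) / lam) ^ 2 ≤ (2 * N2) ^ 2) →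
    ZZ lam (fun η => 16 * N2 < |η|) F1 F2 Ψ ≤ ENNReal.ofReal (C * Kd n lam N1 N2) * (∫⁻ s, Ψ s ^ 2) ^ (1/2:ℝ) *
      ((∑' j, ∫⁻ x, F1 j x ^ 2) * ∑' j, ∫⁻ x, F2 j x ^ 2) := by
  obtain ⟨C, hC, H⟩ := inf_ker n hn
  refine ⟨C * 8, by positivity, ?_⟩
  intro lam N1 N2 hl h2 h12 F1 F2 Ψ m1 m2 hΨ hs hF1 hF2
  have hK := Kd_pos n hl h2 h12
  set P : ℝ → Prop := fun η => 16 * N2 < |η| with hPdef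
  have hP : MeasurableSet {x | P x} := measurableSet_lt measurable_const measurable_abs
  have hA := amp_meas' hP m1 m2
  have hS : ∀ σ j ξ, Measurable fun η => ind (amp P F1 F2 σ j ξ η ≠ 0) := fun σ j ξ =>
    measurable_ind ((hA σ j ξ) (measurableSet_singleton 0).compl)
  -- the one-sided bound
  have T1 : ∀ Φ : ℝ → ℝ≥0∞, Measurable Φ → (∀ s, Φ s ≠ 0 → |s| ≤ 7) → ∀ σ ξ,
      ∑' j, ∑' j', ∫⁻ η, ∫⁻ η', amp P F1 F2 σ j ξ η ^ 2 * (ind (amp P F1 F2 σ j' ξ η' ≠ 0) *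
        Φ (2 * η ^ 2 - 2 * η' ^ 2 + (en lam σ j - en lam σ j'))) ≤
      (ENNReal.ofReal (C * Kd n lam N1 N2) * ∫⁻ s, Φ s) * ∑' j, ∫⁻ η, amp P F1 F2 σ j ξ η ^ 2 := by
    intro Φ hΦ hsΦ σ ξ
    rw [← ENNReal.tsum_mul_left]
    refine ENNReal.tsum_le_tsum fun j => ?_
    have hjm : ∀ j', Measurable fun p : ℝ × ℝ => amp P F1 F2 σ j ξ p.1 ^ 2 * (ind (amp P F1 F2 σ j' ξ p.2 ≠ 0) *
        Φ (2 * p.1 ^ 2 - 2 * p.2 ^ 2 + (en lam σ j - en lam σ j'))) := fun j' =>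
      (((hA σ j ξ).comp measurable_fst).pow_const 2).mul (((hS σ j' ξ).comp measurable_snd).mul (by fun_prop))
    rw [← lintegral_tsum (fun j' => (hjm j').lintegral_prod_right'.aemeasurable)]
    rw [← lintegral_const_mul _ ((hA σ j ξ).pow_const 2)]
    refine lintegral_mono fun η => ?_
    dsimp only
    by_cases h0 : amp P F1 F2 σ j ξ η = 0
    · simp [h0]
    have hk := H lam N1 N2 hl h2 h12 F1 F2 Φ hsΦ hF1 hF2 σ j ξ η h0
    have : ∀ j', ∫⁻ η', amp P F1 F2 σ j ξ η ^ 2 * (ind (amp P F1 F2 σ j' ξ η' ≠ 0) *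
        Φ (2 * η ^ 2 - 2 * η' ^ 2 + (en lam σ j - en lam σ j'))) = amp P F1 F2 σ j ξ η ^ 2 *
        ∫⁻ η', (ind (amp P F1 F2 σ j' ξ η' ≠ 0) *
        Φ (2 * η ^ 2 - 2 * η' ^ 2 + (en lam σ j - en lam σ j'))) := fun j' =>
      lintegral_const_mul _ ((hS σ j' ξ).mul (by fun_prop))
    simp_rw [this]
    rw [ENNReal.tsum_mul_left, mul_comm]
    gcongr
  have fix : ∀ σ ξ, ∑' j : Fin n → ℤ, ∑' j' : Fin n → ℤ, ∫⁻ η : ℝ, ∫⁻ η' : ℝ,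
      amp P F1 F2 σ j ξ η * amp P F1 F2 σ j' ξ η' * Ψ (2 * η ^ 2 - 2 * η' ^ 2 + (en lam σ j - en lam σ j')) ≤
      (2 * (ENNReal.ofReal (C * Kd n lam N1 N2) * ∫⁻ s, Ψ s)) * ∑' j, ∫⁻ η, amp P F1 F2 σ j ξ η ^ 2 := by
    intro σ ξ
    have t1 := T1 Ψ hΨ hs σ ξ
    have t2 := T1 (fun s => Ψ (-s)) (hΨ.comp measurable_neg) (fun s h => by simpa using hs _ h) σ ξ
    rw [lintegral_neg_comp Ψ] at t2
    have hjm : ∀ j j', Measurable fun p : ℝ × ℝ => amp P F1 F2 σ j ξ p.1 ^ 2 * (ind (amp P F1 F2 σ j' ξ p.2 ≠ 0) *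
        Ψ (2 * p.1 ^ 2 - 2 * p.2 ^ 2 + (en lam σ j - en lam σ j'))) := fun j j' =>
      (((hA σ j ξ).comp measurable_fst).pow_const 2).mul (((hS σ j' ξ).comp measurable_snd).mul (by fun_prop))
    have hjm2 : ∀ j j', Measurable fun p : ℝ × ℝ => amp P F1 F2 σ j' ξ p.2 ^ 2 * (ind (amp P F1 F2 σ j ξ p.1 ≠ 0) *
        Ψ (-(2 * p.2 ^ 2 - 2 * p.1 ^ 2 + (en lam σ j' - en lam σ j)))) := fun j j' =>
      (((hA σ j' ξ).comp measurable_snd).pow_const 2).mul (((hS σ j ξ).comp measurable_fst).mul (by fun_prop))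
    have t2' : ∑' j, ∑' j', ∫⁻ η, ∫⁻ η', amp P F1 F2 σ j' ξ η' ^ 2 * (ind (amp P F1 F2 σ j ξ η ≠ 0) *
        Ψ (-(2 * η' ^ 2 - 2 * η ^ 2 + (en lam σ j' - en lam σ j)))) ≤
        (ENNReal.ofReal (C * Kd n lam N1 N2) * ∫⁻ s, Ψ s) * ∑' j, ∫⁻ η, amp P F1 F2 σ j ξ η ^ 2 := by
      refine le_trans (le_of_eq ?_) t2
      rw [ENNReal.tsum_comm]
      refine tsum_congr fun j' => tsum_congr fun j => ?_
      exact lintegral_lintegral_swap (hjm2 j j').aemeasurable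
    calc _ ≤ ∑' j, ∑' j', ((∫⁻ η, ∫⁻ η', amp P F1 F2 σ j ξ η ^ 2 * (ind (amp P F1 F2 σ j' ξ η' ≠ 0) *
          Ψ (2 * η ^ 2 - 2 * η' ^ 2 + (en lam σ j - en lam σ j')))) +
          ∫⁻ η, ∫⁻ η', amp P F1 F2 σ j' ξ η' ^ 2 * (ind (amp P F1 F2 σ j ξ η ≠ 0) *
          Ψ (-(2 * η' ^ 2 - 2 * η ^ 2 + (en lam σ j' - en lam σ j))))) := by
          refine ENNReal.tsum_le_tsum fun j => ENNReal.tsum_le_tsum fun j' => ?_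
          rw [← lintegral_add_left (hjm j j').lintegral_prod_right']
          refine lintegral_mono fun η => ?_
          dsimp only
          have hx : Measurable fun η' => amp P F1 F2 σ j ξ η ^ 2 * (ind (amp P F1 F2 σ j' ξ η' ≠ 0) *
            Ψ (2 * η ^ 2 - 2 * η' ^ 2 + (en lam σ j - en lam σ j'))) := (hjm j j').comp measurable_prodMk_left
          rw [← lintegral_add_left hx]
          refine lintegral_mono fun η' => ?_
          dsimp only
          rw [show -(2 * η' ^ 2 - 2 * η ^ 2 + (en lam σ j' - en lam σ j)) =
            2 * η ^ 2 - 2 * η' ^ 2 + (en lam σ j - en lam σ j') by ring]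
          by_cases z1 : amp P F1 F2 σ j ξ η = 0
          · simp [z1]
          by_cases z2 : amp P F1 F2 σ j' ξ η' = 0
          · simp [z2]
          rw [ind_pos z1, ind_pos z2, one_mul, ← add_mul]
          gcongr
          exact mul_le_sq_add_sq _ _
      _ = _ := by simp_rw [ENNReal.tsum_add]
      _ ≤ _ := (add_le_add t1 t2').trans (le_of_eq (by ring))
  have hαm : ∀ σ j, Measurable (fun ξ => ∫⁻ η, amp P F1 F2 σ j ξ η ^ 2) := fun σ j =>
    Measurable.lintegral_prod_right' (f := fun p : ℝ × ℝ => amp P F1 F2 σ j p.1 p.2 ^ 2)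
      ((amp_meas hP m1 m2 σ j).pow_const 2)
  calc ZZ lam P F1 F2 Ψ ≤ ∑' σ, ∫⁻ ξ, (2 * (ENNReal.ofReal (C * Kd n lam N1 N2) * ∫⁻ s, Ψ s)) *
        ∑' j, ∫⁻ η, amp P F1 F2 σ j ξ η ^ 2 := ENNReal.tsum_le_tsum fun σ => lintegral_mono fun ξ => fix σ ξ
    _ = (2 * (ENNReal.ofReal (C * Kd n lam N1 N2) * ∫⁻ s, Ψ s)) * ∑' σ, ∑' j, ∫⁻ ξ, ∫⁻ η, amp P F1 F2 σ j ξ η ^ 2 := by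
        rw [← ENNReal.tsum_mul_left]
        refine tsum_congr fun σ => ?_
        rw [lintegral_const_mul _ (Measurable.ennreal_tsum fun j => hαm σ j),
          lintegral_tsum (fun j => (hαm σ j).aemeasurable)]
    _ ≤ (2 * (ENNReal.ofReal (C * Kd n lam N1 N2) * (4 * (∫⁻ s, Ψ s ^ 2) ^ (1/2:ℝ)))) *
        ∑' σ, ∑' j, (∫⁻ x, F1 j x ^ 2) * ∫⁻ x, F2 (σ - j) x ^ 2 := by
        gcongr
        · exact l1_le_l2 Ψ hΨ hs
        · exact amp_int m1 m2 _ _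
    _ = (2 * (ENNReal.ofReal (C * Kd n lam N1 N2) * (4 * (∫⁻ s, Ψ s ^ 2) ^ (1/2:ℝ)))) *
        ((∑' j, ∫⁻ x, F1 j x ^ 2) * ∑' j, ∫⁻ x, F2 j x ^ 2) := by
        congr 1
        rw [ENNReal.tsum_comm, ← ENNReal.tsum_mul_right]
        refine tsum_congr fun j => ?_
        rw [ENNReal.tsum_mul_left]
        congr 1
        exact tsum_shift_sub' (fun j => ∫⁻ x, F2 j x ^ 2) j
    _ = _ := by
        rw [show C * 8 * Kd n lam N1 N2 = 8 * (C * Kd n lam N1 N2) by ring, ENNReal.ofReal_mul (p := 8) (by norm_num),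
          show ENNReal.ofReal 8 = 2 * 4 by norm_num]
        ring

-- part J
open MeasureTheory
open scoped ENNReal NNReal

lemma exists_weight : ∃ (w : ℝ → ℝ) (c M : ℝ), Continuous w ∧ Integrable w ∧ (∀ t, 0 ≤ w t) ∧ 0 < c ∧
    (∀ t, |t| ≤ 1/2 → c ≤ w t) ∧ 0 < M ∧
    (∀ E : ℝ, ‖∫ t : ℝ, (w t : ℂ) * Complex.exp (-(Complex.I * ((t * E : ℝ) : ℂ)))‖ ≤ M) ∧
    (∀ E : ℝ, Real.pi < |E| → ∫ t : ℝ, (w t : ℂ) * Complex.exp (-(Complex.I * ((t * E : ℝ) : ℂ))) = 0) := by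
  let φ : ContDiffBump (0:ℝ) := ⟨1/8, 1/4, by norm_num, by norm_num⟩
  have hφ0 : ∀ s, 1/4 ≤ |s| → φ s = 0 := by
    intro s hs
    apply φ.zero_of_le_dist
    rw [Real.dist_eq, sub_zero]; exact hs
  have hφc : Continuous (φ : ℝ → ℝ) := φ.continuous
  have hφi : Integrable (φ : ℝ → ℝ) := φ.integrable
  have hcs : ∀ τ : ℝ, HasCompactSupport (fun s : ℝ => (φ (s - τ) : ℂ)) := by
    intro τ
    have h1 : HasCompactSupport (fun s : ℝ => φ (s - τ)) :=
      φ.hasCompactSupport.comp_homeomorph (Homeomorph.subRight τ)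
    exact h1.comp_left (g := fun x : ℝ => (x : ℂ)) (by simp)
  have hsm : ∀ τ : ℝ, ContDiff ℝ (↑(⊤:ℕ∞)) (fun s : ℝ => (φ (s - τ) : ℂ)) := by
    intro τ
    have h1 : ContDiff ℝ (↑(⊤:ℕ∞)) (fun s : ℝ => φ (s - τ)) := φ.contDiff.comp (contDiff_id.sub contDiff_const)
    exact Complex.ofRealCLM.contDiff.comp h1
  let S : ℝ → SchwartzMap ℝ ℂ := fun τ => (hcs τ).toSchwartzMap (hsm τ)
  have hS : ∀ τ s, S τ s = (φ (s - τ) : ℂ) := fun τ s => rfl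
  let F : ℝ → ℂ := fun t => ∫ s : ℝ, Complex.exp (((-2 * Real.pi * s * t : ℝ) : ℂ) * Complex.I) * (φ s : ℂ)
  have hF : ∀ τ t, FourierTransform.fourier (S τ) t = Complex.exp (((-2 * Real.pi * τ * t : ℝ) : ℂ) * Complex.I) * F t := by
    intro τ t
    rw [SchwartzMap.fourier_coe, Real.fourier_eq']
    simp only [F]
    rw [← integral_const_mul]
    rw [← integral_add_right_eq_self _ τ]
    congr 1; ext s
    rw [hS, smul_eq_mul, ← mul_assoc, ← Complex.exp_add]
    simp only [RCLike.inner_apply, conj_trivial, add_sub_cancel_right]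
    congr 2
    push_cast; ring
  have hF0 : ∀ t, FourierTransform.fourier (S 0) t = F t := by
    intro t; rw [hF]; simp
  have hFc : Continuous F := by
    have : (F : ℝ → ℂ) = (FourierTransform.fourier (S 0) : SchwartzMap ℝ ℂ) := by
      ext t; rw [hF0]
    rw [this]; exact SchwartzMap.continuous _
  have hFI : Integrable (fun t => ‖F t‖ ^ 2) := by
    have h := (SchwartzMap.memLp (FourierTransform.fourier (S 0) : SchwartzMap ℝ ℂ) 2 volume)
    have h2 := h.integrable_norm_pow (by norm_num)
    refine h2.congr (Filter.Eventually.of_forall fun t => ?_)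
    simp only [hF0]
    try norm_num
  have key : ∀ E : ℝ, ∫ t : ℝ, ((‖F t‖^2 : ℝ) : ℂ) * Complex.exp (-(Complex.I * ((t * E : ℝ) : ℂ)))
      = ∫ s : ℝ, ((φ (s + E / (2 * Real.pi)) * φ s : ℝ) : ℂ) := by
    intro E
    have h := SchwartzMap.integral_inner_fourier_fourier (S (- E / (2 * Real.pi))) (S 0)
    have e1 : ∀ t : ℝ, inner ℂ (FourierTransform.fourier (S (- E / (2 * Real.pi))) t) (FourierTransform.fourier (S 0) t)
        = ((‖F t‖^2 : ℝ) : ℂ) * Complex.exp (-(Complex.I * ((t * E : ℝ) : ℂ))) := by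
      intro t
      rw [hF0, hF, RCLike.inner_apply, map_mul, ← Complex.exp_conj]
      have : F t * (starRingEnd ℂ) (F t) = ((‖F t‖^2 : ℝ) : ℂ) := by
        rw [Complex.mul_conj, Complex.normSq_eq_norm_sq]
      rw [mul_comm, mul_assoc, mul_comm ((starRingEnd ℂ) (F t)), this, mul_comm]
      congr 2
      rw [map_mul, Complex.conj_I, Complex.conj_ofReal]
      have := Real.pi_pos.ne'
      have e : -2 * Real.pi * (-E / (2 * Real.pi)) * t = t * E := by field_simp
      rw [e]; ring
    simp_rw [e1] at h
    rw [h]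
    congr 1; ext s
    rw [hS, hS, RCLike.inner_apply, Complex.conj_ofReal, sub_zero, ← Complex.ofReal_mul, mul_comm]
    congr 3; ring
  have hpi := Real.pi_pos
  have hInt : 0 < ∫ s, φ s := φ.integral_pos
  refine ⟨fun t => ‖F t‖^2, ((1/2) * ∫ s, φ s)^2, ∫ s, φ s, by fun_prop, hFI, fun t => by positivity, by positivity, ?_, hInt, ?_, ?_⟩
  · intro t ht
    apply pow_le_pow_left₀ (by positivity)
    refine le_trans ?_ (Complex.re_le_norm _)
    have e1 : (F t).re = ∫ s : ℝ, Real.cos (-2 * Real.pi * s * t) * φ s := by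
      simp only [F]
      have := integral_re (𝕜 := ℂ) (f := fun s : ℝ => Complex.exp (((-2 * Real.pi * s * t : ℝ) : ℂ) * Complex.I) * (φ s : ℂ)) (μ := volume) ?_
      · refine Eq.trans this.symm ?_
        congr 1; ext s
        exact (Complex.re_mul_ofReal _ _).trans (by rw [Complex.exp_ofReal_mul_I_re])
      · have h0 : Integrable (fun s : ℝ => (φ s : ℂ)) := hφi.ofReal
        refine h0.bdd_mul (c := 1) (by fun_prop) (Filter.Eventually.of_forall fun s => ?_)
        rw [Complex.norm_exp_ofReal_mul_I]
    rw [e1, ← integral_const_mul]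
    apply integral_mono_of_nonneg (Filter.Eventually.of_forall fun s => mul_nonneg (by norm_num) φ.nonneg)
    · refine hφi.bdd_mul (c := 1) (by fun_prop) (Filter.Eventually.of_forall fun s => ?_)
      rw [Real.norm_eq_abs]; exact Real.abs_cos_le_one _
    · refine Filter.Eventually.of_forall fun s => ?_
      dsimp only
      by_cases hs : 1/4 ≤ |s|
      · rw [hφ0 s hs]; simp
      · apply mul_le_mul_of_nonneg_right _ φ.nonneg
        have h4 : |(-2 * Real.pi * s * t)| ≤ Real.pi / 3 := by
          rw [abs_mul, abs_mul, abs_mul, abs_of_pos hpi]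
          have : |s| * |t| ≤ 1/4 * (1/2) := mul_le_mul (by linarith) ht (abs_nonneg _) (by norm_num)
          have h5 : |(-2:ℝ)| = 2 := by norm_num
          rw [h5]
          nlinarith
        rw [← Real.cos_abs, ← Real.cos_pi_div_three]
        apply Real.cos_le_cos_of_nonneg_of_le_pi (abs_nonneg _) (by linarith) h4
  · intro E
    rw [key, integral_complex_ofReal]
    rw [Complex.norm_real, Real.norm_eq_abs, abs_of_nonneg (integral_nonneg fun s => mul_nonneg φ.nonneg φ.nonneg)]
    apply integral_mono_of_nonneg (Filter.Eventually.of_forall fun s => mul_nonneg φ.nonneg φ.nonneg) hφi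
    exact Filter.Eventually.of_forall fun s => mul_le_of_le_one_left φ.nonneg φ.le_one
  · intro E hE
    rw [key]
    have : ∀ s, φ (s + E / (2 * Real.pi)) * φ s = 0 := by
      intro s
      by_cases h1 : 1/4 ≤ |s|
      · rw [hφ0 s h1, mul_zero]
      · rw [hφ0 (s + E / (2 * Real.pi)), zero_mul]
        have h2 : 1/2 < |E / (2 * Real.pi)| := by
          rw [abs_div, abs_of_pos (by positivity : (0:ℝ) < 2 * Real.pi), lt_div_iff₀ (by positivity)]
          linarith
        have h3 := abs_sub_abs_le_abs_sub (E / (2 * Real.pi)) (-s)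
        rw [abs_neg, sub_neg_eq_add, add_comm (E / _)] at h3
        linarith
    simp [this]

-- part K
open MeasureTheory
open scoped ENNReal NNReal

lemma TT {T α : Type*} [MeasurableSpace T] [MeasurableSpace α] (ν : Measure T) (μ : Measure α) [SFinite ν] [SFinite μ]
    (W : T → ℝ) (hW : Integrable W ν) (hW0 : ∀ t, 0 ≤ W t) (U : T → α → ℂ)
    (hU : Measurable (fun p : T × α => U p.1 p.2)) (hU1 : ∀ t a, ‖U t a‖ ≤ 1)
    (m : α → ℂ) (hm : Integrable m μ) (Ψ : α → α → ℝ≥0∞) (hΨm : Measurable (fun p : α × α => Ψ p.1 p.2))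
    (hΨ : ∀ a a', ‖∫ t, (W t : ℂ) * (U t a * (starRingEnd ℂ) (U t a')) ∂ν‖ₑ ≤ Ψ a a') :
    ∫⁻ t, ENNReal.ofReal (W t) * ‖∫ a, m a * U t a ∂μ‖ₑ ^ 2 ∂ν ≤
      ∫⁻ a, ∫⁻ a', ‖m a‖ₑ * ‖m a'‖ₑ * Ψ a a' ∂μ ∂μ := by
  set h : T → ℂ := fun t => ∫ a, m a * U t a ∂μ with hh
  have hUt : ∀ t, Measurable (U t) := fun t => hU.comp measurable_prodMk_left
  have hmI : ∀ t, Integrable (fun a => m a * U t a) μ := fun t =>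
    hm.mul_bdd (c := 1) (hUt t).aestronglyMeasurable (Filter.Eventually.of_forall (hU1 t))
  -- big integrand
  let Φ : T → α × α → ℂ := fun t p => (W t : ℂ) * ((m p.1 * U t p.1) * (starRingEnd ℂ) (m p.2 * U t p.2))
  have hΦ : Integrable (Function.uncurry Φ) (ν.prod (μ.prod μ)) := by
    have h1 : Integrable (fun p : T × (α × α) => (W p.1 : ℂ) * (m p.2.1 * (starRingEnd ℂ) (m p.2.2))) (ν.prod (μ.prod μ)) := by
      have hmc : Integrable (fun a => (starRingEnd ℂ) (m a)) μ := by
        exact (integrable_norm_iff (Complex.continuous_conj.comp_aestronglyMeasurable hm.1)).1 (by simpa using hm.norm)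
      exact (hW.ofReal (𝕜 := ℂ)).mul_prod (hm.mul_prod hmc)
    have h2 : Measurable (fun p : T × (α × α) => U p.1 p.2.1 * (starRingEnd ℂ) (U p.1 p.2.2)) := by
      have e1 : Measurable (fun p : T × (α × α) => U p.1 p.2.1) := hU.comp (by fun_prop : Measurable (fun p : T × (α × α) => (p.1, p.2.1)))
      have e2 : Measurable (fun p : T × (α × α) => U p.1 p.2.2) := hU.comp (by fun_prop : Measurable (fun p : T × (α × α) => (p.1, p.2.2)))
      exact e1.mul (Complex.continuous_conj.measurable.comp e2)
    have h3 := h1.mul_bdd (c := 1) h2.aestronglyMeasurable (Filter.Eventually.of_forall fun p => by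
      rw [norm_mul, RCLike.norm_conj]
      exact mul_le_one₀ (hU1 _ _) (norm_nonneg _) (hU1 _ _))
    refine h3.congr (Filter.Eventually.of_forall fun p => ?_)
    simp only [Φ, Function.uncurry, map_mul]; ring
  have hin : ∀ t, ∫ p, Φ t p ∂(μ.prod μ) = ((W t * ‖h t‖ ^ 2 : ℝ) : ℂ) := by
    intro t
    simp only [Φ]
    rw [integral_const_mul, integral_prod_mul (fun a => m a * U t a) (fun a => (starRingEnd ℂ) (m a * U t a)), integral_conj]
    rw [Complex.mul_conj, Complex.normSq_eq_norm_sq]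
    push_cast; rfl
  have hsq : ∀ t, ENNReal.ofReal (W t) * ‖h t‖ₑ ^ 2 = ENNReal.ofReal (W t * ‖h t‖^2) := by
    intro t
    rw [ENNReal.ofReal_mul (hW0 t), ENNReal.ofReal_pow (norm_nonneg _), ofReal_norm]
  have hWI : Integrable (fun t => W t * ‖h t‖ ^ 2) ν := by
    have := hΦ.integral_prod_left
    have h2 := this.re
    refine h2.congr (Filter.Eventually.of_forall fun t => ?_)
    simp only [Function.uncurry]
    rw [hin]; exact Complex.ofReal_re _
  refine (lintegral_congr hsq).trans_le ?_
  rw [← ofReal_integral_eq_lintegral_ofReal hWI (Filter.Eventually.of_forall fun t => mul_nonneg (hW0 t) (by positivity))]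
  have e1 : ENNReal.ofReal (∫ t, W t * ‖h t‖ ^ 2 ∂ν) = ‖∫ t, ∫ p, Φ t p ∂(μ.prod μ) ∂ν‖ₑ := by
    simp_rw [hin]
    rw [integral_complex_ofReal, ← ofReal_norm, Complex.norm_real, Real.norm_eq_abs,
      abs_of_nonneg (integral_nonneg fun t => mul_nonneg (hW0 t) (by positivity))]
  rw [e1, integral_integral_swap hΦ]
  refine (enorm_integral_le_lintegral_enorm _).trans ?_
  have e2 : ∀ p : α × α, ‖∫ t, Φ t p ∂ν‖ₑ ≤ ‖m p.1‖ₑ * ‖m p.2‖ₑ * Ψ p.1 p.2 := by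
    intro p
    have : ∫ t, Φ t p ∂ν = (m p.1 * (starRingEnd ℂ) (m p.2)) * ∫ t, (W t : ℂ) * (U t p.1 * (starRingEnd ℂ) (U t p.2)) ∂ν := by
      rw [← integral_const_mul]
      congr 1; ext t
      simp only [Φ, map_mul]; ring
    rw [this, enorm_mul, enorm_mul]
    have e : ‖(starRingEnd ℂ) (m p.2)‖ₑ = ‖m p.2‖ₑ := by rw [← ofReal_norm, RCLike.norm_conj, ofReal_norm]
    rw [e]
    gcongr
    exact hΨ _ _
  refine (lintegral_mono e2).trans ?_
  rw [lintegral_prod]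
  have hme : AEMeasurable (fun a => ‖m a‖ₑ) μ := hm.1.enorm
  exact ((hme.comp_fst (ν := μ)).mul (hme.comp_snd (μ := μ))).mul hΨm.aemeasurable

-- part L
open MeasureTheory
open scoped ENNReal NNReal

lemma schur_gen {α : Type*} [MeasurableSpace α] (μ : Measure α) [SFinite μ] (f : α → ℝ≥0∞) (hf : AEMeasurable f μ)
    (Ψ : α → α → ℝ≥0∞) (hΨ : Measurable (fun p : α × α => Ψ p.1 p.2)) (hs : ∀ a b, Ψ a b = Ψ b a)
    (B : ℝ≥0∞) (hB : ∀ a, ∫⁻ b, Ψ a b ∂μ ≤ B) :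
    ∫⁻ a, ∫⁻ b, f a * f b * Ψ a b ∂μ ∂μ ≤ 2 * B * ∫⁻ a, f a ^ 2 ∂μ := by
  have hΨa : ∀ a, Measurable (fun b => Ψ a b) := fun a => hΨ.comp measurable_prodMk_left
  have e1 : ∫⁻ a, ∫⁻ b, f a ^ 2 * Ψ a b ∂μ ∂μ ≤ B * ∫⁻ a, f a ^ 2 ∂μ := by
    rw [← lintegral_const_mul'' _ (hf.pow_const 2)]
    refine lintegral_mono fun a => ?_
    rw [lintegral_const_mul _ (hΨa a), mul_comm]
    gcongr; exact hB a
  have e2 : ∫⁻ a, ∫⁻ b, f b ^ 2 * Ψ a b ∂μ ∂μ = ∫⁻ a, ∫⁻ b, f a ^ 2 * Ψ a b ∂μ ∂μ := by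
    rw [lintegral_lintegral_swap]
    · simp_rw [hs]
    · exact ((hf.comp_snd (μ := μ)).pow_const 2).mul hΨ.aemeasurable
  calc _ ≤ ∫⁻ a, (∫⁻ b, f a ^ 2 * Ψ a b ∂μ + ∫⁻ b, f b ^ 2 * Ψ a b ∂μ) ∂μ := by
        refine lintegral_mono fun a => ?_
        rw [← lintegral_add_left ((hΨa a).const_mul _)]
        refine lintegral_mono fun b => ?_
        dsimp only
        rw [← add_mul]
        gcongr
        exact mul_le_sq_add_sq _ _
    _ = ∫⁻ a, ∫⁻ b, f a ^ 2 * Ψ a b ∂μ ∂μ + ∫⁻ a, ∫⁻ b, f b ^ 2 * Ψ a b ∂μ ∂μ := by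
        apply lintegral_add_left'
        simp_rw [lintegral_const_mul _ (hΨa _)]
        exact (hf.pow_const 2).mul hΨ.lintegral_prod_right'.aemeasurable
    _ ≤ _ := by
        rw [e2, ← two_mul, mul_assoc]
        gcongr

lemma exp_int_1d (lam : ℝ) (hl : 0 < lam) (k : ℤ) :
    ∫ u in Set.Icc (0:ℝ) (2 * Real.pi * lam), Complex.exp (Complex.I * ((u * ((k:ℝ) / lam) : ℝ) : ℂ))
      = if k = 0 then ((2 * Real.pi * lam : ℝ) : ℂ) else 0 := by
  have hp : 0 ≤ 2 * Real.pi * lam := by positivity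
  rw [integral_Icc_eq_integral_Ioc, ← intervalIntegral.integral_of_le hp]
  split_ifs with h
  · subst h; simp
  · have hc : Complex.I * ((k:ℂ) / lam) ≠ 0 := by
      have : (lam : ℂ) ≠ 0 := by exact_mod_cast hl.ne'
      have hk : (k : ℂ) ≠ 0 := by exact_mod_cast h
      exact mul_ne_zero Complex.I_ne_zero (div_ne_zero hk this)
    have := integral_exp_mul_complex (a := 0) (b := 2 * Real.pi * lam) hc
    have e : ∀ u : ℝ, Complex.exp (Complex.I * ((u * ((k:ℝ) / lam) : ℝ) : ℂ)) = Complex.exp (Complex.I * ((k:ℂ) / lam) * u) := by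
      intro u; congr 1; push_cast; ring
    simp_rw [e]
    rw [this]
    have e2 : Complex.I * ((k:ℂ) / lam) * ((2 * Real.pi * lam : ℝ) : ℂ) = k * (2 * Real.pi * Complex.I) := by
      have : (lam : ℂ) ≠ 0 := by exact_mod_cast hl.ne'
      push_cast; field_simp
    rw [e2, Complex.exp_int_mul_two_pi_mul_I]
    simp

lemma exp_int_box (lam : ℝ) (hl : 0 < lam) (n : ℕ) (σ : Fin n → ℤ) :
    ∫ y in torusBox lam n, Complex.exp (Complex.I * ((∑ i, y i * ((σ i:ℝ) / lam) : ℝ) : ℂ))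
      = if σ = 0 then ((2 * Real.pi * lam : ℝ) : ℂ) ^ n else 0 := by
  have h1 : (volume : Measure (Fin n → ℝ)).restrict (torusBox lam n) =
      Measure.pi (fun _ : Fin n => (volume : Measure ℝ).restrict (Set.Icc 0 (2 * Real.pi * lam))) := by
    rw [← Measure.restrict_pi_pi, torusBox, ← Set.pi_univ_Icc]; rfl
  rw [h1]
  have h2 : ∀ y : Fin n → ℝ, Complex.exp (Complex.I * ((∑ i, y i * ((σ i:ℝ) / lam) : ℝ) : ℂ))
      = ∏ i, Complex.exp (Complex.I * ((y i * ((σ i:ℝ) / lam) : ℝ) : ℂ)) := by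
    intro y
    rw [← Complex.exp_sum, ← Finset.mul_sum]; push_cast; rfl
  simp_rw [h2]
  rw [integral_fintype_prod_eq_prod (𝕜 := ℂ) (fun i (u : ℝ) => Complex.exp (Complex.I * ((u * ((σ i:ℝ) / lam) : ℝ) : ℂ)))]
  simp_rw [exp_int_1d lam hl]
  split_ifs with h
  · subst h; simp
  · obtain ⟨i, hi⟩ := Function.ne_iff.1 h
    exact Finset.prod_eq_zero (Finset.mem_univ i) (if_neg (by simpa using hi))

/-- frequency space measure -/
noncomputable abbrev kap (n : ℕ) : Measure ((Fin n → ℤ) × ℝ) := (Measure.count : Measure (Fin n → ℤ)).prod volume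

lemma lintegral_kap {n : ℕ} (f : (Fin n → ℤ) × ℝ → ℝ≥0∞) (hf : AEMeasurable f (kap n)) :
    ∫⁻ s, f s ∂(kap n) = ∑' j, ∫⁻ x, f (j, x) := by
  rw [lintegral_prod _ hf, lintegral_count]

-- part M
open MeasureTheory
open scoped ENNReal NNReal

lemma xy_planch (n : ℕ) : ∃ C : ℝ, 0 < C ∧ ∀ lam : ℝ, 0 < lam → ∀ H : (Fin n → ℤ) × ℝ → ℂ, Integrable H (kap n) →
    ∫⁻ x : ℝ, ∫⁻ y in torusBox lam n,
      ‖∫ s, H s * Complex.exp (Complex.I * ((x * s.2 + ∑ i, y i * ((s.1 i : ℝ) / lam) : ℝ) : ℂ)) ∂(kap n)‖ₑ ^ 2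
    ≤ ENNReal.ofReal (C * lam ^ n) * ∫⁻ s, ‖H s‖ₑ ^ 2 ∂(kap n) := by
  obtain ⟨w, c, M, wc, wi, w0, c0, hc, M0, hM, hMz⟩ := exists_weight
  have hpi := Real.pi_pos
  refine ⟨c⁻¹ * (2 * (M * (2 * Real.pi) ^ n * (2 * Real.pi))), by positivity, fun lam hl H hH => ?_⟩
  set U : ℝ × (Fin n → ℝ) → (Fin n → ℤ) × ℝ → ℂ := fun p s =>
    Complex.exp (Complex.I * ((p.1 * s.2 + ∑ i, p.2 i * ((s.1 i : ℝ) / lam) : ℝ) : ℂ)) with hUdef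
  have hUm : Measurable (fun q : (ℝ × (Fin n → ℝ)) × ((Fin n → ℤ) × ℝ) => U q.1 q.2) := by
    have hz : ∀ i : Fin n, Measurable (fun q : (ℝ × (Fin n → ℝ)) × ((Fin n → ℤ) × ℝ) => ((q.2.1 i : ℤ) : ℝ)) := by
      intro i
      exact (measurable_from_top (f := fun z : ℤ => (z:ℝ))).comp (by fun_prop)
    simp only [hUdef]
    apply Complex.measurable_exp.comp
    apply Measurable.const_mul
    apply Complex.measurable_ofReal.comp
    apply Measurable.add (by fun_prop)
    apply Finset.measurable_sum
    intro i _
    apply Measurable.mul (by fun_prop)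
    exact (hz i).div_const _
  have hU1 : ∀ p s, ‖U p s‖ ≤ 1 := by
    intro p s
    simp only [hUdef]
    rw [mul_comm, Complex.norm_exp_ofReal_mul_I]
  set ν := (volume : Measure ℝ).prod ((volume : Measure (Fin n → ℝ)).restrict (torusBox lam n)) with hν
  have hbox : IsFiniteMeasure ((volume : Measure (Fin n → ℝ)).restrict (torusBox lam n)) := by
    refine ⟨?_⟩
    rw [Measure.restrict_apply_univ]
    exact isCompact_Icc.measure_lt_top
  -- main bound for each R
  have main : ∀ R : ℝ, 0 < R → ∫⁻ x in Set.Icc (-(R/2)) (R/2), ∫⁻ y in torusBox lam n, ‖∫ s, H s * U (x, y) s ∂(kap n)‖ₑ ^ 2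
      ≤ ENNReal.ofReal (c⁻¹ * (2 * (M * (2 * Real.pi) ^ n * (2 * Real.pi))) * lam ^ n) * ∫⁻ s, ‖H s‖ₑ ^ 2 ∂(kap n) := by
    intro R hR
    set W : ℝ × (Fin n → ℝ) → ℝ := fun p => w (p.1 / R) with hW
    have hWi : Integrable W ν := by
      have h1 : Integrable (fun x : ℝ => w (x / R)) := wi.comp_div hR.ne'
      exact h1.comp_fst _
    let Ψ : (Fin n → ℤ) × ℝ → (Fin n → ℤ) × ℝ → ℝ≥0∞ := fun s s' =>
      ENNReal.ofReal (R * M * (2 * Real.pi * lam) ^ n) * (ind (s.1 = s'.1) * ind (|R * (s.2 - s'.2)| ≤ Real.pi))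
    have hΨm : Measurable (fun p : ((Fin n → ℤ) × ℝ) × ((Fin n → ℤ) × ℝ) => Ψ p.1 p.2) := by
      apply Measurable.const_mul
      apply Measurable.mul
      · exact measurable_ind (measurableSet_eq_fun (by fun_prop) (by fun_prop))
      · exact measurable_ind (measurableSet_le (by fun_prop) (by fun_prop))
    have hΨ : ∀ s s', ‖∫ p, (W p : ℂ) * (U p s * (starRingEnd ℂ) (U p s')) ∂ν‖ₑ ≤ Ψ s s' := by
      intro s s'
      have e1 : ∀ p : ℝ × (Fin n → ℝ), (W p : ℂ) * (U p s * (starRingEnd ℂ) (U p s')) =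
          ((w (p.1 / R) : ℂ) * Complex.exp (-(Complex.I * (((p.1 / R) * (- (R * (s.2 - s'.2))) : ℝ) : ℂ)))) *
          Complex.exp (Complex.I * ((∑ i, p.2 i * ((((s.1 - s'.1) i : ℤ):ℝ) / lam) : ℝ) : ℂ)) := by
        intro p
        simp only [hUdef, hW]
        rw [← Complex.exp_conj, ← Complex.exp_add, mul_assoc, ← Complex.exp_add]
        congr 2
        rw [map_mul, Complex.conj_I, Complex.conj_ofReal]
        have e3 : p.1 / R * (-(R * (s.2 - s'.2))) = p.1 * s'.2 - p.1 * s.2 := by field_simp; ring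
        have e4 : ∑ i, p.2 i * ((((s.1 - s'.1) i : ℤ):ℝ) / lam) = ∑ i, p.2 i * ((s.1 i : ℝ) / lam) - ∑ i, p.2 i * ((s'.1 i : ℝ) / lam) := by
          rw [← Finset.sum_sub_distrib]
          refine Finset.sum_congr rfl fun i _ => ?_
          simp only [Pi.sub_apply]; push_cast; ring
        rw [e3, e4]; push_cast; ring
      simp_rw [e1]
      rw [hν, integral_prod_mul (fun x : ℝ => (w (x / R) : ℂ) * Complex.exp (-(Complex.I * (((x / R) * (- (R * (s.2 - s'.2))) : ℝ) : ℂ))))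
        (fun y : Fin n → ℝ => Complex.exp (Complex.I * ((∑ i, y i * ((((s.1 - s'.1) i : ℤ):ℝ) / lam) : ℝ) : ℂ)))]
      rw [exp_int_box lam hl]
      rw [Measure.integral_comp_div (fun x : ℝ => (w x : ℂ) * Complex.exp (-(Complex.I * ((x * (- (R * (s.2 - s'.2))) : ℝ) : ℂ)))) R]
      simp only [Ψ]
      by_cases h1 : s.1 = s'.1
      · rw [ind_pos h1, if_pos (by rw [h1, sub_self]), one_mul]
        by_cases h2 : |R * (s.2 - s'.2)| ≤ Real.pi
        · rw [ind_pos h2, mul_one, ← ofReal_norm]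
          apply ENNReal.ofReal_le_ofReal
          rw [norm_mul, norm_smul, ← Complex.ofReal_pow, Complex.norm_real, Real.norm_eq_abs, Real.norm_eq_abs, abs_abs, abs_of_pos hR,
            abs_of_nonneg (by positivity)]
          gcongr
          exact hM _
        · rw [hMz _ (by rw [abs_neg]; exact not_le.1 h2)]
          simp
      · rw [if_neg (by rwa [sub_eq_zero])]
        simp
    have hT := TT ν (kap n) W hWi (fun p => w0 _) U hUm hU1 H hH Ψ hΨm hΨ
    have hS := schur_gen (kap n) (fun s => ‖H s‖ₑ) hH.1.enorm Ψ hΨm (fun a b => by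
      simp only [Ψ]
      rw [abs_mul R, abs_mul R, abs_sub_comm, eq_comm (a := a.1)])
      (ENNReal.ofReal (M * (2 * Real.pi * lam) ^ n * (2 * Real.pi))) (fun a => by
        simp only [Ψ]
        rw [lintegral_const_mul]
        · rw [lintegral_kap]
          · simp only
            rw [tsum_eq_single a.1 (fun b hb => by rw [lintegral_const_mul']; · rw [ind_neg hb.symm, zero_mul]
                                                   · exact (ind_le_one _).trans_lt ENNReal.one_lt_top |>.ne)]
            rw [ind_pos rfl]
            simp only [one_mul]
            have : ∀ x : ℝ, ind (|R * (a.2 - x)| ≤ Real.pi) = (Set.Icc (a.2 - Real.pi / R) (a.2 + Real.pi / R)).indicator 1 x := by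
              intro x
              have : |R * (a.2 - x)| ≤ Real.pi ↔ x ∈ Set.Icc (a.2 - Real.pi / R) (a.2 + Real.pi / R) := by
                rw [abs_mul, abs_of_pos hR, ← le_div_iff₀' hR, abs_le, Set.mem_Icc]
                constructor <;> rintro ⟨h1, h2⟩ <;> constructor <;> linarith
              by_cases h : |R * (a.2 - x)| ≤ Real.pi
              · rw [ind_pos h, Set.indicator_of_mem (this.1 h)]; rfl
              · rw [ind_neg h, Set.indicator_of_notMem (fun h' => h (this.2 h'))]
            simp_rw [this]
            rw [lintegral_indicator_one measurableSet_Icc, Real.volume_Icc, ← ENNReal.ofReal_mul (by positivity)]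
            apply ENNReal.ofReal_le_ofReal
            apply le_of_eq; field_simp; ring
          · apply Measurable.aemeasurable
            apply Measurable.mul
            · exact measurable_ind (measurableSet_eq_fun (by fun_prop) (by fun_prop))
            · exact measurable_ind (measurableSet_le (by fun_prop) (by fun_prop))
        · apply Measurable.mul
          · exact measurable_ind (measurableSet_eq_fun (by fun_prop) (by fun_prop))
          · exact measurable_ind (measurableSet_le (by fun_prop) (by fun_prop)))
    have hfm : Measurable (fun p : ℝ × (Fin n → ℝ) => ‖∫ s, H s * U p s ∂(kap n)‖ₑ ^ 2) := by
      have hme : ∃ H' : (Fin n → ℤ) × ℝ → ℂ, StronglyMeasurable H' ∧ H =ᵐ[kap n] H' := hH.1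
      obtain ⟨H', h1, h2⟩ := hme
      have : ∀ p, ∫ s, H s * U p s ∂(kap n) = ∫ s, H' s * U p s ∂(kap n) := by
        intro p
        apply integral_congr_ae
        filter_upwards [h2] with s hs
        rw [hs]
      simp_rw [this]
      apply Measurable.pow_const
      apply Measurable.enorm
      have h3 : StronglyMeasurable (Function.uncurry fun (p : ℝ × (Fin n → ℝ)) (s : (Fin n → ℤ) × ℝ) => H' s * U p s) :=
        ((h1.measurable.comp measurable_snd).mul hUm).stronglyMeasurable
      exact (StronglyMeasurable.integral_prod_right (ν := kap n) h3).measurable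
    have hlow : ∫⁻ x in Set.Icc (-(R/2)) (R/2), ∫⁻ y in torusBox lam n, ‖∫ s, H s * U (x, y) s ∂(kap n)‖ₑ ^ 2
        ≤ ENNReal.ofReal c⁻¹ * ∫⁻ p, ENNReal.ofReal (W p) * ‖∫ s, H s * U p s ∂(kap n)‖ₑ ^ 2 ∂ν := by
      have hWm : Measurable (fun p => ENNReal.ofReal (W p)) := by
        apply ENNReal.measurable_ofReal.comp
        exact wc.measurable.comp (by fun_prop)
      have hpm : AEMeasurable (fun p => ENNReal.ofReal (W p) * ‖∫ s, H s * U p s ∂(kap n)‖ₑ ^ 2)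
          ((volume : Measure ℝ).prod ((volume : Measure (Fin n → ℝ)).restrict (torusBox lam n))) := (hWm.mul hfm).aemeasurable
      rw [hν, lintegral_prod _ hpm, ← lintegral_const_mul' _ _ ENNReal.ofReal_ne_top]
      refine le_trans ?_ (setLIntegral_le_lintegral (Set.Icc (-(R/2)) (R/2)) _)
      refine setLIntegral_mono' measurableSet_Icc fun x hx => ?_
      simp only [hW]
      rw [lintegral_const_mul' _ _ ENNReal.ofReal_ne_top, ← mul_assoc, ← ENNReal.ofReal_mul (by positivity)]
      refine le_mul_of_one_le_left zero_le ?_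
      rw [ENNReal.one_le_ofReal, ← div_eq_inv_mul, le_div_iff₀ c0, one_mul]
      apply hc
      rw [abs_div, abs_of_pos hR, div_le_iff₀ hR]
      rw [abs_le]; constructor <;> linarith [hx.1, hx.2]
    refine hlow.trans ((mul_le_mul_right (hT.trans hS) _).trans (le_of_eq ?_))
    rw [← mul_assoc]
    congr 1
    rw [show (2:ℝ≥0∞) = ENNReal.ofReal 2 by simp, ← ENNReal.ofReal_mul (by norm_num), ← ENNReal.ofReal_mul (by positivity)]
    congr 1
    rw [mul_pow]; ring
  have hcov : (⋃ k : ℕ, Set.Icc (-(((k:ℝ) + 1)/2)) (((k:ℝ) + 1)/2)) = Set.univ := by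
    rw [Set.eq_univ_iff_forall]
    intro x
    obtain ⟨k, hk⟩ := exists_nat_ge (2 * |x|)
    rw [Set.mem_iUnion]
    refine ⟨k, ?_⟩
    rw [Set.mem_Icc, ← abs_le]; linarith
  have hmono : Directed (· ⊆ ·) (fun k : ℕ => Set.Icc (-(((k:ℝ) + 1)/2)) (((k:ℝ) + 1)/2)) := by
    apply directed_of_isDirected_le
    intro a b hab
    have : (a:ℝ) ≤ b := by exact_mod_cast hab
    apply Set.Icc_subset_Icc <;> linarith
  rw [← setLIntegral_univ, ← hcov, setLIntegral_iUnion_of_directed _ hmono]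
  apply iSup_le
  intro k
  exact main _ (by positivity)

-- part N
open MeasureTheory
open scoped ENNReal NNReal

noncomputable def ph {n : ℕ} (lam t x : ℝ) (y : Fin n → ℝ) (k : (Fin n → ℤ) × ℝ) : ℂ :=
  Complex.exp (Complex.I * (((x * k.2 + ∑ i, y i * ((k.1 i : ℝ) / lam)) - t * (k.2 ^ 2 + ∑ i, ((k.1 i : ℝ) / lam) ^ 2) : ℝ) : ℂ))

noncomputable def wv {n : ℕ} (lam : ℝ) (G : (Fin n → ℤ) × ℝ → ℂ) (t x : ℝ) (y : Fin n → ℝ) : ℂ :=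
  ∫ k, G k * ph lam t x y k ∂(kap n)

noncomputable def mm {n : ℕ} (G1 G2 : (Fin n → ℤ) × ℝ → ℂ) (s k : (Fin n → ℤ) × ℝ) : ℂ :=
  G1 (k.1, s.2 / 2 + k.2) * G2 (s.1 - k.1, s.2 / 2 - k.2)

noncomputable def eng {n : ℕ} (lam t : ℝ) (s k : (Fin n → ℤ) × ℝ) : ℂ :=
  Complex.exp (-(Complex.I * ((t * (2 * k.2 ^ 2 + en lam s.1 k.1) : ℝ) : ℂ)))

noncomputable def HH {n : ℕ} (lam : ℝ) (G1 G2 : (Fin n → ℤ) × ℝ → ℂ) (A : Set ℝ) (t : ℝ) (s : (Fin n → ℤ) × ℝ) : ℂ :=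
  ∫ k, (Set.indicator {k : (Fin n → ℤ) × ℝ | k.2 ∈ A} (mm G1 G2 s) k) * eng lam t s k ∂(kap n)

lemma norm_ph {n : ℕ} (lam t x : ℝ) (y : Fin n → ℝ) (k : (Fin n → ℤ) × ℝ) : ‖ph lam t x y k‖ ≤ 1 := by
  unfold ph; rw [mul_comm, Complex.norm_exp_ofReal_mul_I]

lemma norm_eng {n : ℕ} (lam t : ℝ) (s k : (Fin n → ℤ) × ℝ) : ‖eng lam t s k‖ ≤ 1 := by
  unfold eng; rw [mul_comm, ← neg_mul, ← Complex.ofReal_neg, Complex.norm_exp_ofReal_mul_I]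

lemma meas_cast {β : Type*} [MeasurableSpace β] {f : β → ℤ} (hf : Measurable f) : Measurable (fun b => ((f b : ℤ) : ℝ)) :=
  (measurable_from_top (f := fun z : ℤ => (z:ℝ))).comp hf

lemma meas_ph {n : ℕ} (lam t x : ℝ) (y : Fin n → ℝ) : Measurable (ph lam t x y) := by
  unfold ph
  have hz : ∀ i : Fin n, Measurable (fun q : (Fin n → ℤ) × ℝ => ((q.1 i : ℤ) : ℝ)) := fun i => meas_cast (by fun_prop)
  fun_prop

lemma meas_eng {n : ℕ} (lam : ℝ) : Measurable (fun q : (ℝ × ((Fin n → ℤ) × ℝ)) × ((Fin n → ℤ) × ℝ) => eng lam q.1.1 q.1.2 q.2) := by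
  unfold eng en
  have hz : ∀ i : Fin n, Measurable (fun q : (ℝ × ((Fin n → ℤ) × ℝ)) × ((Fin n → ℤ) × ℝ) => ((q.1.2.1 i : ℤ) : ℝ)) := fun i => meas_cast (by fun_prop)
  have hz' : ∀ i : Fin n, Measurable (fun q : (ℝ × ((Fin n → ℤ) × ℝ)) × ((Fin n → ℤ) × ℝ) => ((q.2.1 i : ℤ) : ℝ)) := fun i => meas_cast (by fun_prop)
  fun_prop

lemma ph_mul {n : ℕ} (lam t x : ℝ) (y : Fin n → ℝ) (s k : (Fin n → ℤ) × ℝ) :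
    ph lam t x y (k.1, s.2 / 2 + k.2) * ph lam t x y (s.1 - k.1, s.2 / 2 - k.2) =
      Complex.exp (-(Complex.I * ((t * s.2 ^ 2 / 2 : ℝ) : ℂ))) *
      Complex.exp (Complex.I * ((x * s.2 + ∑ i, y i * ((s.1 i : ℝ) / lam) : ℝ) : ℂ)) * eng lam t s k := by
  unfold ph eng en
  rw [← Complex.exp_add, ← Complex.exp_add, ← Complex.exp_add]
  congr 1
  simp only [Pi.sub_apply]
  have e1 : ∑ i, y i * (((s.1 i - k.1 i : ℤ) : ℝ) / lam) = ∑ i, y i * ((s.1 i : ℝ) / lam) - ∑ i, y i * ((k.1 i : ℝ) / lam) := by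
    rw [← Finset.sum_sub_distrib]
    refine Finset.sum_congr rfl fun i _ => ?_
    push_cast; ring
  have e2 : ∑ i, (((s.1 i - k.1 i : ℤ) : ℝ) / lam)^2 = (∑ i, ((s.1 i : ℝ) - k.1 i)^2) / lam^2 := by
    rw [Finset.sum_div]
    refine Finset.sum_congr rfl fun i _ => ?_
    push_cast; ring
  have e3 : ∑ i, ((k.1 i : ℝ) / lam)^2 = (∑ i, (k.1 i : ℝ)^2) / lam^2 := by
    rw [Finset.sum_div]
    refine Finset.sum_congr rfl fun i _ => ?_
    ring
  rw [e1, e2, e3]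
  rw [← mul_add, ← Complex.ofReal_add, ← mul_neg, ← mul_neg, ← Complex.ofReal_neg, ← Complex.ofReal_neg, ← mul_add, ← mul_add, ← Complex.ofReal_add, ← Complex.ofReal_add]
  congr 2
  ring

lemma prod_formula {n : ℕ} (lam : ℝ) (G1 G2 : (Fin n → ℤ) × ℝ → ℂ) (h1 : Integrable G1 (kap n)) (h2 : Integrable G2 (kap n))
    (t : ℝ) :
    Integrable (fun s => Complex.exp (-(Complex.I * ((t * s.2 ^ 2 / 2 : ℝ) : ℂ))) * HH lam G1 G2 Set.univ t s) (kap n) ∧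
    ∀ x y, wv lam G1 t x y * wv lam G2 t x y = 
      ∫ s, (Complex.exp (-(Complex.I * ((t * s.2 ^ 2 / 2 : ℝ) : ℂ))) * HH lam G1 G2 Set.univ t s) *
        Complex.exp (Complex.I * ((x * s.2 + ∑ i, y i * ((s.1 i : ℝ) / lam) : ℝ) : ℂ)) ∂(kap n) := by
  have hi : ∀ G : (Fin n → ℤ) × ℝ → ℂ, Integrable G (kap n) → ∀ x y, Integrable (fun k => G k * ph lam t x y k) (kap n) := by
    intro G hG x y
    exact hG.mul_bdd (c := 1) (meas_ph lam t x y).aestronglyMeasurable (Filter.Eventually.of_forall (norm_ph lam t x y))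
  have hc : ∀ x y s, convolution (fun k => G1 k * ph lam t x y k) (fun k => G2 k * ph lam t x y k) (ContinuousLinearMap.mul ℂ ℂ) (kap n) s
      = (Complex.exp (-(Complex.I * ((t * s.2 ^ 2 / 2 : ℝ) : ℂ))) * HH lam G1 G2 Set.univ t s) *
        Complex.exp (Complex.I * ((x * s.2 + ∑ i, y i * ((s.1 i : ℝ) / lam) : ℝ) : ℂ)) := by
    intro x y s
    rw [convolution_def, ← integral_add_right_eq_self _ ((0, s.2 / 2) : (Fin n → ℤ) × ℝ), mul_right_comm, HH, ← integral_const_mul]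
    congr 1; ext k
    have ea : k + (0, s.2 / 2) = (k.1, s.2 / 2 + k.2) := by
      ext <;> simp [add_comm]
    have eb : s - (k + (0, s.2 / 2)) = (s.1 - k.1, s.2 / 2 - k.2) := by
      ext
      · simp
      · simp; ring
    rw [eb, ea, ContinuousLinearMap.mul_apply', mul_mul_mul_comm, ph_mul]
    simp [mm]
    ring
  constructor
  · have := (hi G1 h1 0 0).integrable_convolution (ContinuousLinearMap.mul ℂ ℂ) (hi G2 h2 0 0)
    refine this.congr (Filter.Eventually.of_forall fun s => ?_)
    dsimp only
    rw [hc]; simp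
  · intro x y
    have := integral_convolution (ContinuousLinearMap.mul ℂ ℂ) (hi G1 h1 x y) (hi G2 h2 x y)
    rw [ContinuousLinearMap.mul_apply'] at this
    rw [wv, wv, ← this]
    congr 1; ext s
    exact hc x y s

-- part O
open MeasureTheory
open scoped ENNReal NNReal

lemma mm_int {n : ℕ} (G1 G2 : (Fin n → ℤ) × ℝ → ℂ) (h1 : Integrable G1 (kap n)) (h2 : Integrable G2 (kap n)) :
    ∀ᵐ s ∂(kap n), Integrable (mm G1 G2 s) (kap n) := by
  have h := (h1.convolution_integrand (ContinuousLinearMap.mul ℂ ℂ) h2).prod_right_ae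
  filter_upwards [h] with s hs
  have := hs.comp_add_right ((0, s.2 / 2) : (Fin n → ℤ) × ℝ)
  refine this.congr (Filter.Eventually.of_forall fun k => ?_)
  have ea : k + (0, s.2 / 2) = (k.1, s.2 / 2 + k.2) := by
    ext <;> simp [add_comm]
  have eb : s - (k + (0, s.2 / 2)) = (s.1 - k.1, s.2 / 2 - k.2) := by
    ext
    · simp
    · simp; ring
  simp only [eb, ContinuousLinearMap.mul_apply', mm]
  rw [ea]

lemma meas_mm {n : ℕ} {G1 G2 : (Fin n → ℤ) × ℝ → ℂ} (h1 : Measurable G1) (h2 : Measurable G2) :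
    Measurable (fun q : ((Fin n → ℤ) × ℝ) × ((Fin n → ℤ) × ℝ) => mm G1 G2 q.1 q.2) := by
  unfold mm
  apply Measurable.mul
  · exact h1.comp (by fun_prop)
  · apply h2.comp
    exact ((measurable_fst.comp measurable_fst).sub (measurable_fst.comp measurable_snd)).prodMk (by fun_prop)

lemma meas_HH {n : ℕ} (lam : ℝ) {G1 G2 : (Fin n → ℤ) × ℝ → ℂ} (h1 : Measurable G1) (h2 : Measurable G2) {A : Set ℝ} (hA : MeasurableSet A) :
    Measurable (fun q : ℝ × ((Fin n → ℤ) × ℝ) => HH lam G1 G2 A q.1 q.2) := by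
  unfold HH
  have : Measurable (Function.uncurry fun (q : ℝ × ((Fin n → ℤ) × ℝ)) (k : (Fin n → ℤ) × ℝ) =>
      (Set.indicator {k : (Fin n → ℤ) × ℝ | k.2 ∈ A} (mm G1 G2 q.2) k) * eng lam q.1 q.2 k) := by
    apply Measurable.mul _ (meas_eng lam)
    have e : (fun a : (ℝ × ((Fin n → ℤ) × ℝ)) × ((Fin n → ℤ) × ℝ) => Set.indicator {k : (Fin n → ℤ) × ℝ | k.2 ∈ A} (mm G1 G2 a.1.2) a.2)
        = Set.indicator {a : (ℝ × ((Fin n → ℤ) × ℝ)) × ((Fin n → ℤ) × ℝ) | a.2.2 ∈ A} (fun a => mm G1 G2 a.1.2 a.2) := by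
      ext a; rfl
    rw [e]
    apply Measurable.indicator
    · exact (meas_mm h1 h2).comp (by fun_prop : Measurable (fun a : (ℝ × ((Fin n → ℤ) × ℝ)) × ((Fin n → ℤ) × ℝ) => (a.1.2, a.2)))
    · exact (by fun_prop : Measurable (fun a : (ℝ × ((Fin n → ℤ) × ℝ)) × ((Fin n → ℤ) × ℝ) => a.2.2)) hA
  exact (StronglyMeasurable.integral_prod_right (ν := kap n) this.stronglyMeasurable).measurable

lemma time_piece {n : ℕ} (lam : ℝ) (G1 G2 : (Fin n → ℤ) × ℝ → ℂ) (m1 : Measurable G1) (m2 : Measurable G2)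
    (h1 : Integrable G1 (kap n)) (h2 : Integrable G2 (kap n)) (A : Set ℝ) (hA : MeasurableSet A)
    (W : ℝ → ℝ) (hW : Integrable W) (hW0 : ∀ t, 0 ≤ W t) (Ψ : ℝ → ℝ≥0∞) (hΨm : Measurable Ψ)
    (hΨ : ∀ E : ℝ, ‖∫ t : ℝ, (W t : ℂ) * Complex.exp (-(Complex.I * ((t * E : ℝ) : ℂ)))‖ₑ ≤ Ψ E) :
    ∫⁻ s, (∫⁻ t : ℝ, ENNReal.ofReal (W t) * ‖HH lam G1 G2 A t s‖ₑ ^ 2) ∂(kap n) ≤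
      ZZ lam (fun η => η ∈ A) (fun j x => ‖G1 (j, x)‖ₑ) (fun j x => ‖G2 (j, x)‖ₑ) Ψ := by
  set F1 : (Fin n → ℤ) → ℝ → ℝ≥0∞ := fun j x => ‖G1 (j, x)‖ₑ with hF1
  set F2 : (Fin n → ℤ) → ℝ → ℝ≥0∞ := fun j x => ‖G2 (j, x)‖ₑ with hF2
  have hz : ∀ (σ : Fin n → ℤ), Measurable (fun k : (Fin n → ℤ) × ℝ => 2 * k.2 ^ 2 + en lam σ k.1) := by
    intro σ
    unfold en
    have hz : ∀ i : Fin n, Measurable (fun q : (Fin n → ℤ) × ℝ => ((q.1 i : ℤ) : ℝ)) := fun i => meas_cast (by fun_prop)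
    fun_prop
  have key : ∀ᵐ s ∂(kap n), ∫⁻ t, ENNReal.ofReal (W t) * ‖HH lam G1 G2 A t s‖ₑ ^ 2 ≤
      ∑' j : Fin n → ℤ, ∑' j' : Fin n → ℤ, ∫⁻ η : ℝ, ∫⁻ η' : ℝ,
    amp (fun η => η ∈ A) F1 F2 s.1 j s.2 η * amp (fun η => η ∈ A) F1 F2 s.1 j' s.2 η' * Ψ (2 * η ^ 2 - 2 * η' ^ 2 + (en lam s.1 j - en lam s.1 j')) := by
    filter_upwards [mm_int G1 G2 h1 h2] with s hs
    have hAm : MeasurableSet {k : (Fin n → ℤ) × ℝ | k.2 ∈ A} := measurable_snd hA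
    have hI : Integrable (Set.indicator {k : (Fin n → ℤ) × ℝ | k.2 ∈ A} (mm G1 G2 s)) (kap n) := hs.indicator hAm
    let Ψ' : (Fin n → ℤ) × ℝ → (Fin n → ℤ) × ℝ → ℝ≥0∞ := fun k k' =>
      Ψ (2 * k.2 ^ 2 - 2 * k'.2 ^ 2 + (en lam s.1 k.1 - en lam s.1 k'.1))
    have hPm : Measurable (fun p : ((Fin n → ℤ) × ℝ) × ((Fin n → ℤ) × ℝ) => Ψ' p.1 p.2) := by
      apply hΨm.comp
      have a := (hz s.1).comp (by fun_prop : Measurable (fun p : ((Fin n → ℤ) × ℝ) × ((Fin n → ℤ) × ℝ) => p.1))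
      have b := (hz s.1).comp (by fun_prop : Measurable (fun p : ((Fin n → ℤ) × ℝ) × ((Fin n → ℤ) × ℝ) => p.2))
      convert a.sub b using 1
      ext p; simp; ring
    have hT := TT volume (kap n) W hW hW0 (fun t k => eng lam t s k)
      ((meas_eng lam).comp (by fun_prop : Measurable (fun p : ℝ × ((Fin n → ℤ) × ℝ) => ((p.1, s), p.2))))
      (fun t k => norm_eng lam t s k) _ hI Ψ' hPm (by
        intro k k'
        refine le_trans (le_of_eq ?_) (hΨ _)
        congr 2; ext t
        unfold eng
        rw [← Complex.exp_conj, ← Complex.exp_add]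
        congr 2
        rw [map_neg, map_mul, Complex.conj_I, Complex.conj_ofReal]
        push_cast; ring)
    refine hT.trans (le_of_eq ?_)
    have en1 : ∀ k, ‖Set.indicator {k : (Fin n → ℤ) × ℝ | k.2 ∈ A} (mm G1 G2 s) k‖ₑ = amp (fun η => η ∈ A) F1 F2 s.1 k.1 s.2 k.2 := by
      intro k
      unfold amp
      by_cases hk : k.2 ∈ A
      · rw [ind_pos hk, Set.indicator_of_mem (by exact hk), mm, enorm_mul, one_mul]
      · rw [ind_neg hk, Set.indicator_of_notMem (by exact hk)]; simp
    simp_rw [en1]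
    have F1m : ∀ j, Measurable (F1 j) := fun j => (m1.comp measurable_prodMk_left).enorm
    have F2m : ∀ j, Measurable (F2 j) := fun j => (m2.comp measurable_prodMk_left).enorm
    have hamp : Measurable (fun k : (Fin n → ℤ) × ℝ => amp (fun η => η ∈ A) F1 F2 s.1 k.1 s.2 k.2) := by
      simp_rw [← en1]
      apply Measurable.enorm
      exact ((meas_mm m1 m2).comp measurable_prodMk_left).indicator hAm
    have hall : Measurable (fun p : ((Fin n → ℤ) × ℝ) × ((Fin n → ℤ) × ℝ) =>
        amp (fun η => η ∈ A) F1 F2 s.1 p.1.1 s.2 p.1.2 * amp (fun η => η ∈ A) F1 F2 s.1 p.2.1 s.2 p.2.2 * Ψ' p.1 p.2) :=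
      ((hamp.comp measurable_fst).mul (hamp.comp measurable_snd)).mul hPm
    rw [lintegral_kap _ hall.lintegral_prod_right'.aemeasurable]
    refine tsum_congr fun j => ?_
    rw [← lintegral_tsum]
    · refine lintegral_congr fun η => ?_
      exact lintegral_kap (fun y => amp (fun η => η ∈ A) F1 F2 s.1 j s.2 η * amp (fun η => η ∈ A) F1 F2 s.1 y.1 s.2 y.2 * Ψ' (j, η) y)
        (hall.comp (measurable_prodMk_left (x := (j, η)))).aemeasurable
    · intro j'
      apply Measurable.aemeasurable
      have : Measurable (fun p : ℝ × ℝ => (((j, p.1), (j', p.2)) : ((Fin n → ℤ) × ℝ) × ((Fin n → ℤ) × ℝ))) := by fun_prop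
      exact (hall.comp this).lintegral_prod_right'
  refine (lintegral_mono_ae key).trans ((lintegral_prod_le _).trans ?_)
  rw [lintegral_count]
  exact le_rfl

-- part P
open MeasureTheory
open scoped ENNReal NNReal

lemma exp_int_pi (k : ℤ) :
    ∫ u in Set.Icc (-Real.pi) Real.pi, Complex.exp (Complex.I * ((u * (k:ℝ) : ℝ) : ℂ))
      = if k = 0 then ((2 * Real.pi : ℝ) : ℂ) else 0 := by
  have hp : -Real.pi ≤ Real.pi := by linarith [Real.pi_pos]
  rw [integral_Icc_eq_integral_Ioc, ← intervalIntegral.integral_of_le hp]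
  split_ifs with h
  · subst h; simp; ring
  · have hc : Complex.I * (k:ℂ) ≠ 0 := mul_ne_zero Complex.I_ne_zero (by exact_mod_cast h)
    have := integral_exp_mul_complex (a := -Real.pi) (b := Real.pi) hc
    have e : ∀ u : ℝ, Complex.exp (Complex.I * ((u * (k:ℝ) : ℝ) : ℂ)) = Complex.exp (Complex.I * (k:ℂ) * u) := by
      intro u; congr 1; push_cast; ring
    simp_rw [e]
    rw [this]
    have e2 : Complex.I * (k:ℂ) * (Real.pi : ℂ) = Complex.I * (k:ℂ) * ((-Real.pi : ℝ) : ℂ) + k * (2 * Real.pi * Complex.I) := by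
      push_cast; ring
    rw [e2, Complex.exp_add, Complex.exp_int_mul_two_pi_mul_I]
    simp

lemma time_weight : ∃ B : ℝ, 0 < B ∧ ∀ (S : Finset ℤ) (c : ℤ → ℝ), (∀ γ, 0 ≤ c γ) → ∃ (W : ℝ → ℝ) (Ψ : ℝ → ℝ≥0∞),
    Measurable W ∧ Integrable W ∧ (∀ t, 0 ≤ W t) ∧ Measurable Ψ ∧
    (∀ E : ℝ, ‖∫ t : ℝ, (W t : ℂ) * Complex.exp (-(Complex.I * ((t * E : ℝ) : ℂ)))‖ₑ ≤ Ψ E) ∧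
    (∀ s, Ψ s ≠ 0 → |s| ≤ 7) ∧
    (∀ t, ∑ γ ∈ S, ENNReal.ofReal (c γ) * (Set.Icc (γ:ℝ) (γ + 1)).indicator 1 t ≤ ENNReal.ofReal (W t)) ∧
    ∫⁻ s, Ψ s ^ 2 ≤ ENNReal.ofReal (B * ∑ γ ∈ S, c γ ^ 2) := by
  obtain ⟨w, c0, M, wc, wi, w0, c00, hc0, M0, hM, hMz⟩ := exists_weight
  have hpi := Real.pi_pos
  refine ⟨(M / c0) ^ 2 * (2 * Real.pi), by positivity, fun S c hc => ?_⟩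
  let D : ℝ → ℂ := fun E => ∑ γ ∈ S, (c γ : ℂ) * Complex.exp (-(Complex.I * ((E * ((γ:ℝ) + 1/2) : ℝ) : ℂ)))
  let Ψ : ℝ → ℝ≥0∞ := fun E => ENNReal.ofReal (M / c0) * (ind (|E| ≤ Real.pi) * ‖D E‖ₑ)
  have hDm : Measurable D := by
    apply Finset.measurable_sum
    intro γ _
    fun_prop
  have hInt : ∀ γ : ℤ, Integrable (fun t : ℝ => w (t - ((γ:ℝ) + 1/2))) := fun γ => wi.comp_sub_right _
  refine ⟨fun t => ∑ γ ∈ S, c γ / c0 * w (t - ((γ:ℝ) + 1/2)), Ψ, ?_, ?_, ?_, ?_, ?_, ?_, ?_, ?_⟩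
  · apply Finset.measurable_sum
    intro γ _
    exact (wc.measurable.comp (by fun_prop)).const_mul _
  · apply integrable_finsetSum
    intro γ _
    exact (hInt γ).const_mul _
  · intro t
    exact Finset.sum_nonneg fun γ _ => mul_nonneg (div_nonneg (hc γ) c00.le) (w0 _)
  · exact ((measurable_ind (measurableSet_le (by fun_prop) (by fun_prop))).mul hDm.enorm).const_mul _
  · intro E
    have hi : ∀ γ : ℤ, Integrable (fun t : ℝ => ((c γ / c0 * w (t - ((γ:ℝ) + 1/2)) : ℝ) : ℂ) * Complex.exp (-(Complex.I * ((t * E : ℝ) : ℂ)))) := by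
      intro γ
      refine (((hInt γ).const_mul (c γ / c0)).ofReal (𝕜 := ℂ)).mul_bdd (c := 1) (by fun_prop) (Filter.Eventually.of_forall fun t => ?_)
      rw [mul_comm, ← neg_mul, ← Complex.ofReal_neg, Complex.norm_exp_ofReal_mul_I]
    have e1 : ∀ γ : ℤ, ∫ t : ℝ, ((c γ / c0 * w (t - ((γ:ℝ) + 1/2)) : ℝ) : ℂ) * Complex.exp (-(Complex.I * ((t * E : ℝ) : ℂ)))
        = (c γ : ℂ) * Complex.exp (-(Complex.I * ((E * ((γ:ℝ) + 1/2) : ℝ) : ℂ))) * ((c0 : ℂ)⁻¹ * ∫ t : ℝ, (w t : ℂ) * Complex.exp (-(Complex.I * ((t * E : ℝ) : ℂ)))) := by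
      intro γ
      rw [← integral_add_right_eq_self _ ((γ:ℝ) + 1/2), ← mul_assoc, ← integral_const_mul]
      congr 1; ext t
      rw [add_sub_cancel_right]
      have : -(Complex.I * (((t + ((γ:ℝ) + 1/2)) * E : ℝ) : ℂ)) = -(Complex.I * ((E * ((γ:ℝ) + 1/2) : ℝ) : ℂ)) + -(Complex.I * ((t * E : ℝ) : ℂ)) := by
        push_cast; ring
      rw [this, Complex.exp_add]
      push_cast; ring
    have e2 : ∫ t : ℝ, ((∑ γ ∈ S, c γ / c0 * w (t - ((γ:ℝ) + 1/2)) : ℝ) : ℂ) * Complex.exp (-(Complex.I * ((t * E : ℝ) : ℂ)))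
        = D E * ((c0 : ℂ)⁻¹ * ∫ t : ℝ, (w t : ℂ) * Complex.exp (-(Complex.I * ((t * E : ℝ) : ℂ)))) := by
      simp_rw [Complex.ofReal_sum, Finset.sum_mul]
      rw [integral_finsetSum _ (fun γ _ => hi γ)]
      simp_rw [e1]
      rw [← Finset.sum_mul]
    rw [e2]
    simp only [Ψ]
    by_cases hE : |E| ≤ Real.pi
    · rw [ind_pos hE, one_mul, enorm_mul, mul_comm]
      gcongr
      rw [← ofReal_norm]
      apply ENNReal.ofReal_le_ofReal
      rw [norm_mul, norm_inv, Complex.norm_real, Real.norm_eq_abs, abs_of_pos c00, div_eq_inv_mul]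
      gcongr
      exact hM E
    · rw [hMz E (not_le.1 hE)]; simp
  · intro s hs
    by_contra h
    apply hs
    simp only [Ψ]
    rw [ind_neg (fun h' => h (h'.trans (by linarith [Real.pi_lt_four])))]
    simp
  · intro t
    rw [ENNReal.ofReal_sum_of_nonneg (fun γ _ => mul_nonneg (div_nonneg (hc γ) c00.le) (w0 _))]
    refine Finset.sum_le_sum fun γ _ => ?_
    by_cases ht : t ∈ Set.Icc (γ:ℝ) (γ + 1)
    · rw [Set.indicator_of_mem ht, Pi.one_apply, mul_one]
      apply ENNReal.ofReal_le_ofReal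
      rw [div_mul_eq_mul_div, le_div_iff₀ c00]
      apply mul_le_mul_of_nonneg_left _ (hc γ)
      apply hc0
      rw [abs_le]; constructor <;> linarith [ht.1, ht.2]
    · rw [Set.indicator_of_notMem ht]; simp
  · have hT := TT ((volume : Measure ℝ).restrict (Set.Icc (-Real.pi) Real.pi)) (Measure.count : Measure S) (fun _ => 1)
      (integrable_const 1) (fun _ => zero_le_one)
      (fun E γ => Complex.exp (-(Complex.I * ((E * (((γ:ℤ):ℝ) + 1/2) : ℝ) : ℂ))))
      (by
        have : Measurable (fun p : ℝ × S => (((p.2 : ℤ)) : ℝ)) := meas_cast ((measurable_of_countable _).comp measurable_snd)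
        fun_prop)
      (fun E γ => by rw [mul_comm, ← neg_mul, ← Complex.ofReal_neg, Complex.norm_exp_ofReal_mul_I])
      (fun γ => (c γ : ℂ)) (Integrable.of_finite) (fun γ γ' => ind (γ = γ') * ENNReal.ofReal (2 * Real.pi))
      (measurable_of_countable _)
      (by
        intro γ γ'
        have : ∀ E : ℝ, (((1:ℝ) : ℂ)) * (Complex.exp (-(Complex.I * ((E * (((γ:ℤ):ℝ) + 1/2) : ℝ) : ℂ))) * (starRingEnd ℂ) (Complex.exp (-(Complex.I * ((E * (((γ':ℤ):ℝ) + 1/2) : ℝ) : ℂ)))))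
            = Complex.exp (Complex.I * ((E * ((((γ':ℤ) - (γ:ℤ) : ℤ)):ℝ) : ℝ) : ℂ)) := by
          intro E
          rw [← Complex.exp_conj, ← Complex.exp_add, Complex.ofReal_one, one_mul, map_neg, map_mul, Complex.conj_I, Complex.conj_ofReal]
          congr 1; push_cast; ring
        simp_rw [this]
        rw [exp_int_pi]
        by_cases h : γ = γ'
        · rw [ind_pos h, if_pos (by rw [h, sub_self]), one_mul, ← ofReal_norm, Complex.norm_real, Real.norm_eq_abs, abs_of_pos (by positivity)]
        · rw [if_neg]
          · simp
          · intro h'; apply h; ext; omega)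
    simp only [ENNReal.ofReal_one, one_mul, integral_count, lintegral_count, tsum_fintype] at hT
    have hD : ∀ E, ∑ γ : S, (c γ : ℂ) * Complex.exp (-(Complex.I * ((E * (((γ:ℤ):ℝ) + 1/2) : ℝ) : ℂ))) = D E := fun E =>
      Finset.sum_coe_sort S (fun γ : ℤ => (c γ : ℂ) * Complex.exp (-(Complex.I * ((E * ((γ:ℝ) + 1/2) : ℝ) : ℂ))))
    simp_rw [hD] at hT
    have hR : ∑ γ : S, ∑ γ' : S, ‖(c γ : ℂ)‖ₑ * ‖(c γ' : ℂ)‖ₑ * (ind (γ = γ') * ENNReal.ofReal (2 * Real.pi))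
        = ENNReal.ofReal (2 * Real.pi * ∑ γ ∈ S, c γ ^ 2) := by
      have : ∀ γ : S, ∑ γ' : S, ‖(c γ : ℂ)‖ₑ * ‖(c γ' : ℂ)‖ₑ * (ind (γ = γ') * ENNReal.ofReal (2 * Real.pi)) = ENNReal.ofReal (2 * Real.pi * c γ ^ 2) := by
        intro γ
        rw [Finset.sum_eq_single γ]
        · rw [ind_pos rfl, ← ofReal_norm, Complex.norm_real, Real.norm_eq_abs, abs_of_nonneg (hc γ), one_mul, ← ENNReal.ofReal_mul (hc γ), ← ENNReal.ofReal_mul (mul_nonneg (hc γ) (hc γ))]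
          congr 1; ring
        · intro b _ hb
          rw [ind_neg hb.symm]; simp
        · simp
      simp_rw [this]
      rw [← ENNReal.ofReal_sum_of_nonneg (fun γ _ => by positivity), ← Finset.mul_sum, Finset.sum_coe_sort S (fun γ => c γ ^ 2)]
    rw [hR] at hT
    have e : ∀ s, Ψ s ^ 2 = ENNReal.ofReal ((M / c0) ^ 2) * (Set.Icc (-Real.pi) Real.pi).indicator (fun s => ‖D s‖ₑ ^ 2) s := by
      intro s
      simp only [Ψ]
      rw [mul_pow, mul_pow, ind_sq, ENNReal.ofReal_pow (by positivity)]
      congr 1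
      by_cases h : |s| ≤ Real.pi
      · rw [ind_pos h, Set.indicator_of_mem (by exact abs_le.1 h), one_mul]
      · rw [ind_neg h, Set.indicator_of_notMem (by intro h'; exact h (abs_le.2 h')), zero_mul]
    simp_rw [e]
    rw [lintegral_const_mul' _ _ ENNReal.ofReal_ne_top, lintegral_indicator measurableSet_Icc]
    refine (mul_le_mul_right hT _).trans (le_of_eq ?_)
    rw [← ENNReal.ofReal_mul (by positivity)]
    congr 1; ring

-- part Q0
open MeasureTheory
open scoped ENNReal NNReal

def pcs (b : ℕ) : ℕ → Set ℝ := fun i =>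
  if i < b + 5 then (match i with
    | 0 => {x : ℝ | |x| ≤ 1}
    | (k + 1) => {x : ℝ | (2:ℝ) ^ k < |x| ∧ |x| ≤ 2 ^ (k + 1)})
  else {x : ℝ | 16 * (2:ℝ) ^ b < |x|}

lemma pcs_zero (b : ℕ) : pcs b 0 = {x : ℝ | |x| ≤ 1} := by simp [pcs]
lemma pcs_succ (b k : ℕ) (h : k + 1 < b + 5) : pcs b (k + 1) = {x : ℝ | (2:ℝ) ^ k < |x| ∧ |x| ≤ 2 ^ (k + 1)} := by
  simp only [pcs, if_pos h]
lemma pcs_far (b : ℕ) : pcs b (b + 5) = {x : ℝ | 16 * (2:ℝ) ^ b < |x|} := by simp [pcs]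

lemma pcs_meas (b i : ℕ) (h : i < b + 6) : MeasurableSet (pcs b i) := by
  rcases Nat.lt_succ_iff_lt_or_eq.1 h with h | h
  · rcases i with _ | k
    · rw [pcs_zero]; exact measurableSet_le (by fun_prop) (by fun_prop)
    · rw [pcs_succ b k h]
      have h1 : MeasurableSet {x : ℝ | (2:ℝ) ^ k < |x|} := measurableSet_lt (by fun_prop) (by fun_prop)
      have h2 : MeasurableSet {x : ℝ | |x| ≤ 2 ^ (k + 1)} := measurableSet_le (by fun_prop) (by fun_prop)
      exact h1.inter h2
  · subst h; rw [pcs_far]; exact measurableSet_lt (by fun_prop) (by fun_prop)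

lemma pcs_sum (b : ℕ) (z : ℂ) (x : ℝ) : ∑ i ∈ Finset.range (b + 6), (pcs b i).indicator (fun _ => z) x = z := by
  have h : ∀ k : ℕ, k < b + 5 → ∑ i ∈ Finset.range (k + 1), (pcs b i).indicator (fun _ => z) x = {x : ℝ | |x| ≤ 2 ^ k}.indicator (fun _ => z) x := by
    intro k
    induction k with
    | zero => intro _; simp [pcs_zero]
    | succ k ih =>
      intro hk
      rw [Finset.sum_range_succ, ih (by omega), pcs_succ b k hk]
      have h2 : (2:ℝ) ^ k ≤ 2 ^ (k + 1) := pow_le_pow_right₀ (by norm_num) (by omega)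
      by_cases h1 : |x| ≤ 2 ^ k
      · rw [Set.indicator_of_mem (by exact h1), Set.indicator_of_notMem (by rintro ⟨h, _⟩; linarith), Set.indicator_of_mem (by exact h1.trans h2), add_zero]
      · rw [Set.indicator_of_notMem (by exact h1), zero_add]
        by_cases h3 : |x| ≤ 2 ^ (k + 1)
        · rw [Set.indicator_of_mem (by exact ⟨not_le.1 h1, h3⟩), Set.indicator_of_mem (by exact h3)]
        · rw [Set.indicator_of_notMem (by rintro ⟨_, h⟩; exact h3 h), Set.indicator_of_notMem (by exact h3)]
  rw [Finset.sum_range_succ, h (b + 4) (by omega), pcs_far]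
  have e : (2:ℝ) ^ (b + 4) = 16 * 2 ^ b := by rw [pow_add]; ring
  rw [e]
  by_cases h1 : |x| ≤ 16 * 2 ^ b
  · rw [Set.indicator_of_mem (by exact h1), Set.indicator_of_notMem (by exact not_lt.2 h1), add_zero]
  · rw [Set.indicator_of_notMem (by exact h1), Set.indicator_of_mem (by exact not_le.1 h1), zero_add]

lemma HH_split {n : ℕ} (lam : ℝ) (G1 G2 : (Fin n → ℤ) × ℝ → ℂ) (b : ℕ) (t : ℝ) (s : (Fin n → ℤ) × ℝ)
    (hs : Integrable (mm G1 G2 s) (kap n)) :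
    HH lam G1 G2 Set.univ t s = ∑ i ∈ Finset.range (b + 6), HH lam G1 G2 (pcs b i) t s := by
  unfold HH
  rw [← integral_finsetSum]
  · congr 1; ext k
    rw [← Finset.sum_mul]
    congr 1
    have := pcs_sum b (mm G1 G2 s k) k.2
    simp only [Set.mem_univ, Set.ofPred_true, Set.indicator_univ]
    exact this.symm
  · intro i hi
    have hm : MeasurableSet {k : (Fin n → ℤ) × ℝ | k.2 ∈ pcs b i} := measurable_snd (pcs_meas b i (Finset.mem_range.1 hi))
    refine (hs.indicator hm).mul_bdd (c := 1) ?_ (Filter.Eventually.of_forall (norm_eng lam t s))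
    exact ((meas_eng lam).comp (measurable_prodMk_left (x := (t, s)))).aestronglyMeasurable

lemma sq_sum_enorm (m : ℕ) (f : ℕ → ℂ) : ‖∑ i ∈ Finset.range m, f i‖ₑ ^ 2 ≤ (m : ℝ≥0∞) * ∑ i ∈ Finset.range m, ‖f i‖ₑ ^ 2 := by
  have h : ‖∑ i ∈ Finset.range m, f i‖ ^ 2 ≤ (m : ℝ) * ∑ i ∈ Finset.range m, ‖f i‖ ^ 2 := by
    have h1 := pow_le_pow_left₀ (norm_nonneg _) (norm_sum_le (Finset.range m) f) 2
    have h2 := sq_sum_le_card_mul_sum_sq (s := Finset.range m) (f := fun i => ‖f i‖)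
    rw [Finset.card_range] at h2
    exact h1.trans h2
  have := ENNReal.ofReal_le_ofReal h
  rw [ENNReal.ofReal_mul (by positivity), ENNReal.ofReal_sum_of_nonneg (fun i _ => by positivity), ENNReal.ofReal_natCast] at this
  simpa only [ENNReal.ofReal_pow (norm_nonneg _), ofReal_norm] using this

lemma ZZ_all (n : ℕ) (hn : 1 ≤ n) : ∃ C : ℝ, 0 < C ∧ ∀ (lam N1 : ℝ) (b i : ℕ), i < b + 6 → 1 ≤ lam → (2:ℝ) ^ b ≤ N1 →
    ∀ (F1 F2 : (Fin n → ℤ) → ℝ → ℝ≥0∞) (Ψ : ℝ → ℝ≥0∞), (∀ j, Measurable (F1 j)) → (∀ j, Measurable (F2 j)) → Measurable Ψ →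
    (∀ s, Ψ s ≠ 0 → |s| ≤ 7) →
    (∀ j ζ, F1 j ζ ≠ 0 → ζ ^ 2 + ∑ i, ((j i : ℝ) / lam) ^ 2 ≤ (2 * N1) ^ 2 ∧ (1 < N1 → (N1 / 2) ^ 2 ≤ ζ ^ 2 + ∑ i, ((j i : ℝ) / lam) ^ 2)) →
    (∀ j ζ, F2 j ζ ≠ 0 → ζ ^ 2 + ∑ i, ((j i : ℝ) / lam) ^ 2 ≤ (2 * (2:ℝ) ^ b) ^ 2) →
    ZZ lam (fun η => η ∈ pcs b i) F1 F2 Ψ ≤ ENNReal.ofReal (C * Kd n lam N1 ((2:ℝ) ^ b)) * (∫⁻ s, Ψ s ^ 2) ^ (1/2:ℝ) *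
      ((∑' j, ∫⁻ x, F1 j x ^ 2) * ∑' j, ∫⁻ x, F2 j x ^ 2) := by
  obtain ⟨C1, C10, h1⟩ := piece_bd n hn
  obtain ⟨C2, C20, h2⟩ := inf_bd n hn
  refine ⟨max C1 C2, lt_max_of_lt_left C10, fun lam N1 b i hi hl h12 F1 F2 Ψ m1 m2 mΨ sΨ s1 s2 => ?_⟩
  have hN2 : (1:ℝ) ≤ 2 ^ b := one_le_pow₀ (by norm_num)
  have hK : 0 ≤ Kd n lam N1 ((2:ℝ) ^ b) := (Kd_pos n hl hN2 h12).le
  have hmeas := pcs_meas b i hi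
  rcases Nat.lt_succ_iff_lt_or_eq.1 hi with h | h
  · have hx : ∃ a : ℝ, 1 ≤ a ∧ a ≤ 16 * 2 ^ b ∧ (∀ x, x ∈ pcs b i → |x| ≤ 2 * a) ∧ (a = 1 ∨ ∀ x, x ∈ pcs b i → a ≤ |x|) := by
      rcases i with _ | k
      · refine ⟨1, le_rfl, by linarith, ?_, Or.inl rfl⟩
        rw [pcs_zero]; intro x hx
        have : |x| ≤ 1 := hx
        linarith
      · refine ⟨2 ^ k, one_le_pow₀ (by norm_num), ?_, ?_, Or.inr ?_⟩
        · have : (2:ℝ) ^ k ≤ 2 ^ (b + 4) := pow_le_pow_right₀ (by norm_num) (by omega)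
          rw [pow_add] at this; linarith
        · rw [pcs_succ b k h]; rintro x ⟨_, hx⟩
          rw [pow_succ] at hx; linarith
        · rw [pcs_succ b k h]; rintro x ⟨hx, _⟩
          exact hx.le
    obtain ⟨a, a1, a2, a3, a4⟩ := hx
    refine (h1 lam N1 (2 ^ b) a hl hN2 h12 a1 a2 (fun η => η ∈ pcs b i) F1 F2 Ψ hmeas m1 m2 mΨ sΨ a3 a4 s1 s2).trans ?_
    gcongr
    exact le_max_left _ _
  · subst h
    have := h2 lam N1 (2 ^ b) hl hN2 h12 F1 F2 Ψ m1 m2 mΨ sΨ s1 s2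
    have e : (fun η : ℝ => η ∈ pcs b (b + 5)) = fun η => 16 * (2:ℝ) ^ b < |η| := by
      rw [pcs_far]; rfl
    rw [e]
    refine this.trans ?_
    gcongr
    exact le_max_right _ _

-- part R
open MeasureTheory
open scoped ENNReal NNReal

/-- spatial `L²` norm squared of the product -/
noncomputable def XX {n : ℕ} (lam : ℝ) (G1 G2 : (Fin n → ℤ) × ℝ → ℂ) (t : ℝ) : ℝ≥0∞ :=
  ∫⁻ x : ℝ, ∫⁻ y in torusBox lam n, ‖wv lam G1 t x y * wv lam G2 t x y‖ₑ ^ 2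

lemma XX_le (n : ℕ) : ∃ C : ℝ, 0 < C ∧ ∀ lam : ℝ, 0 < lam → ∀ G1 G2 : (Fin n → ℤ) × ℝ → ℂ,
    Integrable G1 (kap n) → Integrable G2 (kap n) → ∀ t,
    XX lam G1 G2 t ≤ ENNReal.ofReal (C * lam ^ n) * ∫⁻ s, ‖HH lam G1 G2 Set.univ t s‖ₑ ^ 2 ∂(kap n) := by
  obtain ⟨C, C0, hC⟩ := xy_planch n
  refine ⟨C, C0, fun lam hl G1 G2 h1 h2 t => ?_⟩
  obtain ⟨hi, hf⟩ := prod_formula lam G1 G2 h1 h2 t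
  have := hC lam hl _ hi
  unfold XX
  simp only [hf]
  refine this.trans (le_of_eq ?_)
  congr 1
  refine lintegral_congr fun s => ?_
  rw [enorm_mul]
  have : ‖Complex.exp (-(Complex.I * ((t * s.2 ^ 2 / 2 : ℝ) : ℂ)))‖ₑ = 1 := by
    rw [← ofReal_norm, mul_comm, ← neg_mul, ← Complex.ofReal_neg, Complex.norm_exp_ofReal_mul_I, ENNReal.ofReal_one]
  rw [this, one_mul]

set_option maxHeartbeats 1000000 in
lemma core (n : ℕ) (hn : 1 ≤ n) : ∃ C : ℝ, 0 < C ∧ ∀ (lam N1 : ℝ) (b : ℕ), 1 ≤ lam → (2:ℝ) ^ b ≤ N1 →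
    ∀ (G1 G2 : (Fin n → ℤ) × ℝ → ℂ), Measurable G1 → Measurable G2 → Integrable G1 (kap n) → Integrable G2 (kap n) →
    (∀ j ζ, G1 (j, ζ) ≠ 0 → ζ ^ 2 + ∑ i, ((j i : ℝ) / lam) ^ 2 ≤ (2 * N1) ^ 2 ∧ (1 < N1 → (N1 / 2) ^ 2 ≤ ζ ^ 2 + ∑ i, ((j i : ℝ) / lam) ^ 2)) →
    (∀ j ζ, G2 (j, ζ) ≠ 0 → ζ ^ 2 + ∑ i, ((j i : ℝ) / lam) ^ 2 ≤ (2 * (2:ℝ) ^ b) ^ 2) →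
    ∀ (S : Finset ℤ) (c : ℤ → ℝ), (∀ γ, 0 ≤ c γ) →
    ∑ γ ∈ S, ENNReal.ofReal (c γ) * ∫⁻ t in Set.Icc (γ:ℝ) (γ + 1), XX lam G1 G2 t ≤
      ENNReal.ofReal (C * ((b:ℝ) + 6) ^ 2 * (lam ^ n * Kd n lam N1 ((2:ℝ) ^ b))) * ENNReal.ofReal (∑ γ ∈ S, c γ ^ 2) ^ (1/2:ℝ) *
      ((∑' j, ∫⁻ x, ‖G1 (j, x)‖ₑ ^ 2) * ∑' j, ∫⁻ x, ‖G2 (j, x)‖ₑ ^ 2) := by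
  obtain ⟨C1, C10, hX⟩ := XX_le n
  obtain ⟨C2, C20, hZ⟩ := ZZ_all n hn
  obtain ⟨B, B0, hB⟩ := time_weight
  refine ⟨C1 * C2 * B ^ (1/2:ℝ), by positivity, fun lam N1 b hl h12 G1 G2 m1 m2 i1 i2 s1 s2 S c hc => ?_⟩
  obtain ⟨W, Ψ, Wm, Wi, W0, Ψm, hΨ, Ψs, hW, hΨ2⟩ := hB S c hc
  have hl0 : 0 < lam := by linarith
  have hN2 : (1:ℝ) ≤ 2 ^ b := one_le_pow₀ (by norm_num)
  have hK : 0 ≤ Kd n lam N1 ((2:ℝ) ^ b) := (Kd_pos n hl hN2 h12).le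
  set M : ℝ≥0∞ := (∑' j, ∫⁻ x, ‖G1 (j, x)‖ₑ ^ 2) * ∑' j, ∫⁻ x, ‖G2 (j, x)‖ₑ ^ 2 with hM
  set Y : ℝ → ℝ≥0∞ := fun t => ∫⁻ s, ‖HH lam G1 G2 Set.univ t s‖ₑ ^ 2 ∂(kap n) with hY
  have mH : ∀ A, MeasurableSet A → Measurable (fun q : ℝ × ((Fin n → ℤ) × ℝ) => ‖HH lam G1 G2 A q.1 q.2‖ₑ ^ 2) := fun A hA =>
    (meas_HH lam m1 m2 hA).enorm.pow_const 2
  have mY : Measurable Y := (mH _ MeasurableSet.univ).lintegral_prod_right'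
  have mW : Measurable (fun t => ENNReal.ofReal (W t)) := Wm.ennreal_ofReal
  have step1 : ∑ γ ∈ S, ENNReal.ofReal (c γ) * ∫⁻ t in Set.Icc (γ:ℝ) (γ + 1), XX lam G1 G2 t ≤
      ENNReal.ofReal (C1 * lam ^ n) * ∫⁻ t, ENNReal.ofReal (W t) * Y t := by
    calc _ ≤ ∑ γ ∈ S, ENNReal.ofReal (c γ) * ∫⁻ t in Set.Icc (γ:ℝ) (γ + 1), ENNReal.ofReal (C1 * lam ^ n) * Y t := by
          gcongr with γ hγ t
          exact hX lam hl0 G1 G2 i1 i2 t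
      _ = ENNReal.ofReal (C1 * lam ^ n) * ∑ γ ∈ S, ∫⁻ t, ENNReal.ofReal (c γ) * (Set.Icc (γ:ℝ) (γ + 1)).indicator 1 t * Y t := by
          rw [Finset.mul_sum]
          refine Finset.sum_congr rfl fun γ _ => ?_
          rw [lintegral_const_mul _ mY, mul_left_comm]
          congr 1
          rw [← lintegral_indicator measurableSet_Icc, ← lintegral_const_mul _ (mY.indicator measurableSet_Icc)]
          refine lintegral_congr fun t => ?_
          by_cases ht : t ∈ Set.Icc (γ:ℝ) (γ + 1)
          · simp [Set.indicator_of_mem ht]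
          · simp [Set.indicator_of_notMem ht]
      _ = ENNReal.ofReal (C1 * lam ^ n) * ∫⁻ t, (∑ γ ∈ S, ENNReal.ofReal (c γ) * (Set.Icc (γ:ℝ) (γ + 1)).indicator 1 t) * Y t := by
          rw [← lintegral_finsetSum]
          · simp only [Finset.sum_mul]
          · intro γ _
            exact (measurable_const.mul (measurable_one.indicator measurableSet_Icc)).mul mY
      _ ≤ _ := by
          gcongr with t
          exact hW t
  have step2 : ∫⁻ t, ENNReal.ofReal (W t) * Y t ≤ ((b + 6 : ℕ) : ℝ≥0∞) * ∑ i ∈ Finset.range (b + 6),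
      ∫⁻ s, (∫⁻ t : ℝ, ENNReal.ofReal (W t) * ‖HH lam G1 G2 (pcs b i) t s‖ₑ ^ 2) ∂(kap n) := by
    have ml : ∀ A, MeasurableSet A → ∀ t, Measurable (fun s => ‖HH lam G1 G2 A t s‖ₑ ^ 2) := by
      intro A hA t
      have h := (mH A hA).comp (measurable_prodMk_left (x := t))
      exact h
    calc _ ≤ ∫⁻ t, ENNReal.ofReal (W t) * (((b + 6 : ℕ) : ℝ≥0∞) * ∑ i ∈ Finset.range (b + 6), ∫⁻ s, ‖HH lam G1 G2 (pcs b i) t s‖ₑ ^ 2 ∂(kap n)) := by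
          gcongr with t
          rw [← lintegral_finsetSum _ (fun i hi => ml _ (pcs_meas b i (Finset.mem_range.1 hi)) t),
            ← lintegral_const_mul _ (Finset.measurable_fun_sum _ (fun i hi => ml _ (pcs_meas b i (Finset.mem_range.1 hi)) t))]
          refine lintegral_mono_ae ?_
          filter_upwards [mm_int G1 G2 i1 i2] with s hs
          rw [HH_split lam G1 G2 b t s hs]
          exact sq_sum_enorm _ _
      _ = ((b + 6 : ℕ) : ℝ≥0∞) * ∑ i ∈ Finset.range (b + 6), ∫⁻ t, ENNReal.ofReal (W t) * ∫⁻ s, ‖HH lam G1 G2 (pcs b i) t s‖ₑ ^ 2 ∂(kap n) := by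
          have mi : ∀ i ∈ Finset.range (b + 6), Measurable (fun t => ENNReal.ofReal (W t) * ∫⁻ s, ‖HH lam G1 G2 (pcs b i) t s‖ₑ ^ 2 ∂(kap n)) := fun i hi =>
            mW.mul (mH _ (pcs_meas b i (Finset.mem_range.1 hi))).lintegral_prod_right'
          rw [← lintegral_finsetSum _ mi, ← lintegral_const_mul _ (Finset.measurable_fun_sum _ mi)]
          refine lintegral_congr fun t => ?_
          rw [mul_left_comm, Finset.mul_sum]
      _ = _ := by
          congr 1
          refine Finset.sum_congr rfl fun i hi => ?_
          have hm := pcs_meas b i (Finset.mem_range.1 hi)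
          rw [lintegral_lintegral_swap]
          · refine lintegral_congr fun t => ?_
            rw [lintegral_const_mul _ (ml _ hm t)]
          · have hsw : Measurable (fun q : ((Fin n → ℤ) × ℝ) × ℝ => ((q.2, q.1) : ℝ × ((Fin n → ℤ) × ℝ))) := measurable_snd.prodMk measurable_fst
            have h5 := (mH _ hm).comp hsw
            have h6 := mW.comp (measurable_snd : Measurable (fun q : ((Fin n → ℤ) × ℝ) × ℝ => q.2))
            have : Measurable (fun q : ((Fin n → ℤ) × ℝ) × ℝ => ENNReal.ofReal (W q.2) * ‖HH lam G1 G2 (pcs b i) q.2 q.1‖ₑ ^ 2) :=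
              h6.mul h5
            exact this.aemeasurable
  have step3 : ∀ i ∈ Finset.range (b + 6), ∫⁻ s, (∫⁻ t : ℝ, ENNReal.ofReal (W t) * ‖HH lam G1 G2 (pcs b i) t s‖ₑ ^ 2) ∂(kap n) ≤
      ENNReal.ofReal (C2 * Kd n lam N1 ((2:ℝ) ^ b)) * (ENNReal.ofReal (B ^ (1/2:ℝ)) * ENNReal.ofReal (∑ γ ∈ S, c γ ^ 2) ^ (1/2:ℝ)) * M := by
    intro i hi
    have hi' := Finset.mem_range.1 hi
    refine (time_piece lam G1 G2 m1 m2 i1 i2 _ (pcs_meas b i hi') W Wi W0 Ψ Ψm hΨ).trans ?_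
    refine (hZ lam N1 b i hi' hl h12 _ _ Ψ (fun j => (m1.comp (measurable_prodMk_left (x := j))).enorm) (fun j => (m2.comp (measurable_prodMk_left (x := j))).enorm) Ψm Ψs
      (fun j ζ h => s1 j ζ (by simpa using h)) (fun j ζ h => s2 j ζ (by simpa using h))).trans ?_
    refine mul_le_mul' (mul_le_mul' le_rfl ?_) le_rfl
    refine (ENNReal.rpow_le_rpow hΨ2 (by norm_num)).trans (le_of_eq ?_)
    rw [ENNReal.ofReal_mul B0.le, ENNReal.mul_rpow_of_nonneg _ _ (by norm_num), ENNReal.ofReal_rpow_of_nonneg B0.le (by norm_num)]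
  refine step1.trans ?_
  have hb : ((b + 6 : ℕ) : ℝ≥0∞) = ENNReal.ofReal ((b:ℝ) + 6) := by
    rw [← ENNReal.ofReal_natCast]; push_cast; rfl
  calc _ ≤ ENNReal.ofReal (C1 * lam ^ n) * (((b + 6 : ℕ) : ℝ≥0∞) * ∑ i ∈ Finset.range (b + 6),
        ENNReal.ofReal (C2 * Kd n lam N1 ((2:ℝ) ^ b)) * (ENNReal.ofReal (B ^ (1/2:ℝ)) * ENNReal.ofReal (∑ γ ∈ S, c γ ^ 2) ^ (1/2:ℝ)) * M) := by
        gcongr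
        refine step2.trans ?_
        gcongr with i hi
        exact step3 i hi
    _ = _ := by
        rw [Finset.sum_const, Finset.card_range, nsmul_eq_mul, hb]
        have e : C1 * C2 * B ^ (1/2:ℝ) * ((b:ℝ) + 6) ^ 2 * (lam ^ n * Kd n lam N1 ((2:ℝ) ^ b)) =
          (C1 * lam ^ n) * (((b:ℝ) + 6) * (((b:ℝ) + 6) * ((C2 * Kd n lam N1 ((2:ℝ) ^ b)) * B ^ (1/2:ℝ)))) := by ring
        rw [e, ENNReal.ofReal_mul (by positivity : 0 ≤ C1 * lam ^ n), ENNReal.ofReal_mul (by positivity : 0 ≤ (b:ℝ) + 6), ENNReal.ofReal_mul (by positivity : 0 ≤ (b:ℝ) + 6), ENNReal.ofReal_mul (by positivity : 0 ≤ C2 * Kd n lam N1 ((2:ℝ) ^ b))]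
        ring

-- part T
open MeasureTheory
open scoped ENNReal NNReal

lemma ph_pi {n : ℕ} (lam t : ℝ) (x ζ : Fin 1 → ℝ) (y : Fin n → ℝ) (j : Fin n → ℤ) :
    Complex.exp (Complex.I * ((((∑ i, x i * ζ i) + ∑ i, y i * ((j i : ℝ) / lam))
        - t * ((∑ i, (ζ i) ^ 2) + ∑ i, ((j i : ℝ) / lam) ^ 2) : ℝ) : ℂ)) = ph lam t (x 0) y (j, ζ 0) := by
  unfold ph
  simp only [Fin.sum_univ_one, Fin.isValue]

lemma ph_inv {n : ℕ} (lam t x : ℝ) (y : Fin n → ℝ) (k : (Fin n → ℤ) × ℝ) : ph lam t x y k ≠ 0 := by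
  unfold ph; exact Complex.exp_ne_zero _

lemma pi_one_int (f : ℝ → ℂ) : ∫ ζ : Fin 1 → ℝ, f (ζ 0) = ∫ x, f x :=
  (volume_preserving_funUnique (Fin 1) ℝ).integral_comp' f

lemma pi_one_lint (f : ℝ → ℝ≥0∞) : ∫⁻ ζ : Fin 1 → ℝ, f (ζ 0) = ∫⁻ x, f x :=
  (volume_preserving_funUnique (Fin 1) ℝ).lintegral_comp_emb (MeasurableEquiv.measurableEmbedding _) f

lemma one_dim_red (h : ℝ → ℂ) (P : ℝ → Prop) (hP : MeasurableSet {x | P x}) (hs : ∀ x, h x ≠ 0 → P x) :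
    ∃ G : ℝ → ℂ, Measurable G ∧ (∀ x, G x ≠ 0 → P x) ∧ (∀ u : ℝ → ℂ, Measurable u → (∀ x, u x ≠ 0) →
      ∫ x, h x * u x = ∫ x, G x * u x) ∧ ∫⁻ x, ‖G x‖ₑ ^ 2 ≤ ∫⁻ x, ‖h x‖ₑ ^ 2 := by
  by_cases ha : AEStronglyMeasurable h volume
  · obtain ⟨h', hm, he⟩ := ha
    refine ⟨{x | P x}.indicator h', hm.measurable.indicator hP, ?_, ?_, ?_⟩
    · intro x hx
      by_contra hc
      exact hx (Set.indicator_of_notMem (by exact hc) _)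
    all_goals
      have hae : {x | P x}.indicator h' =ᵐ[volume] h := by
        filter_upwards [he] with x hx
        by_cases hp : P x
        · rw [Set.indicator_of_mem (by exact hp), hx]
        · rw [Set.indicator_of_notMem (by exact hp)]
          by_contra hc
          exact hp (hs x (Ne.symm hc))
    · intro u _ _
      refine integral_congr_ae ?_
      filter_upwards [hae] with x hx
      rw [hx]
    · refine le_of_eq (lintegral_congr_ae ?_)
      filter_upwards [hae] with x hx
      rw [hx]
  · refine ⟨fun _ => 0, measurable_const, fun x h => absurd rfl h, ?_, by simp⟩
    intro u hu hu0
    simp only [zero_mul, integral_zero]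
    refine integral_non_aestronglyMeasurable fun hc => ha ?_
    have := hc.mul hu.inv.aestronglyMeasurable
    refine this.congr (Filter.Eventually.of_forall fun x => ?_)
    simp only [Pi.mul_apply, Pi.inv_apply]
    rw [mul_assoc, mul_inv_cancel₀ (hu0 x), mul_one]

def QS {n : ℕ} (lam N : ℝ) (j : Fin n → ℤ) (ζ : ℝ) : Prop :=
  ζ ^ 2 + ∑ i, ((j i : ℝ) / lam) ^ 2 ≤ (2 * N) ^ 2 ∧ (1 < N → (N / 2) ^ 2 ≤ ζ ^ 2 + ∑ i, ((j i : ℝ) / lam) ^ 2)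

lemma QS_meas {n : ℕ} (lam N : ℝ) (j : Fin n → ℤ) : MeasurableSet {ζ : ℝ | QS lam N j ζ} := by
  have h1 : MeasurableSet {ζ : ℝ | ζ ^ 2 + ∑ i, ((j i : ℝ) / lam) ^ 2 ≤ (2 * N) ^ 2} := measurableSet_le (by fun_prop) (by fun_prop)
  have h2 : MeasurableSet {ζ : ℝ | (1 < N → (N / 2) ^ 2 ≤ ζ ^ 2 + ∑ i, ((j i : ℝ) / lam) ^ 2)} := by
    by_cases hN : 1 < N
    · simp only [hN, true_imp_iff]; exact measurableSet_le (by fun_prop) (by fun_prop)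
    · simp [hN]
  exact h1.inter h2

lemma QS_bdd {n : ℕ} {lam N : ℝ} (hl : 1 ≤ lam) (hN : 1 ≤ N) : ∃ T : Set ((Fin n → ℤ) × ℝ), MeasurableSet T ∧ kap n T < ⊤ ∧
    ∀ j ζ, QS lam N j ζ → (j, ζ) ∈ T := by
  obtain ⟨M, hM⟩ := exists_nat_ge (2 * N * lam)
  have hF : (Set.Icc (fun _ : Fin n => -(M:ℤ)) (fun _ => (M:ℤ))).Finite := Set.finite_Icc _ _
  refine ⟨(Set.Icc (fun _ : Fin n => -(M:ℤ)) (fun _ => (M:ℤ))) ×ˢ Set.Icc (-(2*N)) (2*N), hF.measurableSet.prod measurableSet_Icc, ?_, ?_⟩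
  · rw [Measure.prod_prod]
    refine ENNReal.mul_lt_top ?_ (by simp)
    exact Measure.count_apply_lt_top.2 hF
  · rintro j ζ ⟨h, -⟩
    have h0 : 0 ≤ ∑ i, ((j i : ℝ) / lam) ^ 2 := Finset.sum_nonneg fun i _ => sq_nonneg _
    have hz : |ζ| ≤ 2 * N := abs_le_of_sq_le_sq (by linarith) (by linarith)
    have hj : ∀ i, |(j i : ℝ)| ≤ M := by
      intro i
      have h1 : ((j i : ℝ) / lam) ^ 2 ≤ ∑ i, ((j i : ℝ) / lam) ^ 2 :=
        Finset.single_le_sum (f := fun i => ((j i : ℝ) / lam) ^ 2) (fun i _ => sq_nonneg _) (Finset.mem_univ i)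
      have h2 : |(j i : ℝ) / lam| ≤ 2 * N := abs_le_of_sq_le_sq (by nlinarith [sq_nonneg ζ]) (by linarith)
      rw [abs_div, abs_of_pos (by linarith : 0 < lam), div_le_iff₀ (by linarith)] at h2
      linarith
    refine ⟨⟨fun i => ?_, fun i => ?_⟩, abs_le.1 hz⟩
    · have := (abs_le.1 (hj i)).1
      exact_mod_cast this
    · have := (abs_le.1 (hj i)).2
      exact_mod_cast this

lemma reduction {n : ℕ} {lam N : ℝ} (hl : 1 ≤ lam) (hN : 1 ≤ N) (g : (Fin 1 → ℝ) → (Fin n → ℤ) → ℂ)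
    (hg : SuppIn lam g N) (hf : ∑' j : Fin n → ℤ, ∫⁻ ζ : Fin 1 → ℝ, (‖g ζ j‖₊ : ℝ≥0∞) ^ 2 ≠ ⊤) :
    ∃ G : (Fin n → ℤ) × ℝ → ℂ, Measurable G ∧ Integrable G (kap n) ∧ (∀ j ζ, G (j, ζ) ≠ 0 → QS lam N j ζ) ∧
      (∀ t x y, waveU lam g t x y = ((1 / lam ^ n : ℝ) : ℂ) * wv lam G t (x 0) y) ∧
      ∑' j, ∫⁻ x, ‖G (j, x)‖ₑ ^ 2 ≤ ∑' j : Fin n → ℤ, ∫⁻ ζ : Fin 1 → ℝ, (‖g ζ j‖₊ : ℝ≥0∞) ^ 2 := by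
  have hgz : ∀ (ζ : Fin 1 → ℝ), (fun _ => ζ 0) = ζ := fun ζ => by ext i; rw [Subsingleton.elim i 0]
  have hsup : ∀ j (x : ℝ), g (fun _ => x) j ≠ 0 → QS lam N j x := by
    intro j x hx
    obtain ⟨h1, h2⟩ := hg _ _ hx
    unfold freqNorm at h1 h2
    simp only [Fin.sum_univ_one] at h1 h2
    refine ⟨(Real.sqrt_le_left (by linarith)).1 h1, fun h => (Real.le_sqrt' (by linarith)).1 (h2 h)⟩
  choose G Gm Gs Gi G2 using fun j => one_dim_red (fun x => g (fun _ => x) j) (QS lam N j) (QS_meas lam N j) (hsup j)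
  have hm : Measurable (fun k : (Fin n → ℤ) × ℝ => G k.1 k.2) := measurable_from_prod_countable_right (fun j => Gm j)
  have hle : ∑' j, ∫⁻ x, ‖G j x‖ₑ ^ 2 ≤ ∑' j : Fin n → ℤ, ∫⁻ ζ : Fin 1 → ℝ, (‖g ζ j‖₊ : ℝ≥0∞) ^ 2 := by
    refine ENNReal.tsum_le_tsum fun j => (G2 j).trans (le_of_eq ?_)
    rw [← pi_one_lint]
    refine lintegral_congr fun ζ => ?_
    simp only [hgz]; rfl
  have hInt : Integrable (fun k : (Fin n → ℤ) × ℝ => G k.1 k.2) (kap n) := by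
    refine ⟨hm.aestronglyMeasurable, ?_⟩
    obtain ⟨T, Tm, Tf, hT⟩ := QS_bdd (n := n) hl hN
    have hp : ∀ k : (Fin n → ℤ) × ℝ, ‖G k.1 k.2‖ₑ ≤ T.indicator 1 k + ‖G k.1 k.2‖ₑ ^ 2 := by
      intro k
      by_cases h0 : G k.1 k.2 = 0
      · simp [h0]
      · have : k ∈ T := hT _ _ (Gs _ _ h0)
        rw [Set.indicator_of_mem this]
        rcases le_total ‖G k.1 k.2‖ₑ 1 with h | h
        · exact h.trans le_self_add
        · refine le_trans ?_ le_add_self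
          exact le_self_pow₀ h (by norm_num)
    refine lt_of_le_of_lt (lintegral_mono hp) ?_
    rw [lintegral_add_left (measurable_one.indicator Tm), lintegral_indicator_one Tm,
      lintegral_kap _ (hm.enorm.pow_const 2).aemeasurable]
    exact ENNReal.add_lt_top.2 ⟨Tf, hle.trans_lt hf.lt_top⟩
  refine ⟨fun k => G k.1 k.2, hm, hInt, fun j ζ h => Gs j ζ h, ?_, hle⟩
  intro t x y
  unfold waveU wv
  congr 1
  have hI : Integrable (fun k : (Fin n → ℤ) × ℝ => G k.1 k.2 * ph lam t (x 0) y k) (kap n) :=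
    hInt.mul_bdd (c := 1) (meas_ph lam t (x 0) y).aestronglyMeasurable (Filter.Eventually.of_forall (norm_ph lam t (x 0) y))
  rw [integral_prod _ hI, integral_countable hI.integral_prod_left]
  refine tsum_congr fun j => ?_
  have e1 : Measure.real (Measure.count : Measure (Fin n → ℤ)) {j} = 1 := by
    simp [Measure.real]
  rw [e1, one_smul]
  have mp : Measurable (fun x' => ph lam t (x 0) y (j, x')) := (meas_ph lam t (x 0) y).comp (measurable_prodMk_left (x := j))
  rw [← Gi j _ mp (fun _ => ph_inv _ _ _ _ _), ← pi_one_int]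
  refine integral_congr_ae (Filter.Eventually.of_forall fun ζ => ?_)
  simp only [ph_pi, hgz]

-- part U
open MeasureTheory
open scoped ENNReal NNReal

lemma dual_l2 (a : ℤ → ℝ≥0∞) (D : ℝ≥0∞) (hD : D ≠ ⊤)
    (h : ∀ (S : Finset ℤ) (c : ℤ → ℝ), (∀ γ, 0 ≤ c γ) → ∑ γ ∈ S, ENNReal.ofReal (c γ) * a γ ≤ D * ENNReal.ofReal (∑ γ ∈ S, c γ ^ 2) ^ (1/2:ℝ)) :
    ∑' γ, a γ ^ 2 ≤ D ^ 2 := by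
  have ha : ∀ γ, a γ ≠ ⊤ := by
    intro γ
    have := h {γ} (fun _ => 1) (fun _ => zero_le_one)
    simp at this
    exact (this.trans_lt hD.lt_top).ne
  rw [ENNReal.tsum_eq_iSup_sum]
  refine iSup_le fun S => ?_
  have h1 := h S (fun γ => (a γ).toReal) (fun _ => ENNReal.toReal_nonneg)
  have e1 : ∑ γ ∈ S, ENNReal.ofReal ((a γ).toReal) * a γ = ∑ γ ∈ S, a γ ^ 2 :=
    Finset.sum_congr rfl fun γ _ => by rw [ENNReal.ofReal_toReal (ha γ), sq]
  have e2 : ENNReal.ofReal (∑ γ ∈ S, (a γ).toReal ^ 2) = ∑ γ ∈ S, a γ ^ 2 := by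
    rw [ENNReal.ofReal_sum_of_nonneg (fun _ _ => by positivity)]
    exact Finset.sum_congr rfl fun γ _ => by rw [ENNReal.ofReal_pow ENNReal.toReal_nonneg, ENNReal.ofReal_toReal (ha γ)]
  rw [e1, e2] at h1
  set z := ∑ γ ∈ S, a γ ^ 2 with hz
  have hzt : z ≠ ⊤ := (ENNReal.sum_lt_top.2 fun γ _ => ENNReal.pow_lt_top (ha γ).lt_top).ne
  by_cases hz0 : z = 0
  · rw [hz0]; exact zero_le
  have hw : (z ^ (1/2:ℝ)) ^ 2 = z := sq_half z
  set w := z ^ (1/2:ℝ) with hw'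
  have hw0 : w ≠ 0 := by rintro h0; rw [h0] at hw; exact hz0 (by rw [← hw]; simp)
  have hwt : w ≠ ⊤ := by rintro h0; rw [h0] at hw; exact hzt (by rw [← hw]; simp)
  rw [← hw]
  gcongr
  rw [← hw, sq] at h1
  exact (ENNReal.mul_le_mul_iff_left hw0 hwt).1 h1

lemma Kd_eq (n : ℕ) (hn : 1 ≤ n) {lam N1 N2 : ℝ} (hl : 1 ≤ lam) (h2 : 1 ≤ N2) :
    Kd n lam N1 N2 = lam ^ n * (if n = 1 then 1 / lam + N2 / N1
              else N2 ^ ((n : ℝ) - 2) / lam + N2 ^ (n : ℝ) / N1) := by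
  have hl0 : lam ≠ 0 := by positivity
  unfold Kd
  by_cases h : n = 1
  · subst h
    simp only [if_true]
    field_simp
  · rw [if_neg h, if_neg h]
    obtain ⟨m, rfl⟩ : ∃ m, n = m + 2 := ⟨n - 2, by omega⟩
    have e : ((m + 2 : ℕ) : ℝ) - 2 = (m : ℝ) := by push_cast; ring
    rw [e, Real.rpow_natCast, Real.rpow_natCast]
    have e1 : m + 2 - 1 = m + 1 := by omega
    have e2 : m + 2 - 2 = m := by omega
    rw [e1, e2, mul_add]
    have : lam ^ (m + 2) * (N2 ^ m / lam) = lam ^ (m + 1) * N2 ^ m := by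
      rw [pow_succ lam (m+1)]; field_simp
    rw [this, mul_div_assoc]

lemma zero_wave {n : ℕ} {lam N : ℝ} (hl : 1 ≤ lam) (hN : 1 ≤ N) (g : (Fin 1 → ℝ) → (Fin n → ℤ) → ℂ)
    (hg : SuppIn lam g N) (hf : ∑' j : Fin n → ℤ, ∫⁻ ζ : Fin 1 → ℝ, (‖g ζ j‖₊ : ℝ≥0∞) ^ 2 = 0) (t : ℝ) (x : Fin 1 → ℝ) (y : Fin n → ℝ) :
    waveU lam g t x y = 0 := by
  obtain ⟨G, Gm, Gi, -, hw, hle⟩ := reduction hl hN g hg (by rw [hf]; simp)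
  rw [hw, hf] at *
  have h0 : ∫⁻ k, ‖G k‖ₑ ^ 2 ∂(kap n) = 0 := by
    rw [lintegral_kap _ (Gm.enorm.pow_const 2).aemeasurable]
    exact le_antisymm hle zero_le
  rw [lintegral_eq_zero_iff (Gm.enorm.pow_const 2)] at h0
  have : wv lam G t (x 0) y = 0 := by
    unfold wv
    refine integral_eq_zero_of_ae ?_
    filter_upwards [h0] with k hk
    have : G k = 0 := by simpa using hk
    simp [this]
  rw [this, mul_zero]

lemma log_loss (ε : ℝ) (hε : 0 < ε) : ∃ C : ℝ, 0 < C ∧ ∀ b : ℕ, (b:ℝ) + 6 ≤ C * ((2:ℝ) ^ b) ^ ε := by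
  have hl : 0 < Real.log 2 := Real.log_pos (by norm_num)
  refine ⟨6 + 1 / (ε * Real.log 2), by positivity, fun b => ?_⟩
  have h1 : ((2:ℝ) ^ b) ^ ε = Real.exp (b * (ε * Real.log 2)) := by
    rw [Real.rpow_def_of_pos (by positivity), Real.log_pow]; ring_nf
  have h2 := Real.add_one_le_exp ((b:ℝ) * (ε * Real.log 2))
  rw [h1]
  have hq : 0 < ε * Real.log 2 := by positivity
  calc (b:ℝ) + 6 ≤ (6 + 1 / (ε * Real.log 2)) * ((b:ℝ) * (ε * Real.log 2) + 1) := by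
        have : (6 + 1 / (ε * Real.log 2)) * ((b:ℝ) * (ε * Real.log 2) + 1) = b + 6 + (6 * ((b:ℝ) * (ε * Real.log 2)) + 1 / (ε * Real.log 2)) := by
          field_simp; ring
        rw [this]
        have : 0 ≤ 6 * ((b:ℝ) * (ε * Real.log 2)) + 1 / (ε * Real.log 2) := by positivity
        linarith
    _ ≤ _ := by gcongr

lemma finite_case (n : ℕ) (hn : 1 ≤ n) : ∃ C : ℝ, 0 < C ∧ ∀ (lam N1 : ℝ) (b : ℕ) (g1 g2 : (Fin 1 → ℝ) → (Fin n → ℤ) → ℂ),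
    1 ≤ lam → (2:ℝ) ^ b ≤ N1 → SuppIn lam g1 N1 → SuppIn lam g2 (2 ^ b) →
    ∑' j : Fin n → ℤ, ∫⁻ ζ : Fin 1 → ℝ, (‖g1 ζ j‖₊ : ℝ≥0∞) ^ 2 ≠ ⊤ → ∑' j : Fin n → ℤ, ∫⁻ ζ : Fin 1 → ℝ, (‖g2 ζ j‖₊ : ℝ≥0∞) ^ 2 ≠ ⊤ →
    ∑' γ : ℤ, (∫⁻ t in Set.Icc (γ : ℝ) ((γ : ℝ) + 1), ∫⁻ x : Fin 1 → ℝ,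
          ∫⁻ y in torusBox lam n,
          (‖waveU lam g1 t x y * waveU lam g2 t x y‖₊ : ℝ≥0∞) ^ 2) ^ 2 ≤
      (ENNReal.ofReal (C * ((b:ℝ) + 6) ^ 2 * (Kd n lam N1 (2 ^ b) / lam ^ n)) * (l2sq lam g1 * l2sq lam g2)) ^ 2 := by
  obtain ⟨C, C0, hC⟩ := core n hn
  refine ⟨C, C0, fun lam N1 b g1 g2 hl h12 s1 s2 f1 f2 => ?_⟩
  have hN2 : (1:ℝ) ≤ 2 ^ b := one_le_pow₀ (by norm_num)
  have hK : 0 ≤ Kd n lam N1 ((2:ℝ) ^ b) := (Kd_pos n hl hN2 h12).le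
  obtain ⟨G1, m1, i1, q1, w1, l1⟩ := reduction hl (hN2.trans h12) g1 s1 f1
  obtain ⟨G2, m2, i2, q2, w2, l2⟩ := reduction hl hN2 g2 s2 f2
  have hl0 : 0 < lam := by linarith
  set q : ℝ := 1 / lam ^ n with hq
  have q0 : 0 < q := by positivity
  set T1 := ∑' j : Fin n → ℤ, ∫⁻ ζ : Fin 1 → ℝ, (‖g1 ζ j‖₊ : ℝ≥0∞) ^ 2 with hT1
  set T2 := ∑' j : Fin n → ℤ, ∫⁻ ζ : Fin 1 → ℝ, (‖g2 ζ j‖₊ : ℝ≥0∞) ^ 2 with hT2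
  have L1 : l2sq lam g1 = ENNReal.ofReal q * T1 := rfl
  have L2 : l2sq lam g2 = ENNReal.ofReal q * T2 := rfl
  have hqt : ENNReal.ofReal q ^ 4 ≠ ⊤ := ENNReal.pow_ne_top ENNReal.ofReal_ne_top
  have hpt : ∀ t x y, (‖waveU lam g1 t x y * waveU lam g2 t x y‖₊ : ℝ≥0∞) ^ 2 = ENNReal.ofReal q ^ 4 * ‖wv lam G1 t (x 0) y * wv lam G2 t (x 0) y‖ₑ ^ 2 := by
    intro t x y
    change ‖waveU lam g1 t x y * waveU lam g2 t x y‖ₑ ^ 2 = _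
    have hqn : ‖((q : ℝ) : ℂ)‖ₑ = ENNReal.ofReal q := by
      rw [← ofReal_norm, Complex.norm_real, Real.norm_of_nonneg q0.le]
    rw [w1, w2, enorm_mul, enorm_mul, enorm_mul, enorm_mul, hqn]
    ring
  have ha : ∀ γ : ℤ, ∫⁻ t in Set.Icc (γ : ℝ) ((γ : ℝ) + 1), ∫⁻ x : Fin 1 → ℝ,
          ∫⁻ y in torusBox lam n, (‖waveU lam g1 t x y * waveU lam g2 t x y‖₊ : ℝ≥0∞) ^ 2 =
        ENNReal.ofReal q ^ 4 * ∫⁻ t in Set.Icc (γ : ℝ) ((γ : ℝ) + 1), XX lam G1 G2 t := by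
    intro γ
    rw [← lintegral_const_mul' _ _ hqt]
    refine lintegral_congr fun t => ?_
    unfold XX
    rw [← lintegral_const_mul' _ _ hqt, ← pi_one_lint]
    refine lintegral_congr fun x => ?_
    rw [← lintegral_const_mul' _ _ hqt]
    refine lintegral_congr fun y => ?_
    exact hpt t x y
  simp only [ha]
  refine dual_l2 _ _ ?_ fun S c hc => ?_
  · rw [L1, L2]
    exact ENNReal.mul_ne_top ENNReal.ofReal_ne_top (ENNReal.mul_ne_top (ENNReal.mul_ne_top ENNReal.ofReal_ne_top f1) (ENNReal.mul_ne_top ENNReal.ofReal_ne_top f2))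
  · have key := hC lam N1 b hl h12 G1 G2 m1 m2 i1 i2 q1 (fun j ζ h => (q2 j ζ h).1) S c hc
    calc ∑ γ ∈ S, ENNReal.ofReal (c γ) * (ENNReal.ofReal q ^ 4 * ∫⁻ t in Set.Icc (γ : ℝ) ((γ : ℝ) + 1), XX lam G1 G2 t)
        = ENNReal.ofReal q ^ 4 * ∑ γ ∈ S, ENNReal.ofReal (c γ) * ∫⁻ t in Set.Icc (γ : ℝ) ((γ : ℝ) + 1), XX lam G1 G2 t := by
          rw [Finset.mul_sum]
          exact Finset.sum_congr rfl fun γ _ => by ring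
      _ ≤ ENNReal.ofReal q ^ 4 * (ENNReal.ofReal (C * ((b:ℝ) + 6) ^ 2 * (lam ^ n * Kd n lam N1 ((2:ℝ) ^ b))) * ENNReal.ofReal (∑ γ ∈ S, c γ ^ 2) ^ (1/2:ℝ) * (T1 * T2)) := by
          refine mul_le_mul' le_rfl (key.trans ?_)
          exact mul_le_mul' le_rfl (mul_le_mul' l1 l2)
      _ = _ := by
          have e : C * ((b:ℝ) + 6) ^ 2 * (Kd n lam N1 (2 ^ b) / lam ^ n) = q ^ 2 * (C * ((b:ℝ) + 6) ^ 2 * (lam ^ n * Kd n lam N1 ((2:ℝ) ^ b))) := by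
            rw [hq]; field_simp
          rw [e, ENNReal.ofReal_mul (by positivity : 0 ≤ q ^ 2), ENNReal.ofReal_pow q0.le, L1, L2]
          ring

/-- **Global-in-time bilinear Strichartz estimate on `ℝ × 𝕋ⁿ_λ`** (Theorem 1.2 with `m = 1`). -/
theorem global_bilinear_estimate (n : ℕ) (hn : 1 ≤ n) :
    ∀ ε : ℝ, 0 < ε → ∃ C : ℝ, 0 < C ∧
    ∀ (lam N₁ N₂ : ℝ) (g₁ g₂ : (Fin 1 → ℝ) → (Fin n → ℤ) → ℂ),
      1 ≤ lam → IsDyadic N₁ → IsDyadic N₂ → N₂ ≤ N₁ → 1 ≤ N₂ →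
      SuppIn lam g₁ N₁ → SuppIn lam g₂ N₂ →
      (∑' γ : ℤ, (∫⁻ t in Set.Icc (γ : ℝ) ((γ : ℝ) + 1), ∫⁻ x : Fin 1 → ℝ,
          ∫⁻ y in torusBox lam n,
          (‖waveU lam g₁ t x y * waveU lam g₂ t x y‖₊ : ℝ≥0∞) ^ 2) ^ 2) ^ (1 / 4 : ℝ)
        ≤ ENNReal.ofReal (C * N₂ ^ ε *
            Real.sqrt (if n = 1 then 1 / lam + N₂ / N₁
              else N₂ ^ ((n : ℝ) - 2) / lam + N₂ ^ (n : ℝ) / N₁))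
          * (l2sq lam g₁) ^ (1 / 2 : ℝ) * (l2sq lam g₂) ^ (1 / 2 : ℝ) := by
  intro ε hε
  obtain ⟨C, C0, hC⟩ := finite_case n hn
  obtain ⟨E, E0, hE⟩ := log_loss ε hε
  refine ⟨Real.sqrt C * E, by positivity, fun lam N₁ N₂ g₁ g₂ hl _ hd h12 hN2 s1 s2 => ?_⟩
  obtain ⟨b, rfl⟩ := hd
  have hl0 : 0 < lam := by linarith
  have hKd := Kd_eq n hn (N1 := N₁) hl hN2
  have hKp := Kd_pos n hl hN2 h12
  set K : ℝ := if n = 1 then 1 / lam + 2 ^ b / N₁ else ((2:ℝ) ^ b) ^ ((n : ℝ) - 2) / lam + ((2:ℝ) ^ b) ^ (n : ℝ) / N₁ with hKdef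
  have hK : 0 < K := by
    rw [hKd] at hKp
    exact pos_of_mul_pos_right hKp (by positivity)
  have hq : ENNReal.ofReal (1 / lam ^ n) ≠ 0 := by
    rw [Ne, ENNReal.ofReal_eq_zero, not_le]; positivity
  have hc0 : ENNReal.ofReal (Real.sqrt C * E * ((2:ℝ) ^ b) ^ ε * Real.sqrt K) ≠ 0 := by
    rw [Ne, ENNReal.ofReal_eq_zero, not_le]; positivity
  have hz1 : l2sq lam g₁ = 0 → ∑' j : Fin n → ℤ, ∫⁻ ζ : Fin 1 → ℝ, (‖g₁ ζ j‖₊ : ℝ≥0∞) ^ 2 = 0 := fun h => (mul_eq_zero.1 h).resolve_left hq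
  have hz2 : l2sq lam g₂ = 0 → ∑' j : Fin n → ℤ, ∫⁻ ζ : Fin 1 → ℝ, (‖g₂ ζ j‖₊ : ℝ≥0∞) ^ 2 = 0 := fun h => (mul_eq_zero.1 h).resolve_left hq
  by_cases h01 : l2sq lam g₁ = 0
  · have := zero_wave hl (hN2.trans h12) g₁ s1 (hz1 h01)
    simp [this]
  by_cases h02 : l2sq lam g₂ = 0
  · have := zero_wave hl hN2 g₂ s2 (hz2 h02)
    simp [this]
  have hr1 : l2sq lam g₁ ^ (1/2:ℝ) ≠ 0 := by simp [h01]
  have hr2 : l2sq lam g₂ ^ (1/2:ℝ) ≠ 0 := by simp [h02]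
  by_cases ht1 : ∑' j : Fin n → ℤ, ∫⁻ ζ : Fin 1 → ℝ, (‖g₁ ζ j‖₊ : ℝ≥0∞) ^ 2 = ⊤
  · have : l2sq lam g₁ = ⊤ := by unfold l2sq; rw [ht1, ENNReal.mul_top hq]
    rw [this, ENNReal.top_rpow_of_pos (by norm_num), ENNReal.mul_top hc0, ENNReal.top_mul hr2]
    exact le_top
  by_cases ht2 : ∑' j : Fin n → ℤ, ∫⁻ ζ : Fin 1 → ℝ, (‖g₂ ζ j‖₊ : ℝ≥0∞) ^ 2 = ⊤
  · have : l2sq lam g₂ = ⊤ := by unfold l2sq; rw [ht2, ENNReal.mul_top hq]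
    rw [this, ENNReal.top_rpow_of_pos (by norm_num), ENNReal.mul_top (mul_ne_zero hc0 hr1)]
    exact le_top
  have main := hC lam N₁ b g₁ g₂ hl h12 s1 s2 ht1 ht2
  have hKq : Kd n lam N₁ (2 ^ b) / lam ^ n = K := by rw [hKd]; field_simp
  rw [hKq] at main
  refine (ENNReal.rpow_le_rpow main (by norm_num)).trans ?_
  rw [← ENNReal.rpow_natCast, ← ENNReal.rpow_mul]
  have e : ((2:ℕ):ℝ) * (1/4) = 1/2 := by norm_num
  rw [e, ENNReal.mul_rpow_of_nonneg _ _ (by norm_num), ENNReal.mul_rpow_of_nonneg _ _ (by norm_num), ← mul_assoc]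
  gcongr
  rw [ENNReal.ofReal_rpow_of_nonneg (by positivity) (by norm_num), ← Real.sqrt_eq_rpow]
  refine ENNReal.ofReal_le_ofReal ?_
  rw [Real.sqrt_mul (by positivity), Real.sqrt_mul C0.le, Real.sqrt_sq (by positivity), mul_assoc (Real.sqrt C) E]
  gcongr
  exact hE b
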